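/- Carleson estimate in C^{1,1/2} domains (Lemma 2.6): Let K>0. There exists a constant C>0 depending only on n, λ, Λ and K such that the following holds. Assume [g]_{C^{1,1/2}} ≤ K, and let u be a positive solution of u_t = Lu in 𝒞₁ vanishing continuously on Γ. Then sup over 𝒞_{2/3} of u is at most C·u(Ē). -/

import Mathlib

noncomputable section
open scoped BigOperators
open Classical

abbrev Spc (m : ℕ) := EuclideanSpace ℝ (Fin (m + 1))
abbrev Spc' (m : ℕ) := EuclideanSpace ℝ (Fin m)

/-- The horizontal coordinates `x' ∈ ℝ^{n-1}` of a point `x ∈ ℝⁿ`. -/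
def xprime {m : ℕ} (x : Spc m) : Spc' m :=
  (WithLp.equiv 2 _).symm fun i => x i.castSucc

/-- The last (vertical) coordinate `x_n` of a point `x ∈ ℝⁿ`. -/
def xlast {m : ℕ} (x : Spc m) : ℝ := x (Fin.last m)

/-- Build a point of `ℝⁿ` from `x' ∈ ℝ^{n-1}` and the vertical coordinate. -/
def mkPt {m : ℕ} (x' : Spc' m) (xn : ℝ) : Spc m :=
  (WithLp.equiv 2 _).symm fun i => if h : i = Fin.last m then xn else x' (i.castPred h)

/-- The `i`-th standard basis vector. -/
def eVec (m : ℕ) (i : Fin (m + 1)) : Spc m := EuclideanSpace.single i 1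

/-- The entry `∂²u/∂xᵢ∂xⱼ` of the spatial Hessian of `u(x,t)` at `p = (x,t)`. -/
def sHess {m : ℕ} (u : Spc m × ℝ → ℝ) (p : Spc m × ℝ) (i j : Fin (m + 1)) : ℝ :=
  fderiv ℝ (fun y => fderiv ℝ (fun z => u (z, p.2)) y (eVec m j)) p.1 (eVec m i)

/-- The operator `Lu = tr(A(x) D²ₓu)` at the point `p = (x,t)`. -/
def Lop {m : ℕ} (A : Spc m → Matrix (Fin (m + 1)) (Fin (m + 1)) ℝ)
    (u : Spc m × ℝ → ℝ) (p : Spc m × ℝ) : ℝ :=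
  ∑ i, ∑ j, A p.1 i j * sHess u p j i

/-- Uniform ellipticity with symmetric coefficients: `λ|ξ|² ≤ ξ·A(x)ξ ≤ Λ|ξ|²`. -/
def IsElliptic {m : ℕ} (lam Lam : ℝ)
    (A : Spc m → Matrix (Fin (m + 1)) (Fin (m + 1)) ℝ) : Prop :=
  (∀ x, (A x).IsSymm) ∧
  ∀ (x ξ : Spc m),
    lam * ‖ξ‖ ^ 2 ≤ ∑ i, ∑ j, ξ i * A x i j * ξ j ∧
      ∑ i, ∑ j, ξ i * A x i j * ξ j ≤ Lam * ‖ξ‖ ^ 2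

/-- `u` is (pointwise) a solution of `u_t = Lu` on `Ω`: twice continuously
differentiable in `x`, differentiable in `t`, with `∂ₜu = tr(A(x)D²ₓu)`. -/
def SolvesL {m : ℕ} (A : Spc m → Matrix (Fin (m + 1)) (Fin (m + 1)) ℝ)
    (u : Spc m × ℝ → ℝ) (Ω : Set (Spc m × ℝ)) : Prop :=
  ∀ p ∈ Ω, ContDiffAt ℝ 2 (fun y => u (y, p.2)) p.1 ∧
    HasDerivAt (fun s => u (p.1, s)) (Lop A u p) p.2

/-- `u` is a pointwise subsolution: `u_t ≤ Lu` on `Ω`. -/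
def SubSolvesL {m : ℕ} (A : Spc m → Matrix (Fin (m + 1)) (Fin (m + 1)) ℝ)
    (u : Spc m × ℝ → ℝ) (Ω : Set (Spc m × ℝ)) : Prop :=
  ∀ p ∈ Ω, ContDiffAt ℝ 2 (fun y => u (y, p.2)) p.1 ∧
    DifferentiableAt ℝ (fun s => u (p.1, s)) p.2 ∧
    deriv (fun s => u (p.1, s)) p.2 ≤ Lop A u p

/-- `u` solves the heat equation `∂ₜu = Δu` on `Ω`. -/
def SolvesHeat {m : ℕ} (u : Spc m × ℝ → ℝ) (Ω : Set (Spc m × ℝ)) : Prop :=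
  ∀ p ∈ Ω, ContDiffAt ℝ 2 (fun y => u (y, p.2)) p.1 ∧
    HasDerivAt (fun s => u (p.1, s)) (∑ i, sHess u p i i) p.2

/-- The graph `Γ = {x_n = g(x',t)}`. -/
def graphSet {m : ℕ} (g : Spc' m → ℝ → ℝ) : Set (Spc m × ℝ) :=
  {p | xlast p.1 = g (xprime p.1) p.2}

/-- The cylinder `𝒞_r` of size `r` on top of the graph of `g`. -/
def Cyl {m : ℕ} (g : Spc' m → ℝ → ℝ) (r : ℝ) : Set (Spc m × ℝ) :=
  {p | ‖xprime p.1‖ < r ∧ -r ^ 2 < p.2 ∧ p.2 < r ^ 2 ∧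
    g (xprime p.1) p.2 < xlast p.1 ∧ xlast p.1 < g (xprime p.1) p.2 + r}

/-- The point `Ē = ((0', g(0',1/2) + 1/2), 1/2)`. -/
def Ebar {m : ℕ} (g : Spc' m → ℝ → ℝ) : Spc m × ℝ := (mkPt 0 (g 0 (1 / 2) + 1 / 2), 1 / 2)

/-- The point `E̲ = ((0', g(0',−1/2) + 1/2), −1/2)`. -/
def Eund {m : ℕ} (g : Spc' m → ℝ → ℝ) : Spc m × ℝ := (mkPt 0 (g 0 (-(1 / 2)) + 1 / 2), -(1 / 2))

/-- `u` vanishes continuously on `Γ`: `u(Q) → 0` as `Q → P` within `Ω`,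
for every `P ∈ Γ` in the closure of `Ω`. -/
def VanishesOn {m : ℕ} (u : Spc m × ℝ → ℝ) (Ω Γ : Set (Spc m × ℝ)) : Prop :=
  ∀ P ∈ Γ ∩ closure Ω, Filter.Tendsto u (nhdsWithin P Ω) (nhds 0)

/-- `[g]_{C^{α,β}} ≤ K`. -/
def HolderSemi {m : ℕ} (α β K : ℝ) (g : Spc' m → ℝ → ℝ) : Prop :=
  ∀ x' y' t s, |g x' t - g y' s| ≤ K * (‖x' - y'‖ ^ α + |t - s| ^ β)

/-- The backward-in-time cylinder `𝒞_r^−` (Lipschitz setting, parabolic scaling). -/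
def CylB {m : ℕ} (g : Spc' m → ℝ → ℝ) (r : ℝ) : Set (Spc m × ℝ) :=
  {p | (∀ i : Fin m, -r < xprime p.1 i ∧ xprime p.1 i < r) ∧ -r ^ 2 < p.2 ∧ p.2 ≤ 0 ∧
    g (xprime p.1) p.2 < xlast p.1 ∧ xlast p.1 < g (xprime p.1) p.2 + r}

/-- The set `𝒜_r` of points of `𝒞_r^−` at height at least `δr` above `Γ`. -/
def ASet {m : ℕ} (g : Spc' m → ℝ → ℝ) (δ r : ℝ) : Set (Spc m × ℝ) :=
  {p ∈ CylB g r | g (xprime p.1) p.2 + δ * r ≤ xlast p.1}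

/-- The backward-in-time cylinder `𝒞_r^−` (Hölder setting, time interval `(−r,0]`). -/
def CylBH {m : ℕ} (g : Spc' m → ℝ → ℝ) (r : ℝ) : Set (Spc m × ℝ) :=
  {p | (∀ i : Fin m, -r < xprime p.1 i ∧ xprime p.1 i < r) ∧ -r < p.2 ∧ p.2 ≤ 0 ∧
    g (xprime p.1) p.2 < xlast p.1 ∧ xlast p.1 < g (xprime p.1) p.2 + r}

/-- The set `𝒜_r` of points of the Hölder cylinder `𝒞_r^−` at height at least `r^β` above `Γ`. -/
def ASetH {m : ℕ} (g : Spc' m → ℝ → ℝ) (β r : ℝ) : Set (Spc m × ℝ) :=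
  {p ∈ CylBH g r | g (xprime p.1) p.2 + r ^ β ≤ xlast p.1}

/-- The height `h_Γ(x,t) = x_n − g(x',t)` above the graph. -/
def hGamma {m : ℕ} (g : Spc' m → ℝ → ℝ) (p : Spc m × ℝ) : ℝ :=
  xlast p.1 - g (xprime p.1) p.2

section

open MeasureTheory Set Filter Topology
open scoped ENNReal

/-! ### Second-order calculus and linear algebra -/

/-- The second derivative of `f` at `x` as a bilinear form. -/
def hessForm {n : ℕ} (f : Spc' n → ℝ) (x : Spc' n) : Spc' n →L[ℝ] Spc' n →L[ℝ] ℝ :=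
  fderiv ℝ (fderiv ℝ f) x

/-- The pairing `tr(S B)` of a matrix with a bilinear form. -/
def tracePair {n : ℕ} (S : Matrix (Fin n) (Fin n) ℝ) (B : Spc' n →L[ℝ] Spc' n →L[ℝ] ℝ) : ℝ :=
  ∑ i, ∑ j, S i j * B (EuclideanSpace.single j 1) (EuclideanSpace.single i 1)

/-- The trace of a bilinear form. -/
def formTrace {n : ℕ} (B : Spc' n →L[ℝ] Spc' n →L[ℝ] ℝ) : ℝ :=
  ∑ i, B (EuclideanSpace.single i 1) (EuclideanSpace.single i 1)

/-- A symmetric matrix with spectrum in `[lam, Lam]`. -/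
def EllMat {n : ℕ} (lam Lam : ℝ) (S : Matrix (Fin n) (Fin n) ℝ) : Prop :=
  S.IsSymm ∧ ∀ ξ : Spc' n, lam * ‖ξ‖ ^ 2 ≤ ∑ i, ∑ j, ξ i * S i j * ξ j ∧
    ∑ i, ∑ j, ξ i * S i j * ξ j ≤ Lam * ‖ξ‖ ^ 2

/-- The inner product as a real bilinear form. -/
def innerForm (n : ℕ) : Spc' n →L[ℝ] Spc' n →L[ℝ] ℝ := innerSL ℝ

lemma innerForm_apply {n : ℕ} (x y : Spc' n) : innerForm n x y = inner ℝ x y := rfl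

section LinAlg

variable {n : ℕ} {lam Lam : ℝ} {S : Matrix (Fin n) (Fin n) ℝ}

lemma tracePair_add (B B' : Spc' n →L[ℝ] Spc' n →L[ℝ] ℝ) :
    tracePair S (B + B') = tracePair S B + tracePair S B' := by
  simp [tracePair, mul_add, Finset.sum_add_distrib]

lemma tracePair_smul (c : ℝ) (B : Spc' n →L[ℝ] Spc' n →L[ℝ] ℝ) :
    tracePair S (c • B) = c * tracePair S B := by
  simp only [tracePair, Finset.mul_sum, _root_.smul_apply, smul_eq_mul]
  refine Finset.sum_congr rfl fun i _ => Finset.sum_congr rfl fun j _ => by ring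

lemma tracePair_neg (B : Spc' n →L[ℝ] Spc' n →L[ℝ] ℝ) : tracePair S (-B) = -tracePair S B := by
  simp [tracePair, Finset.sum_neg_distrib]

lemma tracePair_sub (B B' : Spc' n →L[ℝ] Spc' n →L[ℝ] ℝ) :
    tracePair S (B - B') = tracePair S B - tracePair S B' := by
  rw [sub_eq_add_neg B, tracePair_add, tracePair_neg]; ring

lemma tracePair_innerForm : tracePair S (innerForm n) = S.trace := by
  simp [tracePair, Matrix.trace, innerForm_apply, EuclideanSpace.inner_single_right]

lemma tracePair_smulRight (x : Spc' n) :
    tracePair S ((innerForm n x).smulRight (innerForm n x)) = ∑ i, ∑ j, x i * S i j * x j := by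
  simp only [tracePair, ContinuousLinearMap.smulRight_apply, _root_.smul_apply,
    innerForm_apply, smul_eq_mul]
  refine Finset.sum_congr rfl fun i _ => Finset.sum_congr rfl fun j _ => ?_
  have h : ∀ i : Fin n, inner ℝ x (EuclideanSpace.single i (1 : ℝ)) = x i := fun i => by
    simp [EuclideanSpace.inner_single_right]
  rw [h, h]; ring

open scoped MatrixOrder in
/-- If `S ≥ lam` and `B ≥ 0` then `tr(S B) ≥ lam tr B`. -/
lemma EllMat.le_tracePair (hS : EllMat lam Lam S) {B : Spc' n →L[ℝ] Spc' n →L[ℝ] ℝ}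
    (hB : ∀ v, 0 ≤ B v v) : lam * formTrace B ≤ tracePair S B := by
  have hpsd : (S - lam • (1 : Matrix (Fin n) (Fin n) ℝ)).PosSemidef := by
    refine Matrix.PosSemidef.of_dotProduct_mulVec_nonneg ?_ ?_
    · rw [Matrix.IsHermitian, Matrix.conjTranspose_eq_transpose_of_trivial]
      simp [hS.1.eq]
    · intro v
      have h := (hS.2 (WithLp.toLp 2 v)).1
      rw [EuclideanSpace.norm_sq_eq] at h
      have e : star v ⬝ᵥ (S - lam • (1 : Matrix (Fin n) (Fin n) ℝ)).mulVec v
          = (∑ i, ∑ j, v i * S i j * v j) - lam * ∑ i, v i ^ 2 := by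
        simp only [star_trivial, Matrix.sub_mulVec, Matrix.smul_mulVec, Matrix.one_mulVec,
          dotProduct_sub, dotProduct_smul, smul_eq_mul]
        simp only [dotProduct, Matrix.mulVec, Finset.mul_sum, mul_assoc, sq]
      rw [e]
      simpa using h
  obtain ⟨R, hR⟩ := CStarAlgebra.nonneg_iff_eq_star_mul_self.1 (Matrix.nonneg_iff_posSemidef.2 hpsd)
  have hent : ∀ i j, S i j = (∑ k, R k i * R k j) + lam * (if i = j then 1 else 0) := by
    intro i j
    have := congrFun (congrFun hR i) j
    simp only [Matrix.sub_apply, Matrix.smul_apply, Matrix.one_apply, smul_eq_mul,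
      Matrix.star_eq_conjTranspose, Matrix.mul_apply, Matrix.conjTranspose_apply,
      star_trivial] at this
    linarith
  have key : tracePair S B = (∑ k, B (∑ j, R k j • EuclideanSpace.single j 1)
      (∑ i, R k i • EuclideanSpace.single i 1)) + lam * formTrace B := by
    simp only [tracePair, hent, add_mul, Finset.sum_add_distrib, formTrace]
    congr 1
    · simp only [map_sum, map_smul, _root_.sum_apply, _root_.smul_apply,
        smul_eq_mul, Finset.mul_sum, Finset.sum_mul]
      rw [Finset.sum_comm' (t' := Finset.univ) (s' := fun _ => Finset.univ) (by simp)]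
      rw [Finset.sum_congr rfl fun j _ => Finset.sum_comm]
      rw [Finset.sum_comm]
      refine Finset.sum_congr rfl fun k _ => ?_
      rw [Finset.sum_comm]
      refine Finset.sum_congr rfl fun i _ => Finset.sum_congr rfl fun j _ => by ring
    · simp [Finset.mul_sum]
  rw [key]
  have : 0 ≤ ∑ k, B (∑ j, R k j • EuclideanSpace.single j 1)
      (∑ i, R k i • EuclideanSpace.single i 1) := Finset.sum_nonneg fun k _ => hB _
  linarith

lemma formTrace_nonneg {B : Spc' n →L[ℝ] Spc' n →L[ℝ] ℝ} (hB : ∀ v, 0 ≤ B v v) :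
    0 ≤ formTrace B := Finset.sum_nonneg fun _ _ => hB _

lemma EllMat.tracePair_nonneg (hlam : 0 ≤ lam) (hS : EllMat lam Lam S)
    {B : Spc' n →L[ℝ] Spc' n →L[ℝ] ℝ} (hB : ∀ v, 0 ≤ B v v) : 0 ≤ tracePair S B :=
  (mul_nonneg hlam (formTrace_nonneg hB)).trans (hS.le_tracePair hB)

lemma EllMat.diag_le (hS : EllMat lam Lam S) (i : Fin n) : lam ≤ S i i ∧ S i i ≤ Lam := by
  have h := hS.2 (EuclideanSpace.single i 1)
  simpa [Pi.single_apply] using h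

lemma EllMat.trace_le (hS : EllMat lam Lam S) : S.trace ≤ n * Lam := by
  rw [Matrix.trace]
  refine (Finset.sum_le_sum fun i _ => (hS.diag_le i).2).trans ?_
  simp

/-- The vector representing a linear functional. -/
def sharp (n : ℕ) : (Spc' n →L[ℝ] ℝ) →L[ℝ] Spc' n :=
  ∑ i, (ContinuousLinearMap.apply ℝ ℝ (EuclideanSpace.single i (1 : ℝ))).smulRight
    (EuclideanSpace.single i (1 : ℝ))

lemma inner_sharp (l : Spc' n →L[ℝ] ℝ) (v : Spc' n) : inner ℝ (sharp n l) v = l v := by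
  have hv : v = ∑ i, v i • EuclideanSpace.single i (1 : ℝ) := by
    ext j; simp [Pi.single_apply]
  conv_rhs => rw [hv]
  simp [sharp, sum_inner, inner_smul_left, EuclideanSpace.inner_single_left, mul_comm]

/-- The determinant of a nonnegative symmetric form is at most its trace to the power `n`. -/
lemma abs_det_sharp_le {B : Spc' n →L[ℝ] Spc' n →L[ℝ] ℝ} (hsymm : ∀ u v, B u v = B v u)
    (hB : ∀ v, 0 ≤ B v v) : |((sharp n).comp B).det| ≤ formTrace B ^ n := by
  set T : Spc' n →ₗ[ℝ] Spc' n := ((sharp n).comp B).toLinearMap with hT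
  have hTapp : ∀ u v, inner ℝ (T u) v = B u v := fun u v => inner_sharp _ _
  have hpos : T.IsPositive := by
    refine ⟨fun u v => ?_, fun u => ?_⟩
    · rw [hTapp, real_inner_comm, hTapp, hsymm]
    · simpa [hTapp] using hB u
  have hn : Module.finrank ℝ (Spc' n) = n := by simp
  have htr : ∑ i, hpos.isSymmetric.eigenvalues hn i = formTrace B := by
    have h1 := hpos.isSymmetric.trace_eq_sum_eigenvalues hn
    simp only [RCLike.ofReal_real_eq_id, id] at h1
    rw [← h1, LinearMap.trace_eq_sum_inner T (EuclideanSpace.basisFun (Fin n) ℝ)]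
    simp only [formTrace, EuclideanSpace.basisFun_apply]
    exact Finset.sum_congr rfl fun i _ => by rw [real_inner_comm, hTapp]
  have hdet : ((sharp n).comp B).det = ∏ i, hpos.isSymmetric.eigenvalues hn i := by
    have := hpos.isSymmetric.det_eq_prod_eigenvalues hn
    simpa using this
  have hev := hpos.nonneg_eigenvalues hn
  rw [hdet, abs_of_nonneg (Finset.prod_nonneg fun i _ => hev i)]
  calc ∏ i, hpos.isSymmetric.eigenvalues hn i ≤ ∏ _i : Fin n, formTrace B := by
        refine Finset.prod_le_prod (fun i _ => hev i) fun i _ => ?_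
        rw [← htr]
        exact Finset.single_le_sum (fun j _ => hev j) (Finset.mem_univ i)
    _ = formTrace B ^ n := by simp

end LinAlg

section Calculus

variable {n : ℕ}

lemma ContDiffAt.hessForm_symm {f : Spc' n → ℝ} {x : Spc' n} (hf : ContDiffAt ℝ 2 f x)
    (u v : Spc' n) : hessForm f x u v = hessForm f x v u :=
  hf.isSymmSndFDerivAt (by simp) u v

lemma ContDiffAt.hasFDerivAt_fderiv_hessForm {f : Spc' n → ℝ} {x : Spc' n}
    (hf : ContDiffAt ℝ 2 f x) : HasFDerivAt (fderiv ℝ f) (hessForm f x) x :=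
  ((hf.fderiv_right (m := 1) (by norm_num)).differentiableAt (by norm_num)).hasFDerivAt

lemma hessForm_add {f g : Spc' n → ℝ} {x : Spc' n} (hf : ContDiffAt ℝ 2 f x)
    (hg : ContDiffAt ℝ 2 g x) : hessForm (fun y => f y + g y) x = hessForm f x + hessForm g x := by
  have h : fderiv ℝ (fun y => f y + g y) =ᶠ[𝓝 x] fun y => fderiv ℝ f y + fderiv ℝ g y := by
    filter_upwards [hf.eventually (by simp), hg.eventually (by simp)] with y h1 h2
    exact fderiv_fun_add (h1.differentiableAt (by norm_num)) (h2.differentiableAt (by norm_num))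
  rw [hessForm, h.fderiv_eq]
  exact (hf.hasFDerivAt_fderiv_hessForm.add hg.hasFDerivAt_fderiv_hessForm).fderiv

lemma hessForm_const_mul {f : Spc' n → ℝ} {x : Spc' n} (c : ℝ) (hf : ContDiffAt ℝ 2 f x) :
    hessForm (fun y => c * f y) x = c • hessForm f x := by
  have h : fderiv ℝ (fun y => c * f y) =ᶠ[𝓝 x] fun y => c • fderiv ℝ f y := by
    filter_upwards [hf.eventually (by simp)] with y h1
    exact fderiv_const_mul (h1.differentiableAt (by norm_num)) c
  rw [hessForm, h.fderiv_eq]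
  exact (hf.hasFDerivAt_fderiv_hessForm.const_smul c).fderiv

lemma hessForm_const (c : ℝ) (x : Spc' n) : hessForm (fun _ => c) x = 0 := by
  have : fderiv ℝ (fun _ : Spc' n => c) = fun _ => 0 := by ext1 y; simp
  rw [hessForm, this]; simp

/-- Second-order necessary condition at a local minimum. -/
lemma IsLocalMin.hessForm_nonneg {f : Spc' n → ℝ} {x : Spc' n} (hmin : IsLocalMin f x)
    (hf : ContDiffAt ℝ 2 f x) (v : Spc' n) : 0 ≤ hessForm f x v v := by
  by_contra! hneg
  set l : ℝ → Spc' n := fun τ => x + τ • v with hl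
  have hl0 : l 0 = x := by simp [hl]
  have hlc : Continuous l := by fun_prop
  have hld : ∀ τ, HasDerivAt l v τ := fun τ => by
    have := ((hasDerivAt_id τ).smul_const v).const_add x
    rwa [one_smul] at this
  have hd1 : deriv (fun τ => f (l τ)) =ᶠ[𝓝 (0 : ℝ)] fun τ => fderiv ℝ f (l τ) v := by
    have h := hf.eventually (by simp)
    rw [← hl0] at h
    filter_upwards [hlc.continuousAt.eventually h] with τ hτ
    exact ((hτ.differentiableAt (by norm_num)).hasFDerivAt.comp_hasDerivAt τ (hld τ)).deriv
  have hd2 : deriv (deriv fun τ => f (l τ)) 0 = hessForm f x v v := by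
    rw [hd1.deriv_eq]
    have h2 := hf.hasFDerivAt_fderiv_hessForm
    rw [← hl0] at h2
    have h3 := h2.comp_hasDerivAt 0 (hld 0)
    have h4 := h3.clm_apply (hasDerivAt_const (0 : ℝ) v)
    simpa [hl0] using h4.deriv
  have hcl : ContinuousAt (fun τ => f (l τ)) 0 := by
    refine ContinuousAt.comp ?_ hlc.continuousAt
    rw [hl0]; exact hf.continuousAt
  have hmin' : IsLocalMin (fun τ => f (l τ)) 0 := by
    have : ∀ᶠ y in 𝓝 (l 0), f x ≤ f y := by rw [hl0]; exact hmin
    filter_upwards [hlc.continuousAt.eventually this] with τ hτ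
    simpa [hl0] using hτ
  have hmax := isLocalMax_of_deriv_deriv_neg (by rw [hd2]; exact hneg) hmin'.deriv_eq_zero hcl
  have hc : (fun τ => f (l τ)) =ᶠ[𝓝 0] fun _ => f x := by
    filter_upwards [hmin', hmax] with τ h1 h2
    simp only [hl0] at h1 h2
    exact le_antisymm h2 h1
  have hc' : deriv (fun τ => f (l τ)) =ᶠ[𝓝 0] fun _ => 0 := by
    filter_upwards [hc.eventually_nhds] with τ hτ
    rw [EventuallyEq.deriv_eq (hτ : _ =ᶠ[𝓝 τ] _)]; simp
  rw [hc'.deriv_eq] at hd2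
  simp at hd2
  linarith

end Calculus

/-! ### Supersolutions and propagation of positivity -/

/-- At `p` the function `w` is a pointwise supersolution for some operator with ellipticity
constants `lam`, `Lam`. -/
def SuperAt {n : ℕ} (lam Lam : ℝ) (w : Spc' n × ℝ → ℝ) (p : Spc' n × ℝ) : Prop :=
  ContDiffAt ℝ 2 (fun y => w (y, p.2)) p.1 ∧
    ∃ (a : ℝ) (S : Matrix (Fin n) (Fin n) ℝ), HasDerivAt (fun s => w (p.1, s)) a p.2 ∧
      EllMat lam Lam S ∧ tracePair S (hessForm (fun y => w (y, p.2)) p.1) ≤ a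

section Touching

variable {n : ℕ} {lam Lam : ℝ}

lemma hessForm_eq_of_hasFDerivAt {F : Spc' n → ℝ} {G : Spc' n → Spc' n →L[ℝ] ℝ}
    {B : Spc' n →L[ℝ] Spc' n →L[ℝ] ℝ} {x : Spc' n} (hF : ∀ y, HasFDerivAt F (G y) y)
    (hG : HasFDerivAt G B x) : hessForm F x = B := by
  have : fderiv ℝ F = G := funext fun y => (hF y).fderiv
  rw [hessForm, this, hG.fderiv]

/-- If a function touches a supersolution from below, it inherits the inequality. -/
lemma SuperAt.touching {w : Spc' n × ℝ → ℝ} {p : Spc' n × ℝ} (hw : SuperAt lam Lam w p)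
    (hlam : 0 ≤ lam) {ψ : Spc' n → ℝ} (hψ : ContDiffAt ℝ 2 ψ p.1)
    (hmin : IsLocalMin (fun y => w (y, p.2) - ψ y) p.1) :
    ∃ (a : ℝ) (S : Matrix (Fin n) (Fin n) ℝ), HasDerivAt (fun s => w (p.1, s)) a p.2 ∧
      EllMat lam Lam S ∧ tracePair S (hessForm ψ p.1) ≤ a := by
  obtain ⟨hc, a, S, ha, hS, hle⟩ := hw
  refine ⟨a, S, ha, hS, ?_⟩
  have hneg : ContDiffAt ℝ 2 (fun y => (-1) * ψ y) p.1 := contDiffAt_const.mul hψ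
  have h1 : hessForm (fun y => w (y, p.2) + (-1) * ψ y) p.1
      = hessForm (fun y => w (y, p.2)) p.1 + (-1 : ℝ) • hessForm ψ p.1 := by
    rw [hessForm_add hc hneg, hessForm_const_mul _ hψ]
  have hmin' : IsLocalMin (fun y => w (y, p.2) + (-1) * ψ y) p.1 := by
    simpa [sub_eq_add_neg] using hmin
  have h2 := hS.tracePair_nonneg hlam (hmin'.hessForm_nonneg (hc.add hneg))
  rw [h1, tracePair_add, tracePair_smul] at h2
  linarith

lemma hasFDerivAt_normSq (x0 y : Spc' n) :
    HasFDerivAt (fun y => ‖y - x0‖ ^ 2) ((2 : ℝ) • innerForm n (y - x0)) y := by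
  have := (hasFDerivAt_sub_const (𝕜 := ℝ) (x := y) x0).norm_sq
  refine this.congr_fderiv ?_
  ext v
  simp [innerForm_apply]

lemma hasFDerivAt_innerForm_sub (x0 y : Spc' n) :
    HasFDerivAt (fun y => innerForm n (y - x0)) (innerForm n) y := by
  exact (innerForm n).hasFDerivAt.comp y (hasFDerivAt_sub_const (𝕜 := ℝ) (x := y) x0)

lemma hessForm_normSq (x0 y : Spc' n) :
    hessForm (fun y => ‖y - x0‖ ^ 2) y = (2 : ℝ) • innerForm n :=
  hessForm_eq_of_hasFDerivAt (hasFDerivAt_normSq x0)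
    ((hasFDerivAt_innerForm_sub x0 y).fun_const_smul 2)

lemma hessForm_bump (s c : ℝ) (x0 y : Spc' n) :
    hessForm (fun y => c * (s - ‖y - x0‖ ^ 2) ^ 2) y
      = (8 * c) • (innerForm n (y - x0)).smulRight (innerForm n (y - x0))
        - (4 * c * (s - ‖y - x0‖ ^ 2)) • innerForm n := by
  have hz : ∀ y : Spc' n, HasFDerivAt (fun y => s - ‖y - x0‖ ^ 2)
      (-((2 : ℝ) • innerForm n (y - x0))) y := fun y => (hasFDerivAt_normSq x0 y).const_sub s
  refine hessForm_eq_of_hasFDerivAt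
    (G := fun y => (-4 * c * (s - ‖y - x0‖ ^ 2)) • innerForm n (y - x0)) (fun y => ?_) ?_
  · refine (((hz y).pow 2).const_mul c).congr_fderiv ?_
    ext v
    simp
    ring
  · refine (((hz y).const_mul (-4 * c)).smul (hasFDerivAt_innerForm_sub x0 y)).congr_fderiv ?_
    ext u v
    simp
    ring

lemma contDiff_bump (s c : ℝ) (x0 : Spc' n) :
    ContDiff ℝ 2 (fun y => c * (s - ‖y - x0‖ ^ 2) ^ 2) := by
  have := (contDiff_id.sub (contDiff_const (c := x0))).norm_sq ℝ (n := 2) (E := Spc' n)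
  exact contDiff_const.mul ((contDiff_const.sub this).pow 2)

lemma HasDerivAt.nonpos_of_left_le {f : ℝ → ℝ} {a t t0 : ℝ} (hf : HasDerivAt f a t) (ht : t0 < t)
    (h : ∀ s ∈ Ioo t0 t, f t ≤ f s) : a ≤ 0 := by
  have h1 := (hasDerivAt_iff_tendsto_slope.1 hf).mono_left
    (nhdsWithin_mono t (show Iio t ⊆ {t}ᶜ from fun s hs => ne_of_lt hs))
  refine le_of_tendsto h1 ?_
  filter_upwards [Ioo_mem_nhdsLT ht] with s hs
  rw [slope_def_field]
  exact div_nonpos_of_nonneg_of_nonpos (sub_nonneg.2 (h s hs)) (sub_nonpos.2 hs.2.le)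

lemma barrier_quadratic {N β s z q : ℝ} (hlam : 0 < lam) (hs : 0 < s)
    (hq : (8 * lam + 4 * N * Lam + 2 * β) ^ 2 ≤ 32 * lam * q * β) :
    0 ≤ 8 * lam * (s - z) - 4 * N * Lam * z - (2 * z * β - q * β * z ^ 2 / s) := by
  have : 0 ≤ 32 * lam * (8 * lam * s ^ 2 - (8 * lam + 4 * N * Lam + 2 * β) * z * s
      + q * β * z ^ 2) := by
    have := mul_nonneg (sub_nonneg.2 hq) (sq_nonneg z)
    have := sq_nonneg (16 * lam * s - (8 * lam + 4 * N * Lam + 2 * β) * z)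
    linarith
  have := nonneg_of_mul_nonneg_right this (by positivity)
  have e : 8 * lam * (s - z) - 4 * N * Lam * z - (2 * z * β - q * β * z ^ 2 / s)
      = (8 * lam * s ^ 2 - (8 * lam + 4 * N * Lam + 2 * β) * z * s + q * β * z ^ 2) / s := by
    field_simp
    ring
  rw [e]
  positivity

set_option maxHeartbeats 1000000 in
/-- Propagation of positivity by an explicit barrier. -/
lemma barrier_propagation (hlam : 0 < lam) {w : Spc' n × ℝ → ℝ} {x0 : Spc' n}
    {t0 t1 δ R β h : ℝ} {q : ℕ} (hq2 : 2 ≤ q) (hβ : 0 < β) (hδ : 0 < δ)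
    (hR : δ ^ 2 + β * (t1 - t0) ≤ R ^ 2) (hR0 : 0 < R) (hh : 0 ≤ h)
    (hq : (8 * lam + 4 * n * Lam + 2 * β) ^ 2 ≤ 32 * lam * q * β)
    (hcont : ContinuousOn w (Metric.closedBall x0 R ×ˢ Icc t0 t1))
    (hpos : ∀ p ∈ Metric.closedBall x0 R ×ˢ Icc t0 t1, 0 ≤ w p)
    (hsup : ∀ p ∈ Metric.ball x0 R ×ˢ Ioc t0 t1, w p < h → SuperAt lam Lam w p)
    (hbase : ∀ x ∈ Metric.closedBall x0 δ, h ≤ w (x, t0)) (ht : t0 ≤ t1) {x1 : Spc' n}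
    (hx1 : ‖x1 - x0‖ ^ 2 ≤ δ ^ 2 + β * (t1 - t0)) :
    h * δ ^ (2 * q) / δ ^ 4 * (δ ^ 2 + β * (t1 - t0) - ‖x1 - x0‖ ^ 2) ^ 2
      / (δ ^ 2 + β * (t1 - t0)) ^ q ≤ w (x1, t1) := by
  set s : ℝ → ℝ := fun t => δ ^ 2 + β * (t - t0) with hs
  set k : ℝ := h * δ ^ (2 * q) / δ ^ 4 with hk
  have hk0 : 0 ≤ k := by positivity
  set φ : Spc' n × ℝ → ℝ := fun p => k * (s p.2 - ‖p.1 - x0‖ ^ 2) ^ 2 / s p.2 ^ q with hφ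
  by_contra! hlt
  have hspos : ∀ t, t0 ≤ t → δ ^ 2 ≤ s t := fun t h => by
    have := mul_nonneg hβ.le (sub_nonneg.2 h); simp only [hs]; linarith
  have hδ2 : 0 < δ ^ 2 := by positivity
  have hmono : ∀ t, t ≤ t1 → s t ≤ s t1 := fun t h => by
    have := mul_le_mul_of_nonneg_left h hβ.le; simp only [hs]; linarith
  have hφle : ∀ x t, t0 ≤ t → ‖x - x0‖ ^ 2 ≤ s t → φ (x, t) ≤ h := by
    intro x t ht' hx
    have hst := hspos t ht'
    have hst0 : 0 < s t := hδ2.trans_le hst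
    simp only [hφ, hk]
    obtain ⟨r, rfl⟩ := Nat.exists_eq_add_of_le hq2
    have e1 : (s t - ‖x - x0‖ ^ 2) ^ 2 ≤ s t ^ 2 :=
      pow_le_pow_left₀ (by linarith) (by nlinarith [sq_nonneg ‖x - x0‖]) 2
    have e2 : (δ ^ 2) ^ r ≤ s t ^ r := pow_le_pow_left₀ hδ2.le hst r
    rw [div_le_iff₀ (by positivity)]
    have e3 : h * δ ^ (2 * (2 + r)) / δ ^ 4 = h * (δ ^ 2) ^ r := by
      field_simp
      ring
    rw [e3, pow_add]
    calc h * (δ ^ 2) ^ r * (s t - ‖x - x0‖ ^ 2) ^ 2 ≤ h * s t ^ r * s t ^ 2 := by gcongr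
      _ = _ := by ring
  set K : Set (Spc' n × ℝ) :=
    (Metric.closedBall x0 R ×ˢ Icc t0 t1) ∩ {p | ‖p.1 - x0‖ ^ 2 ≤ s p.2} with hK
  have hKc : IsCompact K := by
    refine ((isCompact_closedBall x0 R).prod isCompact_Icc).inter_right ?_
    exact isClosed_le (by fun_prop) (by simp only [hs]; fun_prop)
  have hin : ∀ x t, t ∈ Icc t0 t1 → ‖x - x0‖ ^ 2 ≤ s t → (x, t) ∈ K := by
    intro x t ht' hx
    refine ⟨⟨?_, ht'⟩, hx⟩
    rw [Metric.mem_closedBall, dist_eq_norm]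
    exact abs_le_of_sq_le_sq' ((hx.trans (hmono t ht'.2)).trans hR) hR0.le |>.2
  have hK1 : (x1, t1) ∈ K := hin x1 t1 ⟨ht, le_rfl⟩ hx1
  have hφc : ContinuousOn φ K := by
    refine ContinuousOn.div (by simp only [hs]; fun_prop) (by simp only [hs]; fun_prop) ?_
    intro p hp
    exact pow_ne_zero _ (hδ2.trans_le (hspos p.2 hp.1.2.1)).ne'
  have hgap : 0 < φ (x1, t1) - w (x1, t1) := by simp only [hφ, hs]; linarith
  set η : ℝ := (φ (x1, t1) - w (x1, t1)) / (t1 - t0 + 1) with hη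
  have hη0 : 0 < η := div_pos hgap (by linarith)
  have hη1 : η * (t1 - t0) < φ (x1, t1) - w (x1, t1) := by
    rw [hη, div_mul_eq_mul_div, div_lt_iff₀ (by linarith)]
    nlinarith
  obtain ⟨⟨x, t⟩, hpK, hmin⟩ := hKc.exists_isMinOn ⟨_, hK1⟩
    (f := fun p => w p - φ p + η * (p.2 - t0))
    (((hcont.mono inter_subset_left).sub hφc).add (by fun_prop))
  have hval : w (x, t) - φ (x, t) + η * (t - t0) < 0 := by
    have := hmin hK1
    simp only [mem_ofPred_eq] at this
    linarith
  have htI : t ∈ Icc t0 t1 := hpK.1.2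
  have hxs : ‖x - x0‖ ^ 2 ≤ s t := hpK.2
  have hst0 : 0 < s t := hδ2.trans_le (hspos t htI.1)
  have hwφ : w (x, t) < φ (x, t) := by nlinarith [htI.1]
  have htgt : t0 < t := by
    refine lt_of_le_of_ne htI.1 fun he => ?_
    subst he
    have h1 : ‖x - x0‖ ≤ δ := by
      have : ‖x - x0‖ ^ 2 ≤ δ ^ 2 := by simpa [hs] using hxs
      exact abs_le_of_sq_le_sq' this hδ.le |>.2
    have := hbase x (by simpa [dist_eq_norm] using h1)
    have := hφle x t0 le_rfl hxs
    linarith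
  have hxlt : ‖x - x0‖ ^ 2 < s t := by
    refine lt_of_le_of_ne hxs fun he => ?_
    have h1 : φ (x, t) = 0 := by simp [hφ, he]
    have := hpos _ hpK.1
    linarith
  have hball : x ∈ Metric.ball x0 R := by
    rw [Metric.mem_ball, dist_eq_norm]
    exact lt_of_pow_lt_pow_left₀ 2 hR0.le ((hxlt.trans_le (hmono t htI.2)).trans_le hR)
  have hS := hsup (x, t) ⟨hball, htgt, htI.2⟩ (hwφ.trans_le (hφle x t htI.1 hxs))
  set c : ℝ := k / s t ^ q with hc
  have hφx : ∀ y, φ (y, t) = c * (s t - ‖y - x0‖ ^ 2) ^ 2 := fun y => by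
    simp only [hφ, hc]; ring
  obtain ⟨a, S, ha, hS, hle⟩ := hS.touching hlam.le
    (ψ := fun y => c * (s t - ‖y - x0‖ ^ 2) ^ 2) (contDiff_bump _ _ _).contDiffAt (by
      have : ∀ᶠ y in 𝓝 x, ‖y - x0‖ ^ 2 < s t :=
        ContinuousAt.eventually_lt (by fun_prop) continuousAt_const hxlt
      filter_upwards [this] with y hy
      have := hmin (hin y t htI hy.le)
      simp only [mem_ofPred_eq, hφx] at this
      linarith)
  rw [hessForm_bump, tracePair_sub, tracePair_smul, tracePair_smul, tracePair_smulRight,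
    tracePair_innerForm] at hle
  set z : ℝ := s t - ‖x - x0‖ ^ 2 with hz
  have hz0 : 0 < z := by rw [hz]; linarith
  have hφt : HasDerivAt (fun τ => φ (x, τ))
      (k * ((2 * z * β) / s t ^ q - q * β * z ^ 2 / s t ^ (q + 1))) t := by
    have hs' : HasDerivAt s β t := by
      have := (((hasDerivAt_id t).sub_const t0).const_mul β).const_add (δ ^ 2)
      rwa [mul_one] at this
    have h1 := (((hs'.sub_const (‖x - x0‖ ^ 2)).pow 2).const_mul k).div (hs'.pow q)
      (pow_ne_zero q hst0.ne')
    refine h1.congr_deriv ?_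
    obtain ⟨r, rfl⟩ : ∃ r, q = r + 1 := ⟨q - 1, by omega⟩
    simp only [Nat.add_sub_cancel, Pi.pow_apply, ← hz]
    field_simp
    push_cast
    ring
  have hτ0 : max t0 (t0 + (‖x - x0‖ ^ 2 - δ ^ 2) / β) < t := by
    refine max_lt htgt ?_
    have : (‖x - x0‖ ^ 2 - δ ^ 2) / β < t - t0 := by
      rw [div_lt_iff₀ hβ]; simp only [hs] at hxlt; linarith
    linarith
  have hleft := HasDerivAt.nonpos_of_left_le
    ((ha.sub hφt).add (((hasDerivAt_id t).sub_const t0).const_mul η)) hτ0 (by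
      intro τ hτ
      have h1 := (le_max_left _ _).trans_lt hτ.1
      have h2 := (le_max_right _ _).trans_lt hτ.1
      have hτK : ‖x - x0‖ ^ 2 ≤ s τ := by
        have : (‖x - x0‖ ^ 2 - δ ^ 2) / β < τ - t0 := by linarith
        rw [div_lt_iff₀ hβ] at this
        simp only [hs]; linarith
      simpa using hmin (hin x τ ⟨h1.le, hτ.2.le.trans htI.2⟩ hτK))
  have hell := (hS.2 (x - x0)).1
  have htr := hS.trace_le
  have hc0 : 0 ≤ c := by positivity
  have hxz : ‖x - x0‖ ^ 2 = s t - z := by rw [hz]; ring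
  rw [hxz] at hell
  have e1 : k * (2 * z * β / s t ^ q - q * β * z ^ 2 / s t ^ (q + 1))
      = c * (2 * z * β - q * β * z ^ 2 / s t) := by
    simp only [hc, pow_succ]; field_simp
  have hquad : 0 ≤ 8 * lam * (s t - z) - 4 * n * Lam * z - (2 * z * β - q * β * z ^ 2 / s t) :=
    barrier_quadratic hlam hst0 hq
  have h1 := mul_le_mul_of_nonneg_left hell (mul_nonneg (by norm_num : (0 : ℝ) ≤ 8) hc0)
  have h2 := mul_le_mul_of_nonneg_left htr (mul_nonneg (mul_nonneg (by norm_num : (0 : ℝ) ≤ 4) hc0)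
    hz0.le)
  have h3 := mul_nonneg hc0 hquad
  rw [e1] at hleft
  linarith

/-- Positivity spreads with a polynomial loss. -/
lemma exists_propagation (n : ℕ) {lam Lam θ₁ θ₂ : ℝ} (hlam : 0 < lam) (hθ₁ : 0 < θ₁) (hθ : θ₁ ≤ θ₂) :
    ∃ q : ℕ, ∀ (w : Spc' n × ℝ → ℝ) (x0 : Spc' n) (t0 t1 δ R h : ℝ), 0 < δ → δ ≤ R → 0 ≤ h →
      θ₁ * R ^ 2 ≤ t1 - t0 → t1 - t0 ≤ θ₂ * R ^ 2 →
      ContinuousOn w (Metric.closedBall x0 (2 * R) ×ˢ Icc t0 t1) →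
      (∀ p ∈ Metric.closedBall x0 (2 * R) ×ˢ Icc t0 t1, 0 ≤ w p) →
      (∀ p ∈ Metric.ball x0 (2 * R) ×ˢ Ioc t0 t1, w p < h → SuperAt lam Lam w p) →
      (∀ x ∈ Metric.closedBall x0 δ, h ≤ w (x, t0)) →
      ∀ x ∈ Metric.closedBall x0 R, h * (δ / (2 * R)) ^ q ≤ w (x, t1) := by
  have hθ₂ : 0 < θ₂ := hθ₁.trans_le hθ
  obtain ⟨q0, hq0⟩ := exists_nat_ge (sSup {y | ∃ β ∈ Icc (3 / θ₂) (4 / θ₁),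
    y = (8 * lam + 4 * n * Lam + 2 * β) ^ 2 / (32 * lam * β)})
  refine ⟨2 * (q0 + 2), fun w x0 t0 t1 δ R h hδ hδR hh ht1 ht2 hcont hpos hsup hbase x hx => ?_⟩
  have hR : 0 < R := hδ.trans_le hδR
  have hT : 0 < t1 - t0 := (by positivity : 0 < θ₁ * R ^ 2).trans_le ht1
  set β : ℝ := (4 * R ^ 2 - δ ^ 2) / (t1 - t0) with hβ
  have hδ2 : δ ^ 2 ≤ R ^ 2 := pow_le_pow_left₀ hδ.le hδR 2
  have hβI : β ∈ Icc (3 / θ₂) (4 / θ₁) := by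
    constructor
    · rw [hβ, div_le_div_iff₀ hθ₂ hT]; nlinarith
    · rw [hβ, div_le_div_iff₀ hT hθ₁]; nlinarith [sq_nonneg δ]
  have hβ0 : 0 < β := (by positivity : 0 < 3 / θ₂).trans_le hβI.1
  have hbdd : BddAbove {y | ∃ β ∈ Icc (3 / θ₂) (4 / θ₁),
      y = (8 * lam + 4 * n * Lam + 2 * β) ^ 2 / (32 * lam * β)} := by
    have hc : ContinuousOn (fun β : ℝ => (8 * lam + 4 * n * Lam + 2 * β) ^ 2 / (32 * lam * β))
        (Icc (3 / θ₂) (4 / θ₁)) := by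
      refine ContinuousOn.div (by fun_prop) (by fun_prop) fun b hb => ?_
      have : 0 < b := (by positivity : 0 < 3 / θ₂).trans_le hb.1
      positivity
    obtain ⟨M, hM⟩ := isCompact_Icc.bddAbove_image hc
    exact ⟨M, fun y ⟨b, hb, hy⟩ => hM ⟨b, hb, hy.symm⟩⟩
  have hq : (8 * lam + 4 * n * Lam + 2 * β) ^ 2 / (32 * lam * β) ≤ q0 :=
    (le_csSup hbdd ⟨β, hβI, rfl⟩).trans hq0
  rw [div_le_iff₀ (by positivity)] at hq
  have hs1 : δ ^ 2 + β * (t1 - t0) = 4 * R ^ 2 := by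
    rw [hβ, div_mul_cancel₀ _ hT.ne']; ring
  have hxR : ‖x - x0‖ ^ 2 ≤ R ^ 2 := by
    rw [← dist_eq_norm]
    exact pow_le_pow_left₀ dist_nonneg (Metric.mem_closedBall.1 hx) 2
  have hmain := barrier_propagation (Lam := Lam) (R := 2 * R) (q := q0 + 2) hlam (by omega) hβ0 hδ
    (by rw [hs1]; nlinarith) (by positivity) hh
    (by push_cast; nlinarith [mul_pos hlam hβ0]) hcont hpos hsup hbase (by linarith) (x1 := x)
    (by rw [hs1]; nlinarith)
  refine le_trans ?_ hmain
  rw [hs1]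
  have e1 : h * δ ^ (2 * (q0 + 2)) / δ ^ 4 * (4 * R ^ 2 - ‖x - x0‖ ^ 2) ^ 2
      / (4 * R ^ 2) ^ (q0 + 2)
      = h * (δ / (2 * R)) ^ (2 * (q0 + 2)) * ((4 * R ^ 2 - ‖x - x0‖ ^ 2) ^ 2 / δ ^ 4) := by
    have : (4 * R ^ 2) ^ (q0 + 2) = (2 * R) ^ (2 * (q0 + 2)) := by rw [pow_mul]; ring
    rw [this, div_pow]
    field_simp
  rw [e1]
  have e2 : 1 ≤ (4 * R ^ 2 - ‖x - x0‖ ^ 2) ^ 2 / δ ^ 4 := by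
    rw [le_div_iff₀ (by positivity)]
    nlinarith [sq_nonneg δ]
  exact le_mul_of_one_le_right (by positivity) e2

end Touching

/-! ### Sliding paraboloids: a measure estimate for supersolutions -/

section Sliding

variable {n : ℕ} {lam Lam : ℝ}

lemma SuperAt.congr {w w' : Spc' n × ℝ → ℝ} {p : Spc' n × ℝ} (hw : SuperAt lam Lam w p)
    (h : w' =ᶠ[𝓝 p] w) : SuperAt lam Lam w' p := by
  obtain ⟨hc, a, S, ha, hS, hle⟩ := hw
  have hx : (fun y => w' (y, p.2)) =ᶠ[𝓝 p.1] fun y => w (y, p.2) :=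
    (Continuous.continuousAt (by fun_prop : Continuous fun y : Spc' n => (y, p.2))).eventually h
  have ht : (fun s => w' (p.1, s)) =ᶠ[𝓝 p.2] fun s => w (p.1, s) :=
    (Continuous.continuousAt (by fun_prop : Continuous fun s : ℝ => (p.1, s))).eventually h
  refine ⟨hc.congr_of_eventuallyEq hx, a, S, ha.congr_of_eventuallyEq ht, hS, ?_⟩
  have : hessForm (fun y => w' (y, p.2)) p.1 = hessForm (fun y => w (y, p.2)) p.1 :=
    (hx.fderiv (𝕜 := ℝ)).fderiv_eq
  rwa [this]

/-- A continuous antitone function whose left slopes are bounded by `C` at record times can only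
drop during a set of record times of proportional measure. -/
lemma drop_le_volume_records {f : ℝ → ℝ} {a b C : ℝ} (hf : Continuous f)
    (hanti : AntitoneOn f (Icc (-1) 0)) (ha : a ≤ f (-1)) (hb : f 0 ≤ b) (hC : 0 ≤ C)
    (hslope : ∀ t ∈ Ioo (-1 : ℝ) 0, f t < a → (∀ s ∈ Ico (-1) t, f t < f s) →
      ∀ r, C < r → ∃ᶠ s in 𝓝[<] t, f s - f t < r * (t - s)) :
    ENNReal.ofReal (a - b) ≤
      ENNReal.ofReal C * volume {t ∈ Ioo (-1 : ℝ) 0 | f t < a ∧ ∀ s ∈ Ico (-1) t, f t < f s} := by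
  set R := {t ∈ Ioo (-1 : ℝ) 0 | f t < a ∧ ∀ s ∈ Ico (-1) t, f t < f s} with hR
  have hlip : ∀ t1 ∈ R, ∀ t2 ∈ R, t1 ≤ t2 → f t1 - f t2 ≤ C * (t2 - t1) := by
    intro t1 h1 t2 h2 h12
    have key := image_le_of_liminf_slope_right_le_deriv_boundary
      (f := fun τ => f (-τ)) (a := -t2) (b := -t1)
      (B := fun τ => f t2 + C * (τ + t2)) (B' := fun _ => C) (by fun_prop) (by simp)
      (by fun_prop) (by
        intro τ _
        have := (((hasDerivAt_id τ).add_const t2).const_mul C).const_add (f t2)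
        rw [mul_one] at this
        exact this.hasDerivWithinAt) (by
        intro τ hτ r hr
        set t := -τ with ht
        have htI : t ∈ Ioc t1 t2 := ⟨by linarith [hτ.2], by linarith [hτ.1]⟩
        have ht0 : t ∈ Ioo (-1 : ℝ) 0 := ⟨h1.1.1.trans htI.1, htI.2.trans_lt h2.1.2⟩
        have hfr : ∃ᶠ s in 𝓝[<] t, f s - f t < r * (t - s) := by
          by_cases hrec : ∀ s ∈ Ico (-1) t, f t < f s
          · exact hslope t ht0 ((hanti ⟨h1.1.1.le, h1.1.2.le⟩ ⟨ht0.1.le, ht0.2.le⟩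
              htI.1.le).trans_lt h1.2.1) hrec r hr
          · push Not at hrec
            obtain ⟨s, hs, hle⟩ := hrec
            refine Eventually.frequently ?_
            filter_upwards [Ioo_mem_nhdsLT hs.2] with z hz
            have := hanti (a := s) (b := z) ⟨hs.1, by linarith [hs.2, ht0.2]⟩
              ⟨by linarith [hs.1, hz.1], by linarith [hz.2, ht0.2]⟩ hz.1.le
            have : 0 < r * (t - z) := mul_pos (by linarith) (by linarith [hz.2])
            linarith
        have htend : Tendsto (fun s : ℝ => -s) (𝓝[<] t) (𝓝[>] τ) := by
          have := tendsto_neg_nhdsLT (a := t)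
          rwa [ht, neg_neg] at this
        refine htend.frequently (hfr.mp ?_)
        filter_upwards [self_mem_nhdsWithin] with s hs hlt
        have hs' : 0 < -s - τ := by simp only [mem_Iio] at hs; linarith
        rw [slope_def_field, div_lt_iff₀ hs']
        simp only [neg_neg]
        have : -s - τ = t - s := by rw [ht]; ring
        rw [this]; exact hlt)
    have := key (x := -t1) ⟨by linarith, le_rfl⟩
    simp only [neg_neg] at this
    linarith
  have hLip : LipschitzOnWith C.toNNReal f R := by
    refine LipschitzOnWith.of_dist_le_mul fun t1 h1 t2 h2 => ?_
    rw [Real.coe_toNNReal _ hC, Real.dist_eq, Real.dist_eq]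
    rcases le_total t1 t2 with h | h
    · have := hlip t1 h1 t2 h2 h
      have h3 := hanti ⟨h1.1.1.le, h1.1.2.le⟩ ⟨h2.1.1.le, h2.1.2.le⟩ h
      rw [abs_of_nonneg (by linarith), abs_of_nonpos (by linarith)]; linarith
    · have := hlip t2 h2 t1 h1 h
      have h3 := hanti ⟨h2.1.1.le, h2.1.2.le⟩ ⟨h1.1.1.le, h1.1.2.le⟩ h
      rw [abs_of_nonpos (by linarith), abs_of_nonneg (by linarith)]; linarith
  have hsub : Ioo b a ⊆ f '' R := by
    intro l hl
    set S := Icc (-1 : ℝ) 0 ∩ f ⁻¹' Iic l with hS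
    have hSc : IsCompact S := isCompact_Icc.inter_right (isClosed_Iic.preimage hf)
    have hSne : S.Nonempty := ⟨0, ⟨by norm_num, le_rfl⟩, hb.trans hl.1.le⟩
    obtain ⟨t, htS, hleast⟩ := hSc.exists_isLeast hSne
    have h0 : ∀ s ∈ Ico (-1) t, l < f s := by
      intro s hs
      by_contra! h
      exact absurd (hleast ⟨⟨hs.1, hs.2.le.trans htS.1.2⟩, h⟩) (not_le.2 hs.2)
    have htm : -1 < t := lt_of_le_of_ne htS.1.1 fun h => by
      have := htS.2; rw [← h] at this; simp only [mem_preimage, mem_Iic] at this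
      linarith [hl.2]
    have heq : f t = l := by
      refine le_antisymm htS.2 ?_
      have : Tendsto f (𝓝[<] t) (𝓝 (f t)) := hf.continuousAt.mono_left nhdsWithin_le_nhds
      refine ge_of_tendsto this ?_
      filter_upwards [Ioo_mem_nhdsLT htm] with s hs using (h0 s ⟨hs.1.le, hs.2⟩).le
    have ht0 : t < 0 := lt_of_le_of_ne htS.1.2 fun h => by
      rw [h] at heq; linarith [hl.1]
    exact ⟨t, ⟨⟨htm, ht0⟩, by rw [heq]; exact hl.2, fun s hs => by rw [heq]; exact h0 s hs⟩, heq⟩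
  calc ENNReal.ofReal (a - b) = volume (Ioo b a) := by rw [Real.volume_Ioo]
    _ ≤ volume (f '' R) := measure_mono hsub
    _ ≤ ENNReal.ofReal C * volume R := by
      have := hLip.hausdorffMeasure_image_le (d := 1) zero_le_one
      rw [hausdorffMeasure_real] at this
      simpa [ENNReal.ofReal] using this

/-- The function minimized when sliding paraboloids with vertex `y`. -/
def slideVal (W : Spc' n × ℝ → ℝ) (y : Spc' n) (p : Spc' n × ℝ) : ℝ :=
  W p + 16 * ‖p.1 - y‖ ^ 2 - 9 * p.2

/-- The infimum of `slideVal` over the unit ball and the times in `[-1, t]`. -/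
def slideInf (W : Spc' n × ℝ → ℝ) (y : Spc' n) (t : ℝ) : ℝ :=
  sInf ((fun q : Spc' n × ℝ => slideVal W y (q.1, -1 + q.2 * (t + 1))) ''
    (Metric.closedBall 0 1 ×ˢ Icc 0 1))

lemma isCompact_slide : IsCompact (Metric.closedBall (0 : Spc' n) 1 ×ˢ Icc (0 : ℝ) 1) :=
  (isCompact_closedBall _ _).prod isCompact_Icc

lemma continuous_slideInf {W : Spc' n × ℝ → ℝ} (hW : Continuous W) :
    Continuous fun p : Spc' n × ℝ => slideInf W p.1 p.2 := by
  refine isCompact_slide.continuous_sInf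
    (f := fun (p : Spc' n × ℝ) (q : Spc' n × ℝ) => slideVal W p.1 (q.1, -1 + q.2 * (p.2 + 1))) ?_
  simp only [slideVal, Function.HasUncurry.uncurry, id]
  fun_prop

lemma slideInf_le {W : Spc' n × ℝ → ℝ} (hW : Continuous W) (y : Spc' n) {t s : ℝ} {x : Spc' n}
    (hx : x ∈ Metric.closedBall (0 : Spc' n) 1) (hs : s ∈ Icc (-1) t) :
    slideInf W y t ≤ slideVal W y (x, s) := by
  have hbdd : BddBelow ((fun q : Spc' n × ℝ => slideVal W y (q.1, -1 + q.2 * (t + 1))) ''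
      (Metric.closedBall 0 1 ×ˢ Icc 0 1)) := by
    refine isCompact_slide.bddBelow_image (Continuous.continuousOn ?_)
    simp only [slideVal]; fun_prop
  rcases hs.1.eq_or_lt with h | h
  · exact csInf_le hbdd ⟨(x, 0), ⟨hx, by simp⟩, by simp [← h]⟩
  · have ht : 0 < t + 1 := by linarith [hs.2]
    refine csInf_le hbdd ⟨(x, (s + 1) / (t + 1)), ⟨hx, by
      constructor
      · exact div_nonneg (by linarith) ht.le
      · rw [div_le_one ht]; linarith [hs.2]⟩, ?_⟩
    simp only [div_mul_cancel₀ _ ht.ne']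
    congr 2; ring

lemma exists_slideInf_eq {W : Spc' n × ℝ → ℝ} (hW : Continuous W) (y : Spc' n) {t : ℝ}
    (ht : -1 ≤ t) : ∃ x ∈ Metric.closedBall (0 : Spc' n) 1, ∃ s ∈ Icc (-1) t,
      slideVal W y (x, s) = slideInf W y t := by
  obtain ⟨q, hq, heq⟩ := (isCompact_slide (n := n)).exists_sInf_image_eq
    ⟨(0, 0), by simp, by simp⟩
    (f := fun q : Spc' n × ℝ => slideVal W y (q.1, -1 + q.2 * (t + 1)))
    (Continuous.continuousOn (by simp only [slideVal]; fun_prop))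
  refine ⟨q.1, hq.1, -1 + q.2 * (t + 1), ⟨?_, ?_⟩, heq.symm⟩
  · have := mul_nonneg hq.2.1 (by linarith : 0 ≤ t + 1); linarith
  · have := mul_le_mul_of_nonneg_right hq.2.2 (by linarith : 0 ≤ t + 1); linarith

lemma antitone_slideInf {W : Spc' n × ℝ → ℝ} (hW : Continuous W) (y : Spc' n) :
    AntitoneOn (slideInf W y) (Icc (-1) 0) := by
  intro a ha b _ hab
  obtain ⟨x, hx, s, hs, h⟩ := exists_slideInf_eq hW y ha.1
  rw [← h]
  exact slideInf_le hW y hx ⟨hs.1, hs.2.trans hab⟩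

/-- At a record time the infimum is attained at an interior point, where the derivatives of the
supersolution are controlled. -/
lemma exists_contact (hlam : 0 < lam) {W : Spc' n × ℝ → ℝ} (hW : Continuous W)
    (hpos : ∀ p ∈ Metric.closedBall (0 : Spc' n) 1 ×ˢ Icc (-1 : ℝ) 0, 0 ≤ W p)
    (hsup : ∀ p ∈ Metric.ball (0 : Spc' n) 1 ×ˢ Ioo (-1 : ℝ) 0, W p < 10 → SuperAt lam Lam W p)
    {y : Spc' n} (hy : y ∈ Metric.ball (0 : Spc' n) (1 / 4)) {t : ℝ} (ht : t ∈ Ioo (-1 : ℝ) 0)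
    (hlt : slideInf W y t < 9) (hrec : ∀ s ∈ Ico (-1) t, slideInf W y t < slideInf W y s) :
    ∃ x ∈ Metric.ball (0 : Spc' n) 1, W (x, t) ≤ 9 ∧
      y = x + (1 / 32 : ℝ) • sharp n (fderiv ℝ (fun z => W (z, t)) x) ∧
      (∀ v, 0 ≤ (hessForm (fun z => W (z, t)) x + (32 : ℝ) • innerForm n) v v) ∧
      formTrace (hessForm (fun z => W (z, t)) x + (32 : ℝ) • innerForm n)
        ≤ (9 + 32 * (n * Lam)) / lam ∧
      slideVal W y (x, t) = slideInf W y t ∧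
      ∃ a, HasDerivAt (fun s => W (x, s)) a t ∧ -(32 * (n * Lam)) ≤ a := by
  obtain ⟨x, hx, s, hs, heq⟩ := exists_slideInf_eq hW y ht.1.le
  obtain rfl : s = t := by
    refine le_antisymm hs.2 (not_lt.1 fun hst => ?_)
    have := slideInf_le hW y hx (t := s) ⟨hs.1, le_rfl⟩
    have := hrec s ⟨hs.1, hst⟩
    linarith
  have hW0 := hpos (x, s) ⟨hx, ht.1.le, ht.2.le⟩
  have hval : W (x, s) + 16 * ‖x - y‖ ^ 2 - 9 * s < 9 := by
    have := heq; simp only [slideVal] at this; linarith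
  have hyn : ‖y‖ < 1 / 4 := by simpa using hy
  have hxb : x ∈ Metric.ball (0 : Spc' n) 1 := by
    rw [mem_ball_zero_iff]
    by_contra! h
    have h1 : 3 / 4 ≤ ‖x - y‖ := by linarith [norm_sub_norm_le x y]
    nlinarith [ht.2]
  have hW9 : W (x, s) ≤ 9 := by nlinarith [ht.2, sq_nonneg ‖x - y‖]
  obtain ⟨hc, a, S, ha, hS, hle⟩ := hsup (x, s) ⟨hxb, ht⟩ (by linarith)
  simp only at hc ha hle
  have hqc : ContDiff ℝ 2 fun z : Spc' n => ‖z - y‖ ^ 2 :=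
    (contDiff_id.sub contDiff_const).norm_sq ℝ
  have hmin : IsLocalMin (fun z => W (z, s) + 16 * ‖z - y‖ ^ 2) x := by
    filter_upwards [Metric.isOpen_ball.mem_nhds hxb] with z hz
    have := slideInf_le hW y (Metric.ball_subset_closedBall hz) (t := s) ⟨ht.1.le, le_rfl⟩
    rw [← heq] at this
    simp only [slideVal] at this
    linarith
  have hqc' : ContDiffAt ℝ 2 (fun z : Spc' n => 16 * ‖z - y‖ ^ 2) x :=
    (contDiff_const.mul hqc).contDiffAt
  have hH : hessForm (fun z => W (z, s) + 16 * ‖z - y‖ ^ 2) x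
      = hessForm (fun z => W (z, s)) x + (32 : ℝ) • innerForm n := by
    rw [hessForm_add hc hqc', hessForm_const_mul _ hqc.contDiffAt, hessForm_normSq, smul_smul]
    norm_num
  have hP : ∀ v, 0 ≤ (hessForm (fun z => W (z, s)) x + (32 : ℝ) • innerForm n) v v := by
    intro v
    rw [← hH]
    exact hmin.hessForm_nonneg (hc.add hqc') v
  have ha9 : a ≤ 9 := by
    have := HasDerivAt.nonpos_of_left_le (t0 := -1)
      ((ha.add_const (16 * ‖x - y‖ ^ 2)).sub ((hasDerivAt_id s).const_mul 9)) ht.1 (by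
        intro τ hτ
        have h1 := slideInf_le hW y hx (t := τ) ⟨hτ.1.le, le_rfl⟩
        have h2 := hrec τ ⟨hτ.1.le, hτ.2⟩
        rw [← heq] at h2
        simp only [slideVal] at h1 h2
        simp only [Pi.sub_apply, id]
        linarith)
    linarith
  have hT := tracePair_add (S := S) (hessForm (fun z => W (z, s)) x) ((32 : ℝ) • innerForm n)
  rw [tracePair_smul, tracePair_innerForm] at hT
  have h1 := hS.le_tracePair hP
  have h2 := hS.tracePair_nonneg hlam.le hP
  have h3 := hS.trace_le
  refine ⟨x, hxb, hW9, ?_, hP, ?_, heq, a, ha, ?_⟩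
  · have hd : HasFDerivAt (fun z => W (z, s) + 16 * ‖z - y‖ ^ 2)
        (fderiv ℝ (fun z => W (z, s)) x + (16 : ℝ) • (2 : ℝ) • innerForm n (x - y)) x :=
      (hc.differentiableAt (by norm_num)).hasFDerivAt.add ((hasFDerivAt_normSq y x).const_mul 16)
    have h0 := hmin.hasFDerivAt_eq_zero hd
    refine ext_inner_right ℝ fun v => ?_
    have hv := congrArg (fun l : Spc' n →L[ℝ] ℝ => l v) h0
    simp only [_root_.add_apply, _root_.smul_apply, smul_eq_mul, innerForm_apply,
      _root_.zero_apply, inner_sub_left] at hv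
    rw [inner_add_left, real_inner_smul_left, inner_sharp]
    linarith
  · rw [le_div_iff₀ hlam]; linarith
  · linarith

lemma sharp_comp_innerForm : (sharp n).comp (innerForm n) = ContinuousLinearMap.id ℝ (Spc' n) := by
  ext1 x
  refine ext_inner_right ℝ fun v => ?_
  rw [ContinuousLinearMap.comp_apply, inner_sharp, innerForm_apply, ContinuousLinearMap.id_apply]

/-- Time slices of the set of vertices are controlled by a sublevel set of the supersolution. -/
lemma volume_vertex_slice_le (hlam : 0 < lam) {W : Spc' n × ℝ → ℝ} (hW : Continuous W)
    (hpos : ∀ p ∈ Metric.closedBall (0 : Spc' n) 1 ×ˢ Icc (-1 : ℝ) 0, 0 ≤ W p)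
    (hsup : ∀ p ∈ Metric.ball (0 : Spc' n) 1 ×ˢ Ioo (-1 : ℝ) 0, W p < 10 → SuperAt lam Lam W p)
    {t : ℝ} (ht : t ∈ Ioo (-1 : ℝ) 0) :
    volume {y | y ∈ Metric.ball (0 : Spc' n) (1 / 4) ∧ slideInf W y t < 9 ∧
        ∀ s ∈ Ico (-1) t, slideInf W y t < slideInf W y s}
      ≤ ENNReal.ofReal ((1 / 32) ^ n * ((9 + 32 * (n * Lam)) / lam) ^ n) *
        volume {x | x ∈ Metric.ball (0 : Spc' n) 1 ∧ W (x, t) ≤ 9} := by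
  set D : ℝ := (1 / 32) ^ n * ((9 + 32 * (n * Lam)) / lam) ^ n with hD
  set f : Spc' n → ℝ := fun z => W (z, t) with hf
  set L : Spc' n → Spc' n →L[ℝ] Spc' n := fun x =>
    (1 / 32 : ℝ) • (sharp n).comp (fderiv ℝ (fderiv ℝ f) x + (32 : ℝ) • innerForm n) with hL
  set G := Metric.ball (0 : Spc' n) 1 ∩ {x | f x ≤ 9} with hG
  set s := G ∩ {x | |(L x).det| ≤ D} with hs
  have hLm : Measurable L := by
    have h1 : Measurable (fderiv ℝ (fderiv ℝ f)) := measurable_fderiv ℝ _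
    have h2 : Continuous fun B : Spc' n →L[ℝ] Spc' n →L[ℝ] ℝ =>
        (1 / 32 : ℝ) • (sharp n).comp (B + (32 : ℝ) • innerForm n) := by fun_prop
    exact h2.measurable.comp h1
  have hGm : MeasurableSet G := by
    refine (Metric.isOpen_ball.measurableSet).inter (measurableSet_le ?_ measurable_const)
    exact (by fun_prop : Continuous f).measurable
  have hsm : MeasurableSet s := by
    refine hGm.inter (measurableSet_le ?_ measurable_const)
    exact (continuous_abs.comp ContinuousLinearMap.continuous_det).measurable.comp hLm
  have hder : ∀ x ∈ s, HasFDerivWithinAt (fun x => x + (1 / 32 : ℝ) • sharp n (fderiv ℝ f x))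
      (L x) s x := by
    intro x hx
    have hc : ContDiffAt ℝ 2 f x :=
      (hsup (x, t) ⟨hx.1.1, ht⟩ (by have := hx.1.2; simp only [hf, mem_ofPred_eq] at this; linarith)).1
    have h1 := (hasFDerivAt_id (𝕜 := ℝ) x).add
      (((sharp n).hasFDerivAt.comp x hc.hasFDerivAt_fderiv_hessForm).const_smul (1 / 32 : ℝ))
    refine (h1.congr_fderiv ?_).hasFDerivWithinAt
    simp only [hL, ContinuousLinearMap.comp_add, ContinuousLinearMap.comp_smul,
      sharp_comp_innerForm, smul_add, smul_smul]
    rw [add_comm]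
    congr 1
    norm_num
  have hsub : {y | y ∈ Metric.ball (0 : Spc' n) (1 / 4) ∧ slideInf W y t < 9 ∧
        ∀ s ∈ Ico (-1) t, slideInf W y t < slideInf W y s}
      ⊆ (fun x => x + (1 / 32 : ℝ) • sharp n (fderiv ℝ f x)) '' s := by
    rintro y ⟨hy, hlt, hrec⟩
    obtain ⟨x, hx, h9, hyx, hP, htr, -, -⟩ := exists_contact hlam hW hpos hsup hy ht hlt hrec
    refine ⟨x, ⟨⟨hx, h9⟩, ?_⟩, hyx.symm⟩
    have hc : ContDiffAt ℝ 2 f x := (hsup (x, t) ⟨hx, ht⟩ (by linarith)).1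
    have hdet := abs_det_sharp_le (B := hessForm f x + (32 : ℝ) • innerForm n) (fun u v => by
      simp [hc.hessForm_symm u v, innerForm_apply, real_inner_comm]) hP
    have h1 : (L x).det = (1 / 32) ^ n
        * ((sharp n).comp (hessForm f x + (32 : ℝ) • innerForm n)).det := by
      have := LinearMap.det_smul (1 / 32 : ℝ)
        ((sharp n).comp (hessForm f x + (32 : ℝ) • innerForm n)).toLinearMap
      rw [finrank_euclideanSpace, Fintype.card_fin] at this
      exact this
    simp only [mem_ofPred_eq]
    rw [h1, abs_mul, abs_of_pos (by positivity)]
    refine mul_le_mul_of_nonneg_left (hdet.trans ?_) (by positivity)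
    exact pow_le_pow_left₀ (formTrace_nonneg hP) htr n
  refine (measure_mono hsub).trans
    ((addHaar_image_le_lintegral_abs_det_fderiv volume hsm hder).trans ?_)
  calc ∫⁻ x in s, ENNReal.ofReal |(L x).det| ≤ ∫⁻ _ in s, ENNReal.ofReal D :=
        setLIntegral_mono' hsm fun x hx => ENNReal.ofReal_le_ofReal hx.2
    _ = ENNReal.ofReal D * volume s := by rw [setLIntegral_const]
    _ ≤ _ := by gcongr; exact inter_subset_left

set_option maxHeartbeats 1000000 in
lemma measure_estimate_unit_aux (hlam : 0 < lam) (hLam : 0 ≤ Lam) {W : Spc' n × ℝ → ℝ}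
    (hW : Continuous W)
    (hpos : ∀ p ∈ Metric.closedBall (0 : Spc' n) 1 ×ˢ Icc (-1 : ℝ) 0, 0 ≤ W p)
    (hsup : ∀ p ∈ Metric.ball (0 : Spc' n) 1 ×ˢ Ioo (-1 : ℝ) 0, W p < 10 → SuperAt lam Lam W p)
    (h0 : W (0, 0) ≤ 1) :
    ENNReal.ofReal 7 * volume (Metric.ball (0 : Spc' n) (1 / 4)) ≤
      ENNReal.ofReal (9 + 32 * (n * Lam)) *
        (ENNReal.ofReal ((1 / 32) ^ n * ((9 + 32 * (n * Lam)) / lam) ^ n) *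
        volume {p : Spc' n × ℝ | p ∈ Metric.ball (0 : Spc' n) 1 ×ˢ Ioo (-1 : ℝ) 0 ∧ W p ≤ 9}) := by
  set C : ℝ := 9 + 32 * (n * Lam) with hC
  set D : ℝ := (1 / 32) ^ n * (C / lam) ^ n with hD
  have hC0 : 0 < C := by positivity
  have hg := continuous_slideInf hW
  set R : Set (Spc' n × ℝ) := (Metric.ball 0 (1 / 4) ×ˢ Ioo (-1 : ℝ) 0) ∩
    ({p | slideInf W p.1 p.2 < 9} ∩
      ⋂ k : ℕ, {p | slideInf W p.1 p.2 < slideInf W p.1 (max (p.2 - 1 / (k + 1)) (-1))}) with hR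
  have hRm : MeasurableSet R := by
    have h1 : Measurable fun p : Spc' n × ℝ => slideInf W p.1 p.2 := hg.measurable
    have h2 (k : ℕ) : Measurable fun p : Spc' n × ℝ =>
        slideInf W p.1 (max (p.2 - 1 / ((k : ℝ) + 1)) (-1)) :=
      (hg.comp (f := fun p : Spc' n × ℝ => (p.1, max (p.2 - 1 / ((k : ℝ) + 1)) (-1)))
        (by fun_prop)).measurable
    exact (measurableSet_ball.prod measurableSet_Ioo).inter
      ((measurableSet_lt h1 measurable_const).inter
      (MeasurableSet.iInter fun k => measurableSet_lt h1 (h2 k)))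
  have hRiff : ∀ y t, (y, t) ∈ R ↔ y ∈ Metric.ball (0 : Spc' n) (1 / 4) ∧ t ∈ Ioo (-1 : ℝ) 0 ∧
      slideInf W y t < 9 ∧ ∀ s ∈ Ico (-1) t, slideInf W y t < slideInf W y s := by
    intro y t
    simp only [hR, mem_inter_iff, mem_prod, mem_iInter, mem_ofPred_eq]
    constructor
    · rintro ⟨⟨hy, ht⟩, h9, h⟩
      refine ⟨hy, ht, h9, fun s hs => ?_⟩
      obtain ⟨k, hk⟩ := exists_nat_one_div_lt (sub_pos.2 hs.2)
      have hmax : s ≤ max (t - 1 / ((k : ℝ) + 1)) (-1) := le_max_of_le_left (by linarith)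
      have hmax' : max (t - 1 / ((k : ℝ) + 1)) (-1) ≤ t :=
        max_le (by linarith [Nat.one_div_pos_of_nat (α := ℝ) (n := k)]) ht.1.le
      exact (h k).trans_le (antitone_slideInf hW y ⟨hs.1, by linarith [hs.2, ht.2]⟩
        ⟨le_max_right _ _, hmax'.trans ht.2.le⟩ hmax)
    · rintro ⟨hy, ht, h9, h⟩
      refine ⟨⟨hy, ht⟩, h9, fun k => ?_⟩
      exact h _ ⟨le_max_right _ _, max_lt
        (by linarith [Nat.one_div_pos_of_nat (α := ℝ) (n := k)]) ht.1⟩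
  have hGm : MeasurableSet
      {p : Spc' n × ℝ | p ∈ Metric.ball (0 : Spc' n) 1 ×ˢ Ioo (-1 : ℝ) 0 ∧ W p ≤ 9} := by
    have h1 : MeasurableSet (Metric.ball (0 : Spc' n) 1 ×ˢ Ioo (-1 : ℝ) 0) :=
      measurableSet_ball.prod measurableSet_Ioo
    exact h1.inter (measurableSet_le hW.measurable measurable_const : MeasurableSet {p | W p ≤ 9})
  have hslice : ∀ y ∈ Metric.ball (0 : Spc' n) (1 / 4),
      ENNReal.ofReal 7 ≤ ENNReal.ofReal C * volume (Prod.mk y ⁻¹' R) := by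
    intro y hy
    have hyn : ‖y‖ < 1 / 4 := by simpa using hy
    have hdrop := drop_le_volume_records (f := slideInf W y) (a := 9) (b := 2) (C := C)
      (hg.comp (by fun_prop : Continuous fun t : ℝ => (y, t))) (antitone_slideInf hW y) (by
        obtain ⟨x, hx, s, hs, h⟩ := exists_slideInf_eq hW y (le_refl (-1 : ℝ))
        obtain rfl : s = -1 := le_antisymm hs.2 hs.1
        rw [← h]
        have := hpos (x, -1) ⟨hx, by norm_num, by norm_num⟩
        simp only [slideVal]
        nlinarith [sq_nonneg ‖x - y‖]) (by
        refine (slideInf_le hW y (x := 0) (s := 0) (by simp) (by simp)).trans ?_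
        simp only [slideVal, zero_sub, norm_neg]
        nlinarith [norm_nonneg y]) hC0.le (by
        intro t ht hlt hrec r hr
        obtain ⟨x, hx, -, -, -, -, heq, a, ha, ha'⟩ :=
          exists_contact hlam hW hpos hsup hy ht hlt hrec
        have hd : HasDerivAt (fun s => slideVal W y (x, s)) (a - 9) t := by
          have := (ha.add_const (16 * ‖x - y‖ ^ 2)).sub ((hasDerivAt_id t).const_mul 9)
          rw [mul_one] at this
          exact this
        have h1 := (hasDerivAt_iff_tendsto_slope.1 hd).mono_left
          (nhdsWithin_mono t (show Iio t ⊆ {t}ᶜ from fun s hs => ne_of_lt hs))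
        refine Eventually.frequently ?_
        filter_upwards [h1.eventually (lt_mem_nhds (show -r < a - 9 by linarith)),
          Ioo_mem_nhdsLT ht.1] with s hs hst
        rw [slope_def_field, lt_div_iff_of_neg (by linarith [hst.2])] at hs
        have := slideInf_le hW y (Metric.ball_subset_closedBall hx) (t := s) ⟨hst.1.le, le_rfl⟩
        rw [← heq]
        linarith)
    have e : (9 : ℝ) - 2 = 7 := by norm_num
    rw [e] at hdrop
    refine hdrop.trans ?_
    gcongr
    rintro t ⟨ht, hlt, hrec⟩
    exact (hRiff y t).2 ⟨hy, ht, hlt, hrec⟩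
  have hlow : ENNReal.ofReal 7 * volume (Metric.ball (0 : Spc' n) (1 / 4))
      ≤ ENNReal.ofReal C * volume R := by
    rw [Measure.volume_eq_prod, Measure.prod_apply hRm, ← lintegral_const_mul _
      (measurable_measure_prodMk_left hRm), ← setLIntegral_const]
    exact (setLIntegral_mono' measurableSet_ball hslice).trans (setLIntegral_le_lintegral _ _)
  refine hlow.trans ?_
  gcongr
  rw [Measure.volume_eq_prod, Measure.prod_apply_symm hRm, Measure.prod_apply_symm hGm,
    ← lintegral_const_mul _ (measurable_measure_prodMk_right hGm)]
  refine lintegral_mono fun t => ?_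
  by_cases ht : t ∈ Ioo (-1 : ℝ) 0
  · refine le_trans (measure_mono ?_) ((volume_vertex_slice_le hlam hW hpos hsup ht).trans ?_)
    · intro y hy
      have := (hRiff y t).1 hy
      exact ⟨this.1, this.2.2⟩
    · gcongr
      rintro x ⟨hx, h9⟩
      exact ⟨⟨hx, ht⟩, h9⟩
  · have : (fun x => (x, t)) ⁻¹' R = ∅ := by
      ext y
      simp only [mem_preimage, mem_empty_iff_false, iff_false]
      exact fun h => ht ((hRiff y t).1 h).2.1
    rw [this]; simp

/-- A supersolution that is small at one point is bounded on a set of positive measure. -/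
lemma exists_measure_estimate_unit (n : ℕ) {lam Lam : ℝ} (hlam : 0 < lam) (hLam : 0 ≤ Lam) :
    ∃ μ : ℝ, 0 < μ ∧ ∀ w : Spc' n × ℝ → ℝ,
      ContinuousOn w (Metric.closedBall (0 : Spc' n) 1 ×ˢ Icc (-1 : ℝ) 0) →
      (∀ p ∈ Metric.closedBall (0 : Spc' n) 1 ×ˢ Icc (-1 : ℝ) 0, 0 ≤ w p) →
      (∀ p ∈ Metric.ball (0 : Spc' n) 1 ×ˢ Ioo (-1 : ℝ) 0, w p < 10 → SuperAt lam Lam w p) →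
      w (0, 0) ≤ 1 →
      ENNReal.ofReal μ ≤
        volume {p : Spc' n × ℝ | p ∈ Metric.ball (0 : Spc' n) 1 ×ˢ Ioo (-1 : ℝ) 0 ∧ w p ≤ 9} := by
  set C : ℝ := 9 + 32 * (n * Lam) with hC
  set D : ℝ := (1 / 32) ^ n * (C / lam) ^ n with hD
  have hC0 : 0 < C := by positivity
  have hD0 : 0 < D := by positivity
  set b : ℝ := (volume (Metric.ball (0 : Spc' n) (1 / 4))).toReal with hb
  have hbfin : volume (Metric.ball (0 : Spc' n) (1 / 4)) ≠ ⊤ := measure_ball_lt_top.ne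
  have hb0 : 0 < b := ENNReal.toReal_pos (Metric.measure_ball_pos _ _ (by norm_num)).ne' hbfin
  refine ⟨7 * b / (C * D), by positivity, fun w hw hpos hsup h0 => ?_⟩
  set K := Metric.closedBall (0 : Spc' n) 1 ×ˢ Icc (-1 : ℝ) 0 with hK
  obtain ⟨W, hWeq⟩ := ContinuousMap.exists_restrict_eq
    (Metric.isClosed_closedBall.prod isClosed_Icc : IsClosed K) ⟨K.domRestrict w, hw.domRestrict⟩
  have hWw : ∀ p ∈ K, W p = w p := fun p hp => by
    have := congrArg (fun f : C(K, ℝ) => f ⟨p, hp⟩) hWeq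
    exact this
  have hsubK : Metric.ball (0 : Spc' n) 1 ×ˢ Ioo (-1 : ℝ) 0 ⊆ K :=
    prod_mono Metric.ball_subset_closedBall Ioo_subset_Icc_self
  have h := measure_estimate_unit_aux (Lam := Lam) hlam hLam W.continuous
    (fun p hp => by rw [hWw p hp]; exact hpos p hp) (fun p hp hlt => by
      rw [hWw p (hsubK hp)] at hlt
      refine (hsup p hp hlt).congr ?_
      filter_upwards [(Metric.isOpen_ball.prod isOpen_Ioo).mem_nhds hp] with q hq
      exact hWw q (hsubK hq)) (by rw [hWw _ (by simp [hK])]; exact h0)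
  have hset : {p : Spc' n × ℝ | p ∈ Metric.ball (0 : Spc' n) 1 ×ˢ Ioo (-1 : ℝ) 0 ∧ W p ≤ 9}
      = {p : Spc' n × ℝ | p ∈ Metric.ball (0 : Spc' n) 1 ×ˢ Ioo (-1 : ℝ) 0 ∧ w p ≤ 9} := by
    ext p
    refine and_congr_right fun hp => by rw [hWw p (hsubK hp)]
  rw [hset, ← hC, ← hD, ← mul_assoc, ← ENNReal.ofReal_mul hC0.le, ← ENNReal.ofReal_toReal hbfin,
    ← hb, ← ENNReal.ofReal_mul (by norm_num)] at h
  rw [ENNReal.ofReal_div_of_pos (by positivity)]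
  refine ENNReal.div_le_of_le_mul ?_
  rwa [mul_comm (volume _)]

end Sliding

/-! ### Parabolic scaling -/

/-- At `p` the function `v` is a pointwise solution for some operator with ellipticity
constants `lam`, `Lam`. -/
def SolAt {n : ℕ} (lam Lam : ℝ) (v : Spc' n × ℝ → ℝ) (p : Spc' n × ℝ) : Prop :=
  ContDiffAt ℝ 2 (fun y => v (y, p.2)) p.1 ∧
    ∃ (a : ℝ) (S : Matrix (Fin n) (Fin n) ℝ), HasDerivAt (fun s => v (p.1, s)) a p.2 ∧
      EllMat lam Lam S ∧ tracePair S (hessForm (fun y => v (y, p.2)) p.1) = a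

/-- The parabolic rescaling sending the unit cylinder to the cylinder of size `r` at `(x0, t0)`. -/
def zoom {n : ℕ} (x0 : Spc' n) (t0 r : ℝ) (p : Spc' n × ℝ) : Spc' n × ℝ :=
  (x0 + r • p.1, t0 + r ^ 2 * p.2)

section Scaling

variable {n : ℕ} {lam Lam : ℝ}

lemma SolAt.superAt {v : Spc' n × ℝ → ℝ} {p : Spc' n × ℝ} (hv : SolAt lam Lam v p) :
    SuperAt lam Lam v p := by
  obtain ⟨hc, a, S, ha, hS, h⟩ := hv
  exact ⟨hc, a, S, ha, hS, h.le⟩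

lemma SuperAt.const_mul {w : Spc' n × ℝ → ℝ} {p : Spc' n × ℝ} (hw : SuperAt lam Lam w p) {c : ℝ}
    (hc0 : 0 ≤ c) : SuperAt lam Lam (fun q => c * w q) p := by
  obtain ⟨hc, a, S, ha, hS, h⟩ := hw
  refine ⟨contDiffAt_const.mul hc, c * a, S, ha.const_mul c, hS, ?_⟩
  rw [hessForm_const_mul c hc, tracePair_smul]
  exact mul_le_mul_of_nonneg_left h hc0

lemma SolAt.affine {v : Spc' n × ℝ → ℝ} {p : Spc' n × ℝ} (hv : SolAt lam Lam v p) (b c : ℝ) :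
    SolAt lam Lam (fun q => b + c * v q) p := by
  obtain ⟨hc, a, S, ha, hS, h⟩ := hv
  refine ⟨contDiffAt_const.add (contDiffAt_const.mul hc), c * a, S, (ha.const_mul c).const_add b,
    hS, ?_⟩
  rw [hessForm_add contDiffAt_const (contDiffAt_const.mul hc), hessForm_const,
    hessForm_const_mul c hc, tracePair_add, tracePair_smul, h]
  simp [tracePair]

lemma hessForm_comp_affine {f : Spc' n → ℝ} {x0 y : Spc' n} {r : ℝ}
    (hf : ContDiffAt ℝ 2 f (x0 + r • y)) :
    hessForm (fun z => f (x0 + r • z)) y = r ^ 2 • hessForm f (x0 + r • y) := by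
  have hl : ∀ z : Spc' n, HasFDerivAt (fun z : Spc' n => x0 + r • z)
      (r • ContinuousLinearMap.id ℝ (Spc' n)) z := fun z =>
    ((hasFDerivAt_id z).const_smul r).const_add x0
  have hc : Continuous fun z : Spc' n => x0 + r • z := by fun_prop
  have h : fderiv ℝ (fun z => f (x0 + r • z)) =ᶠ[𝓝 y] fun z => r • fderiv ℝ f (x0 + r • z) := by
    filter_upwards [hc.continuousAt.eventually (hf.eventually (by simp))] with z hz
    have := ((hz.differentiableAt (by norm_num)).hasFDerivAt.comp z (hl z)).fderiv
    refine this.trans ?_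
    ext v; simp
  rw [hessForm, h.fderiv_eq]
  have := (hf.hasFDerivAt_fderiv_hessForm.comp y (hl y)).const_smul r
  refine this.fderiv.trans ?_
  ext u v; simp; ring

lemma tracePair_hessForm_zoom {S : Matrix (Fin n) (Fin n) ℝ} {w : Spc' n × ℝ → ℝ} {x0 : Spc' n}
    {t0 r a : ℝ} {p : Spc' n × ℝ}
    (hc : ContDiffAt ℝ 2 (fun y => w (y, (zoom x0 t0 r p).2)) (zoom x0 t0 r p).1)
    (ha : HasDerivAt (fun s => w ((zoom x0 t0 r p).1, s)) a (zoom x0 t0 r p).2) :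
    ContDiffAt ℝ 2 (fun y => w (zoom x0 t0 r (y, p.2))) p.1 ∧
      HasDerivAt (fun s => w (zoom x0 t0 r (p.1, s))) (r ^ 2 * a) p.2 ∧
      tracePair S (hessForm (fun y => w (zoom x0 t0 r (y, p.2))) p.1) =
        r ^ 2 * tracePair S
          (hessForm (fun y => w (y, (zoom x0 t0 r p).2)) (zoom x0 t0 r p).1) := by
  simp only [zoom] at hc ha ⊢
  refine ⟨?_, ?_, ?_⟩
  · have : ContDiff ℝ 2 fun z : Spc' n => x0 + r • z := by fun_prop
    exact ContDiffAt.comp (g := fun y => w (y, t0 + r ^ 2 * p.2))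
      (f := fun z : Spc' n => x0 + r • z) p.1 hc this.contDiffAt
  · have h1 : HasDerivAt (fun s => t0 + r ^ 2 * s) (r ^ 2) p.2 := by
      have := ((hasDerivAt_id p.2).const_mul (r ^ 2)).const_add t0
      rwa [mul_one] at this
    rw [mul_comm]
    exact HasDerivAt.comp (h₂ := fun s => w (x0 + r • p.1, s)) (h := fun s => t0 + r ^ 2 * s)
      p.2 ha h1
  · rw [hessForm_comp_affine hc, tracePair_smul]

lemma SuperAt.comp_zoom {w : Spc' n × ℝ → ℝ} {x0 : Spc' n} {t0 r : ℝ} {p : Spc' n × ℝ}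
    (hw : SuperAt lam Lam w (zoom x0 t0 r p)) :
    SuperAt lam Lam (fun q => w (zoom x0 t0 r q)) p := by
  obtain ⟨hc, a, S, ha, hS, h⟩ := hw
  obtain ⟨h1, h2, h3⟩ := tracePair_hessForm_zoom (S := S) hc ha
  exact ⟨h1, r ^ 2 * a, S, h2, hS, h3.trans_le (mul_le_mul_of_nonneg_left h (sq_nonneg r))⟩

lemma SolAt.comp_zoom {w : Spc' n × ℝ → ℝ} {x0 : Spc' n} {t0 r : ℝ} {p : Spc' n × ℝ}
    (hw : SolAt lam Lam w (zoom x0 t0 r p)) :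
    SolAt lam Lam (fun q => w (zoom x0 t0 r q)) p := by
  obtain ⟨hc, a, S, ha, hS, h⟩ := hw
  obtain ⟨h1, h2, h3⟩ := tracePair_hessForm_zoom (S := S) hc ha
  exact ⟨h1, r ^ 2 * a, S, h2, hS, h3.trans (by rw [h])⟩

lemma continuous_zoom (x0 : Spc' n) (t0 r : ℝ) : Continuous (zoom x0 t0 r) := by
  unfold zoom; fun_prop

lemma dist_zoom_fst (x0 y : Spc' n) {r : ℝ} (hr : 0 < r) : dist (x0 + r • y) x0 = r * ‖y‖ := by
  rw [dist_eq_norm, add_sub_cancel_left, norm_smul, Real.norm_of_nonneg hr.le]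

lemma zoom_mem_ball_iff {x0 y : Spc' n} {r ρ : ℝ} (hr : 0 < r) :
    x0 + r • y ∈ Metric.ball x0 (r * ρ) ↔ y ∈ Metric.ball (0 : Spc' n) ρ := by
  rw [Metric.mem_ball, dist_zoom_fst _ _ hr, mem_ball_zero_iff, mul_lt_mul_iff_right₀ hr]

lemma zoom_mem_closedBall_iff {x0 y : Spc' n} {r ρ : ℝ} (hr : 0 < r) :
    x0 + r • y ∈ Metric.closedBall x0 (r * ρ) ↔ y ∈ Metric.closedBall (0 : Spc' n) ρ := by
  rw [Metric.mem_closedBall, dist_zoom_fst _ _ hr, mem_closedBall_zero_iff,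
    mul_le_mul_iff_right₀ hr]

lemma exists_zoom_eq (x0 : Spc' n) (t0 : ℝ) {r : ℝ} (hr : 0 < r) (p : Spc' n × ℝ) :
    ∃ q, zoom x0 t0 r q = p :=
  ⟨(r⁻¹ • (p.1 - x0), (p.2 - t0) / r ^ 2), by
    ext1
    · simp [zoom, smul_smul, mul_inv_cancel₀ hr.ne']
    · simp [zoom, mul_div_cancel₀ _ (pow_ne_zero 2 hr.ne')]⟩

lemma volume_zoom_image (x0 : Spc' n) (t0 : ℝ) {r : ℝ} (hr : 0 < r) (S : Set (Spc' n × ℝ)) :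
    volume (zoom x0 t0 r '' S) = ENNReal.ofReal (r ^ (n + 2)) * volume S := by
  set L : Spc' n × ℝ →ₗ[ℝ] Spc' n × ℝ :=
    LinearMap.prodMap (r • LinearMap.id) (r ^ 2 • LinearMap.id) with hL
  have h1 : zoom x0 t0 r '' S = (fun p => (x0, t0) + p) '' (L '' S) := by
    rw [image_image]
    refine image_congr fun p _ => ?_
    simp [hL, zoom]
  have hdet : LinearMap.det L = r ^ (n + 2) := by
    rw [hL, LinearMap.det_prodMap, LinearMap.det_smul, LinearMap.det_smul]
    simp [pow_add]
  have : Measure.IsAddHaarMeasure (volume : Measure (Spc' n × ℝ)) := by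
    rw [Measure.volume_eq_prod]; infer_instance
  rw [h1, image_add_left, measure_preimage_add, Measure.addHaar_image_linearMap, hdet,
    abs_of_pos (by positivity)]

/-- Scaled version of the measure estimate. -/
lemma exists_measure_estimate (n : ℕ) {lam Lam : ℝ} (hlam : 0 < lam) (hLam : 0 ≤ Lam) :
    ∃ μ : ℝ, 0 < μ ∧ ∀ (w : Spc' n × ℝ → ℝ) (x0 : Spc' n) (t0 r h : ℝ), 0 < r → 0 < h →
      ContinuousOn w (Metric.closedBall x0 r ×ˢ Icc (t0 - r ^ 2) t0) →
      (∀ p ∈ Metric.closedBall x0 r ×ˢ Icc (t0 - r ^ 2) t0, 0 ≤ w p) →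
      (∀ p ∈ Metric.ball x0 r ×ˢ Ioo (t0 - r ^ 2) t0, w p < 10 * h → SuperAt lam Lam w p) →
      w (x0, t0) ≤ h →
      ENNReal.ofReal (μ * r ^ (n + 2)) ≤
        volume {p | p ∈ Metric.ball x0 r ×ˢ Ioo (t0 - r ^ 2) t0 ∧ w p ≤ 9 * h} := by
  obtain ⟨μ, hμ, H⟩ := exists_measure_estimate_unit n hlam hLam
  refine ⟨μ, hμ, fun w x0 t0 r h hr hh hcont hpos hsup h0 => ?_⟩
  have hr2 : 0 < r ^ 2 := by positivity
  have hcl : ∀ q ∈ Metric.closedBall (0 : Spc' n) 1 ×ˢ Icc (-1 : ℝ) 0,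
      zoom x0 t0 r q ∈ Metric.closedBall x0 r ×ˢ Icc (t0 - r ^ 2) t0 := by
    rintro ⟨y, s⟩ ⟨hy, hs⟩
    refine ⟨?_, ?_, ?_⟩
    · have := (zoom_mem_closedBall_iff (x0 := x0) hr).2 hy
      rwa [mul_one] at this
    · simp only [zoom]; nlinarith [hs.1]
    · simp only [zoom]; nlinarith [hs.2]
  have hop : ∀ q ∈ Metric.ball (0 : Spc' n) 1 ×ˢ Ioo (-1 : ℝ) 0,
      zoom x0 t0 r q ∈ Metric.ball x0 r ×ˢ Ioo (t0 - r ^ 2) t0 := by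
    rintro ⟨y, s⟩ ⟨hy, hs⟩
    refine ⟨?_, ?_, ?_⟩
    · have := (zoom_mem_ball_iff (x0 := x0) hr).2 hy
      rwa [mul_one] at this
    · simp only [zoom]; nlinarith [hs.1]
    · simp only [zoom]; nlinarith [hs.2]
  have key := H (fun q => h⁻¹ * w (zoom x0 t0 r q))
    (continuousOn_const.mul (hcont.comp (continuous_zoom x0 t0 r).continuousOn hcl))
    (fun q hq => mul_nonneg (inv_nonneg.2 hh.le) (hpos _ (hcl q hq)))
    (fun q hq hlt => by
      refine SuperAt.const_mul ((hsup _ (hop q hq) ?_).comp_zoom) (inv_nonneg.2 hh.le)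
      rwa [inv_mul_lt_iff₀ hh, mul_comm] at hlt)
    (by
      rw [inv_mul_le_iff₀ hh, mul_one]
      simpa [zoom] using h0)
  calc ENNReal.ofReal (μ * r ^ (n + 2))
      = ENNReal.ofReal (r ^ (n + 2)) * ENNReal.ofReal μ := by
        rw [← ENNReal.ofReal_mul (by positivity), mul_comm]
    _ ≤ ENNReal.ofReal (r ^ (n + 2)) * _ := by gcongr
    _ = _ := (volume_zoom_image x0 t0 hr _).symm
    _ ≤ _ := by
      refine measure_mono ?_
      rintro _ ⟨q, ⟨hq, h9⟩, rfl⟩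
      refine ⟨hop q hq, ?_⟩
      rwa [inv_mul_le_iff₀ hh, mul_comm] at h9

end Scaling

/-! ### Covering by stacked cylinders -/

lemma volume_biUnion_Ioo_le_stack {ι : Type*} (F : Finset ι) (a b : ι → ℝ) (hab : ∀ i ∈ F, a i < b i)
    (m : ℕ) (y : ℝ) :
    (m : ℝ≥0∞) * volume ((⋃ i ∈ F, Ioo (a i) (b i)) ∩ Ici y) ≤
      (m + 1) * volume ((⋃ i ∈ F, Ioo (b i) (b i + m * (b i - a i))) ∩ Ici y) := by
  induction hk : (F.filter fun i => y < b i).card using Nat.strong_induction_on generalizing y with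
  | _ k ih =>
  rcases (F.filter fun i => y < b i).eq_empty_or_nonempty with h | h
  · have : (⋃ i ∈ F, Ioo (a i) (b i)) ∩ Ici y = ∅ := by
      rw [eq_empty_iff_forall_notMem]
      rintro x ⟨hx, hy⟩
      simp only [mem_iUnion] at hx
      obtain ⟨i, hi, hx⟩ := hx
      have : i ∈ F.filter fun i => y < b i :=
        Finset.mem_filter.2 ⟨hi, lt_of_le_of_lt hy hx.2⟩
      rw [h] at this
      exact absurd this (Finset.notMem_empty i)
    rw [this]; simp
  · obtain ⟨j, hj, hmin⟩ := Finset.exists_min_image _ a h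
    rw [Finset.mem_filter] at hj
    set y' := b j + m * (b j - a j) with hy'
    have hℓ : 0 < b j - a j := sub_pos.2 (hab j hj.1)
    have hby : b j ≤ y' := by have : (0 : ℝ) ≤ m * (b j - a j) := by positivity
                              linarith
    have hcard : (F.filter fun i => y' < b i).card < k := by
      rw [← hk]
      refine Finset.card_lt_card ?_
      rw [Finset.ssubset_iff_of_subset]
      · exact ⟨j, Finset.mem_filter.2 hj, fun h' => absurd (Finset.mem_filter.1 h').2 (not_lt.2 hby)⟩
      · intro i hi
        rw [Finset.mem_filter] at hi ⊢
        exact ⟨hi.1, by linarith [hi.2, hj.2]⟩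
    have IH := ih _ hcard y' rfl
    set I := ⋃ i ∈ F, Ioo (a i) (b i)
    set S := ⋃ i ∈ F, Ioo (b i) (b i + m * (b i - a i)) with hS
    have h1 : I ∩ Ici y ⊆ Icc (a j) y' ∪ I ∩ Ici y' := by
      rintro x ⟨hx, hxy⟩
      by_cases hxy' : y' ≤ x
      · exact Or.inr ⟨hx, hxy'⟩
      · refine Or.inl ⟨?_, (not_le.1 hxy').le⟩
        have hx' := hx
        simp only [I, mem_iUnion] at hx'
        obtain ⟨i, hi, hx'⟩ := hx'
        exact (hmin i (Finset.mem_filter.2 ⟨hi, lt_of_le_of_lt hxy hx'.2⟩)).trans hx'.1.le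
    have h2 : Ioo (b j) y' ∪ S ∩ Ici y' ⊆ S ∩ Ici y := by
      rintro x (hx | ⟨hx, hxy⟩)
      · refine ⟨?_, by simp only [mem_Ici]; linarith [hx.1, hj.2]⟩
        rw [hS, mem_iUnion₂]
        exact ⟨j, hj.1, hx⟩
      · refine ⟨hx, ?_⟩
        simp only [mem_Ici] at hxy ⊢
        linarith [hj.2]
    have hdisj : Disjoint (Ioo (b j) y') (S ∩ Ici y') := by
      rw [disjoint_left]
      rintro x hx ⟨_, hx'⟩
      exact absurd hx.2 (not_lt.2 hx')
    have hSm : MeasurableSet (S ∩ Ici y') :=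
      (F.measurableSet_biUnion fun i _ => measurableSet_Ioo).inter measurableSet_Ici
    calc (m : ℝ≥0∞) * volume (I ∩ Ici y)
        ≤ m * (volume (Icc (a j) y') + volume (I ∩ Ici y')) := by
          gcongr
          exact (measure_mono h1).trans (measure_union_le _ _)
      _ = m * volume (Icc (a j) y') + m * volume (I ∩ Ici y') := mul_add _ _ _
      _ ≤ (m + 1) * volume (Ioo (b j) y') + (m + 1) * volume (S ∩ Ici y') := by
          refine add_le_add (le_of_eq ?_) IH
          rw [Real.volume_Icc, Real.volume_Ioo, ← ENNReal.ofReal_natCast, ← ENNReal.ofReal_one,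
            ← ENNReal.ofReal_add (by positivity) zero_le_one, ← ENNReal.ofReal_mul (by positivity),
            ← ENNReal.ofReal_mul (by positivity)]
          congr 1
          rw [hy']; ring
      _ = (m + 1) * volume (Ioo (b j) y' ∪ S ∩ Ici y') := by
          rw [measure_union hdisj hSm, mul_add]
      _ ≤ _ := by gcongr

lemma volume_biUnion_prod_le_stack {n : ℕ} {ι : Type*} (F : Finset ι) (B : ι → Set (Spc' n))
    (hB : ∀ i, MeasurableSet (B i)) (a b : ι → ℝ) (hab : ∀ i ∈ F, a i < b i) (m : ℕ) :
    (m : ℝ≥0∞) * volume (⋃ i ∈ F, B i ×ˢ Ioo (a i) (b i)) ≤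
      (m + 1) * volume (⋃ i ∈ F, B i ×ˢ Ioo (b i) (b i + m * (b i - a i))) := by
  have hm : ∀ c d : ι → ℝ, MeasurableSet (⋃ i ∈ F, B i ×ˢ Ioo (c i) (d i)) := fun c d =>
    F.measurableSet_biUnion fun i _ => (hB i).prod measurableSet_Ioo
  have hsl : ∀ (c d : ι → ℝ) (x : Spc' n), Prod.mk x ⁻¹' (⋃ i ∈ F, B i ×ˢ Ioo (c i) (d i)) =
      ⋃ i ∈ F.filter fun i => x ∈ B i, Ioo (c i) (d i) := by
    intro c d x
    ext t
    simp only [mem_preimage, mem_iUnion, Finset.mem_filter, mem_prod, exists_prop, and_assoc]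
  rw [Measure.volume_eq_prod, Measure.prod_apply (hm _ _), Measure.prod_apply (hm _ _),
    ← lintegral_const_mul' _ _ (by simp), ← lintegral_const_mul' _ _ (by finiteness)]
  refine lintegral_mono fun x => ?_
  simp only [hsl]
  set F' := F.filter fun i => x ∈ B i
  set I := ⋃ i ∈ F', Ioo (a i) (b i)
  obtain ⟨y, hy⟩ : ∃ y, ∀ i ∈ F', y ≤ a i := by
    obtain ⟨y, hy⟩ := (F'.finite_toSet.image a).bddBelow
    exact ⟨y, fun i hi => hy (mem_image_of_mem _ hi)⟩
  have hI : I ∩ Ici y = I := by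
    refine inter_eq_left.2 fun t ht => ?_
    simp only [I, mem_iUnion] at ht
    obtain ⟨i, hi, ht⟩ := ht
    exact (hy i hi).trans ht.1.le
  have := volume_biUnion_Ioo_le_stack F' a b (fun i hi => hab i (Finset.mem_filter.1 hi).1) m y
  rw [hI] at this
  refine this.trans ?_
  gcongr
  exact inter_subset_left

/-- The centered parabolic cylinder of size `r`. -/
def pcyl {n : ℕ} (z : Spc' n × ℝ) (r : ℝ) : Set (Spc' n × ℝ) :=
  Metric.ball z.1 r ×ˢ Ioo (z.2 - r ^ 2) (z.2 + r ^ 2)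

lemma isOpen_pcyl {n : ℕ} (z : Spc' n × ℝ) (r : ℝ) : IsOpen (pcyl z r) :=
  Metric.isOpen_ball.prod isOpen_Ioo

lemma mem_pcyl_self {n : ℕ} (z : Spc' n × ℝ) {r : ℝ} (hr : 0 < r) : z ∈ pcyl z r :=
  ⟨Metric.mem_ball_self hr, by constructor <;> nlinarith⟩

lemma volume_pcyl {n : ℕ} (z : Spc' n × ℝ) {r : ℝ} (hr : 0 < r) :
    volume (pcyl z r) = ENNReal.ofReal (r ^ (n + 2)) * volume (pcyl (0 : Spc' n × ℝ) 1) := by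
  rw [← volume_zoom_image z.1 z.2 hr]
  congr 1
  ext p
  constructor
  · intro hp
    obtain ⟨q, rfl⟩ := exists_zoom_eq z.1 z.2 hr p
    refine ⟨q, ⟨?_, ?_⟩, rfl⟩
    · exact (zoom_mem_ball_iff (x0 := z.1) hr).1 (by rw [mul_one]; exact hp.1)
    · have h2 := hp.2
      simp only [zoom, mem_Ioo] at h2
      have hr2 : 0 < r ^ 2 := by positivity
      constructor
      · simp only [Prod.snd_zero]; nlinarith
      · simp only [Prod.snd_zero]; nlinarith
  · rintro ⟨q, ⟨h1, h2⟩, rfl⟩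
    have hr2 : 0 < r ^ 2 := by positivity
    refine ⟨?_, ?_⟩
    · have := (zoom_mem_ball_iff (x0 := z.1) hr).2 h1
      rwa [mul_one] at this
    · simp only [Prod.snd_zero, mem_Ioo] at h2
      simp only [zoom]
      constructor <;> nlinarith

/-- The stack of height `m` on top of the cylinder `pcyl z r`. -/
def stack {n : ℕ} (m : ℕ) (z : Spc' n × ℝ) (r : ℝ) : Set (Spc' n × ℝ) :=
  Metric.ball z.1 r ×ˢ Ioo (z.2 + r ^ 2) (z.2 + r ^ 2 + m * (2 * r ^ 2))

lemma exists_stack_growth (n : ℕ) {μ : ℝ} (hμ : 0 < μ) :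
    ∃ (m : ℕ) (κ : ℝ), 0 < m ∧ 0 < κ ∧ ∀ (Γ : Set (Spc' n × ℝ)) (R : Spc' n × ℝ → ℝ) (R₀ : ℝ),
      MeasurableSet Γ → (∀ z ∈ Γ, 0 < R z ∧ R z ≤ R₀) →
      (∀ z ∈ Γ, ENNReal.ofReal μ * volume (pcyl z (R z)) ≤ volume (pcyl z (R z) \ Γ)) →
      ENNReal.ofReal (1 + κ) * volume Γ ≤ volume (⋃ z ∈ Γ, stack m z (R z)) := by
  set κ₀ : ℝ := μ / 5 ^ (n + 2) with hκ₀
  have hκ : 0 < κ₀ := by positivity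
  obtain ⟨m, hm⟩ := exists_nat_gt (2 / κ₀ + 1)
  have hm0 : (0 : ℝ) < m := lt_trans (by positivity) hm
  refine ⟨m, κ₀ / 2, by exact_mod_cast hm0, by positivity, fun Γ R R₀ hΓ hR hbad => ?_⟩
  set U := ⋃ z ∈ Γ, pcyl z (R z) with hU
  have hUo : IsOpen U := isOpen_biUnion fun z _ => isOpen_pcyl z _
  have hΓU : Γ ⊆ U := fun z hz => mem_iUnion₂.2 ⟨z, hz, mem_pcyl_self z (hR z hz).1⟩
  obtain ⟨u, huΓ, hud, hcov⟩ := Vitali.exists_disjoint_subfamily_covering_enlargement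
    (fun z => pcyl z (R z)) Γ R 2 one_lt_two (fun z hz => (hR z hz).1.le) R₀
    (fun z hz => (hR z hz).2) (fun z hz => ⟨z, mem_pcyl_self z (hR z hz).1⟩)
  have hcount : u.Countable := hud.countable_of_isOpen (fun z _ => isOpen_pcyl z _)
    fun z hz => ⟨z, mem_pcyl_self z (hR z (huΓ hz)).1⟩
  have hU5 : U ⊆ ⋃ z ∈ u, pcyl z (5 * R z) := by
    intro p hp
    obtain ⟨a, ha, hpa⟩ := mem_iUnion₂.1 hp
    obtain ⟨b, hb, ⟨q, hqa, hqb⟩, hab⟩ := hcov a ha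
    refine mem_iUnion₂.2 ⟨b, hb, ?_, ?_⟩
    · have h1 := hpa.1; have h2 := hqa.1; have h3 := hqb.1
      rw [Metric.mem_ball] at *
      have := dist_triangle4_right p.1 b.1 q.1 a.1
      have t1 := dist_triangle p.1 a.1 b.1
      have t2 := dist_triangle_left a.1 b.1 q.1
      linarith
    · have h1 := hpa.2; have h2 := hqa.2; have h3 := hqb.2
      have ha0 := (hR a ha).1
      have : (R a) ^ 2 ≤ 4 * (R b) ^ 2 := by nlinarith
      simp only [mem_Ioo] at *
      constructor <;> nlinarith
  have h5 : volume U ≤ ENNReal.ofReal (5 ^ (n + 2)) * ∑' z : u, volume (pcyl z.1 (R z)) := by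
    calc volume U ≤ volume (⋃ z ∈ u, pcyl z (5 * R z)) := measure_mono hU5
      _ ≤ ∑' z : u, volume (pcyl z.1 (5 * R z)) := measure_biUnion_le _ hcount _
      _ = ∑' z : u, ENNReal.ofReal (5 ^ (n + 2)) * volume (pcyl z.1 (R z)) := by
          refine tsum_congr fun z => ?_
          have hz := (hR z (huΓ z.2)).1
          rw [volume_pcyl _ hz, volume_pcyl _ (by positivity), ← mul_assoc,
            ← ENNReal.ofReal_mul (by positivity), mul_pow]
      _ = _ := ENNReal.tsum_mul_left
  have hdiff : ENNReal.ofReal μ * ∑' z : u, volume (pcyl z.1 (R z)) ≤ volume (U \ Γ) := by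
    calc _ = ∑' z : u, ENNReal.ofReal μ * volume (pcyl z.1 (R z)) := ENNReal.tsum_mul_left.symm
      _ ≤ ∑' z : u, volume (pcyl z.1 (R z) \ Γ) := by
          gcongr with z
          exact hbad z (huΓ z.2)
      _ = volume (⋃ z ∈ u, pcyl z (R z) \ Γ) := by
          refine (measure_biUnion hcount ?_ fun z _ => (isOpen_pcyl z _).measurableSet.diff hΓ).symm
          exact hud.mono fun z => sdiff_subset
      _ ≤ _ := by
          refine measure_mono (iUnion₂_subset fun z hz => sdiff_subset_sdiff_left ?_)
          exact subset_biUnion_of_mem (u := fun z => pcyl z (R z)) (huΓ hz)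
  have hκU : ENNReal.ofReal κ₀ * volume U ≤ volume (U \ Γ) := by
    refine le_trans ?_ hdiff
    calc ENNReal.ofReal κ₀ * volume U
        ≤ ENNReal.ofReal κ₀ * (ENNReal.ofReal (5 ^ (n + 2)) * ∑' z : u, volume (pcyl z.1 (R z))) := by
          gcongr
      _ = _ := by
          rw [← mul_assoc, ← ENNReal.ofReal_mul hκ.le, hκ₀, div_mul_cancel₀ _ (by positivity)]
  have hgrow : ENNReal.ofReal (1 + κ₀) * volume Γ ≤ volume U := by
    rw [ENNReal.ofReal_add zero_le_one hκ.le, ENNReal.ofReal_one, add_mul, one_mul,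
      ← measure_inter_add_sdiff U hΓ, inter_eq_right.2 hΓU]
    refine add_le_add le_rfl (le_trans ?_ hκU)
    gcongr
  have hstack : (m : ℝ≥0∞) * volume U ≤ (m + 1) * volume (⋃ z ∈ Γ, stack m z (R z)) := by
    rw [hUo.measure_eq_iSup_isCompact, ENNReal.mul_iSup]
    refine iSup_le fun K => ?_
    rw [ENNReal.mul_iSup]
    refine iSup_le fun hKU => ?_
    rw [ENNReal.mul_iSup]
    refine iSup_le fun hK => ?_
    obtain ⟨t, ht, hKt⟩ := hK.elim_finite_subcover_image (b := Γ)
      (fun z _ => isOpen_pcyl z (R z)) hKU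
    obtain ⟨htf, hKt⟩ := hKt
    have key := volume_biUnion_prod_le_stack htf.toFinset (fun z => Metric.ball z.1 (R z))
      (fun z => Metric.isOpen_ball.measurableSet) (fun z => z.2 - R z ^ 2) (fun z => z.2 + R z ^ 2)
      (fun z hz => by
        have := (hR z (ht (htf.mem_toFinset.1 hz))).1
        nlinarith) m
    simp only [htf.mem_toFinset] at key
    calc (m : ℝ≥0∞) * volume K ≤ _ := by gcongr; exact hKt
      _ ≤ _ := key
      _ ≤ _ := by
          refine mul_le_mul_right (measure_mono ?_) _
          refine iUnion₂_subset fun z hz => ?_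
          refine subset_trans (le_of_eq ?_)
            (subset_biUnion_of_mem (u := fun z => stack m z (R z)) (ht hz))
          simp only [stack]
          congr 3
          ring
  have h3 : ENNReal.ofReal ((m + 1) * (1 + κ₀ / 2)) * volume Γ ≤
      ENNReal.ofReal (m + 1) * volume (⋃ z ∈ Γ, stack m z (R z)) := by
    calc _ ≤ ENNReal.ofReal (m * (1 + κ₀)) * volume Γ := by
          refine mul_le_mul_left (ENNReal.ofReal_le_ofReal ?_) _
          have : 2 / κ₀ * κ₀ = 2 := div_mul_cancel₀ _ hκ.ne'
          nlinarith
      _ = m * (ENNReal.ofReal (1 + κ₀) * volume Γ) := by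
          rw [ENNReal.ofReal_mul hm0.le, ENNReal.ofReal_natCast, mul_assoc]
      _ ≤ m * volume U := by gcongr
      _ ≤ _ := hstack
      _ = _ := by
          rw [ENNReal.ofReal_add hm0.le zero_le_one, ENNReal.ofReal_natCast, ENNReal.ofReal_one]
  rw [ENNReal.ofReal_mul (by positivity), mul_assoc] at h3
  exact (ENNReal.mul_le_mul_iff_right (by simp; positivity) ENNReal.ofReal_ne_top).1 h3

/-! ### Growth from measure to pointwise bounds -/

section Growth

variable {n : ℕ} {lam Lam : ℝ}

lemma volume_pcyl_lt_top (z : Spc' n × ℝ) (r : ℝ) : volume (pcyl z r) < ∞ := by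
  rw [pcyl, Measure.volume_eq_prod, Measure.prod_prod]
  exact ENNReal.mul_lt_top measure_ball_lt_top (by simp)

lemma volume_pcyl_pos (z : Spc' n × ℝ) {r : ℝ} (hr : 0 < r) : 0 < volume (pcyl z r) := by
  have : Measure.IsAddHaarMeasure (volume : Measure (Spc' n × ℝ)) := by
    rw [Measure.volume_eq_prod]; infer_instance
  exact (isOpen_pcyl z r).measure_pos volume ⟨z, mem_pcyl_self z hr⟩

lemma exists_pcyl_subset {U : Set (Spc' n × ℝ)} (hU : IsOpen U) {z : Spc' n × ℝ} (hz : z ∈ U) :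
    ∃ ε, 0 < ε ∧ ∀ r, 0 < r → r ≤ ε → pcyl z r ⊆ U := by
  obtain ⟨ε, hε, hsub⟩ := Metric.isOpen_iff.1 hU z hz
  refine ⟨min ε 1, by positivity, fun r hr hrε p hp => hsub ?_⟩
  have h1 := hrε.trans (min_le_left _ _)
  have h2 := hrε.trans (min_le_right _ _)
  rw [Metric.mem_ball, Prod.dist_eq, max_lt_iff]
  refine ⟨(Metric.mem_ball.1 hp.1).trans_le h1, ?_⟩
  rw [Real.dist_eq, abs_lt]
  have := hp.2.1
  have := hp.2.2
  constructor <;> nlinarith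

/-- If the sublevel set of a supersolution has small density in a cylinder then the
supersolution is bounded below on a slice. -/
lemma exists_density_bound (n : ℕ) (hlam : 0 < lam) (hLam : 0 ≤ Lam) :
    ∃ μ : ℝ, 0 < μ ∧ ∀ (w : Spc' n × ℝ → ℝ) (Γ : Set (Spc' n × ℝ)) (z : Spc' n × ℝ) (r h : ℝ),
      0 < r → 0 < h → ContinuousOn w (pcyl z r) → (∀ p ∈ pcyl z r, 0 ≤ w p) →
      (∀ p ∈ pcyl z r, SuperAt lam Lam w p) → (∀ p ∈ Γ, h < w p) →
      volume (pcyl z r \ Γ) < ENNReal.ofReal μ * volume (pcyl z r) →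
      ∀ y ∈ Metric.closedBall z.1 (r / 4), h / 9 ≤ w (y, z.2 + r ^ 2 / 2) := by
  obtain ⟨μ, hμ, H⟩ := exists_measure_estimate n hlam hLam
  set v := (volume (pcyl (0 : Spc' n × ℝ) 1)).toReal with hv
  have hv0 : 0 < v := ENNReal.toReal_pos (volume_pcyl_pos _ one_pos).ne' (volume_pcyl_lt_top _ _).ne
  refine ⟨μ / 2 ^ (n + 2) / v, by positivity, ?_⟩
  intro w Γ z r h hr hh hc h0 hS hΓ hsmall y hy
  by_contra hlt
  rw [not_le] at hlt
  have hyr := Metric.mem_closedBall.1 hy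
  have hr2 : 0 < r ^ 2 := by positivity
  have hsub : Metric.closedBall y (r / 2) ×ˢ
      Icc (z.2 + r ^ 2 / 2 - (r / 2) ^ 2) (z.2 + r ^ 2 / 2) ⊆ pcyl z r := by
    rintro p ⟨hp1, hp2⟩
    refine ⟨?_, ?_⟩
    · rw [Metric.mem_closedBall] at hp1
      rw [Metric.mem_ball]
      have := dist_triangle p.1 y z.1
      linarith
    · rw [mem_Icc] at hp2
      constructor <;> nlinarith
  have hsub' : Metric.ball y (r / 2) ×ˢ
      Ioo (z.2 + r ^ 2 / 2 - (r / 2) ^ 2) (z.2 + r ^ 2 / 2) ⊆ pcyl z r :=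
    (Set.prod_mono Metric.ball_subset_closedBall Ioo_subset_Icc_self).trans hsub
  have key := H w y (z.2 + r ^ 2 / 2) (r / 2) (h / 9) (by positivity) (by positivity)
    (hc.mono hsub) (fun p hp => h0 p (hsub hp)) (fun p hp _ => hS p (hsub' hp)) hlt.le
  refine absurd (key.trans (measure_mono ?_)) (not_le.2 (hsmall.trans_eq ?_))
  · rintro p ⟨hp, hp9⟩
    refine ⟨hsub' hp, fun hpΓ => ?_⟩
    have := hΓ p hpΓ
    linarith
  · rw [volume_pcyl _ hr, ← ENNReal.ofReal_toReal (volume_pcyl_lt_top (0 : Spc' n × ℝ) 1).ne, ← hv,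
      ← ENNReal.ofReal_mul (by positivity), ← ENNReal.ofReal_mul (by positivity)]
    congr 1
    rw [div_pow]
    field_simp

set_option maxHeartbeats 1000000 in
lemma exists_growth_unit (n : ℕ) (hlam : 0 < lam) (hLam : 0 ≤ Lam) {η : ℝ} (hη : 0 < η) :
    ∃ c : ℝ, 0 < c ∧ ∀ w : Spc' n × ℝ → ℝ,
      ContinuousOn w (Metric.closedBall 0 8 ×ˢ Icc (-2) 3) →
      (∀ p ∈ Metric.closedBall (0 : Spc' n) 8 ×ˢ Icc (-2 : ℝ) 3, 0 ≤ w p) →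
      (∀ p ∈ Metric.closedBall (0 : Spc' n) 8 ×ˢ Icc (-2 : ℝ) 3, SuperAt lam Lam w p) →
      ENNReal.ofReal η ≤
        volume {p | p ∈ Metric.ball (0 : Spc' n) 1 ×ˢ Ioo (-1 : ℝ) 0 ∧ 1 < w p} →
      ∀ p ∈ Metric.closedBall (0 : Spc' n) 1 ×ˢ Icc (2 : ℝ) 3, c ≤ w p := by
  obtain ⟨μ, hμ, hdens⟩ := exists_density_bound n hlam hLam
  obtain ⟨m, κ, hm, hκ, hgrow⟩ := exists_stack_growth n hμ
  obtain ⟨q, hq⟩ := exists_propagation n (Lam := Lam) hlam (θ₁ := 3.5 / 4)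
    (θ₂ := (3.5 + 8 * m) / 4) (by norm_num) (by
      have : (0 : ℝ) ≤ m := by positivity
      linarith)
  obtain ⟨q', hq'⟩ := exists_propagation n (Lam := Lam) hlam (θ₁ := 0.8 / 9) (θ₂ := 4.5 / 9)
    (by norm_num) (by norm_num)
  set V := (volume (pcyl (0 : Spc' n × ℝ) 2)).toReal with hV
  obtain ⟨J, hJ⟩ : ∃ J : ℕ, V < (1 + κ) ^ (J + 1) * η := by
    obtain ⟨J, hJ⟩ := pow_unbounded_of_one_lt (V / η) (by linarith : 1 < 1 + κ)
    refine ⟨J, ?_⟩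
    rw [div_lt_iff₀ hη] at hJ
    refine hJ.trans_le ?_
    gcongr <;> linarith
  set σ : ℝ := 1 / (J + 1 : ℕ) with hσ
  have hσ0 : 0 < σ := by positivity
  have hσJ : (J + 1 : ℕ) * σ = 1 := by rw [hσ]; field_simp
  have hσ1 : σ ≤ 1 := by
    rw [hσ, div_le_one (by positivity)]; push_cast; linarith [(Nat.cast_nonneg J : (0 : ℝ) ≤ J)]
  set r₀ : ℝ := σ / (4 + 8 * m) with hr₀
  have hr0 : 0 < r₀ := by positivity
  have hm1 : (1 : ℝ) ≤ m := by exact_mod_cast hm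
  have hr0σ : r₀ * (4 + 8 * m) = σ := by rw [hr₀]; field_simp
  have hr0q : r₀ ≤ σ / 12 := by nlinarith
  set c : ℝ := 1 / 18 * (1 / 16) ^ q with hc
  have hc0 : 0 < c := by positivity
  have hc1 : c ≤ 1 := by
    have : ((1 : ℝ) / 16) ^ q ≤ 1 := pow_le_one₀ (by norm_num) (by norm_num)
    linarith
  refine ⟨c ^ (J + 1) / 9 * (r₀ / 4 / (2 * 3)) ^ q', by positivity, ?_⟩
  intro w hcont h0 hS hvol
  set D := Metric.closedBall (0 : Spc' n) 8 ×ˢ Icc (-2 : ℝ) 3 with hD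
  set Γ : ℕ → Set (Spc' n × ℝ) := fun j =>
    (Metric.ball 0 (1 + j * σ) ×ˢ Ioo (-1) (j * σ)) ∩ w ⁻¹' Ioi (c ^ j) with hΓ
  have hjσ : ∀ j : ℕ, j ≤ J + 1 → (j : ℝ) * σ ≤ 1 := fun j hj => by
    rw [← hσJ]; gcongr
  -- cylinders around points of `Γ j` stay inside the domain
  have hdom : ∀ j ≤ J + 1, ∀ z ∈ Γ j, ‖z.1‖ < 2 ∧ -1 < z.2 ∧ z.2 < 1 := by
    rintro j hj z ⟨⟨h1, h2⟩, -⟩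
    have := hjσ j hj
    rw [mem_ball_zero_iff] at h1
    exact ⟨by linarith, h2.1, by linarith [h2.2]⟩
  have hbox : ∀ z : Spc' n × ℝ, ‖z.1‖ < 2 → ∀ ρ ≤ 6, Metric.closedBall z.1 ρ ⊆
      Metric.closedBall (0 : Spc' n) 8 := by
    intro z hz ρ hρ
    refine Metric.closedBall_subset_closedBall' ?_
    rw [dist_zero_right]; linarith
  have hcylD : ∀ j ≤ J + 1, ∀ z ∈ Γ j, ∀ r, 0 < r → r ≤ r₀ → pcyl z r ⊆ D := by
    intro j hj z hz r hr hrr p hp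
    obtain ⟨h1, h2, h3⟩ := hdom j hj z hz
    refine ⟨hbox z h1 r (by linarith) (Metric.ball_subset_closedBall hp.1), ?_, ?_⟩
    · have := hp.2.1; nlinarith
    · have := hp.2.2; nlinarith
  have hopen : ∀ j ≤ J + 1, IsOpen (Γ j) := by
    intro j hj
    refine (hcont.mono ?_).isOpen_inter_preimage (Metric.isOpen_ball.prod isOpen_Ioo) isOpen_Ioi
    have := hjσ j hj
    refine Set.prod_mono (Metric.ball_subset_closedBall.trans
      (Metric.closedBall_subset_closedBall (by linarith))) (Ioo_subset_Icc_self.trans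
        (Icc_subset_Icc (by norm_num) (by linarith)))
  -- the slice bound
  have hslice : ∀ j ≤ J + 1, ∀ z ∈ Γ j, ∀ r, 0 < r → r ≤ r₀ →
      volume (pcyl z r \ Γ j) < ENNReal.ofReal μ * volume (pcyl z r) →
      ∀ y ∈ Metric.closedBall z.1 (r / 4), c ^ j / 9 ≤ w (y, z.2 + r ^ 2 / 2) := by
    intro j hj z hz r hr hrr hsm
    have hsub := hcylD j hj z hz r hr hrr
    exact hdens w (Γ j) z r (c ^ j) hr (by positivity) (hcont.mono hsub)
      (fun p hp => h0 p (hsub hp)) (fun p hp => hS p (hsub hp)) (fun p hp => hp.2) hsm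
  -- alternative one
  by_cases halt : ∃ j ≤ J + 1, ∃ z ∈ Γ j,
      volume (pcyl z r₀ \ Γ j) < ENNReal.ofReal μ * volume (pcyl z r₀)
  · obtain ⟨j, hj, z, hz, hsm⟩ := halt
    rintro ⟨x, t⟩ ⟨hx, ht⟩
    obtain ⟨hz1, hz2, hz3⟩ := hdom j hj z hz
    have hsl := hslice j hj z hz r₀ hr0 le_rfl hsm
    rw [mem_closedBall_zero_iff] at hx
    simp only [mem_Icc] at ht
    have hsub : Metric.closedBall z.1 (2 * 3) ×ˢ Icc (z.2 + r₀ ^ 2 / 2) t ⊆ D :=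
      Set.prod_mono (hbox z hz1 _ (by norm_num)) (Icc_subset_Icc (by nlinarith) ht.2)
    have key := hq' w z.1 (z.2 + r₀ ^ 2 / 2) t (r₀ / 4) 3 (c ^ j / 9) (by positivity) (by linarith)
      (by positivity) (by nlinarith) (by nlinarith) (hcont.mono hsub) (fun p hp => h0 p (hsub hp))
      (fun p hp _ => hS p (hsub (Set.prod_mono Metric.ball_subset_closedBall Ioc_subset_Icc_self hp)))
      hsl x (by
        rw [Metric.mem_closedBall, dist_eq_norm]
        linarith [norm_sub_le x z.1])
    refine le_trans ?_ key
    have := pow_le_pow_of_le_one hc0.le hc1 hj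
    gcongr ?_ / 9 * _
  · push Not at halt
    exfalso
    have hstep : ∀ j ≤ J, ENNReal.ofReal (1 + κ) * volume (Γ j) ≤ volume (Γ (j + 1)) := by
      intro j hj
      have hj' : j ≤ J + 1 := by omega
      have hex : ∀ z ∈ Γ j, ∃ k : ℕ, volume (pcyl z (r₀ / 2 ^ k) \ Γ j) <
          ENNReal.ofReal μ * volume (pcyl z (r₀ / 2 ^ k)) := by
        intro z hz
        obtain ⟨ε, hε, hsub⟩ := exists_pcyl_subset (hopen j hj') hz
        have hlim : Tendsto (fun k : ℕ => r₀ / 2 ^ k) atTop (𝓝 0) :=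
          tendsto_const_nhds.div_atTop (tendsto_pow_atTop_atTop_of_one_lt one_lt_two)
        obtain ⟨k, hk⟩ := (hlim.eventually (gt_mem_nhds hε)).exists
        have hpos : 0 < r₀ / 2 ^ k := by positivity
        refine ⟨k, ?_⟩
        rw [sdiff_eq_empty.2 (hsub _ hpos hk.le), measure_empty]
        exact ENNReal.mul_pos (by simpa using hμ) (volume_pcyl_pos _ hpos).ne'
      have hrad : ∀ z ∈ Γ j, ∃ r, 0 < r ∧ 2 * r ≤ r₀ ∧
          volume (pcyl z r \ Γ j) < ENNReal.ofReal μ * volume (pcyl z r) ∧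
          ENNReal.ofReal μ * volume (pcyl z (2 * r)) ≤ volume (pcyl z (2 * r) \ Γ j) := by
        intro z hz
        have h1 := Nat.find_spec (hex z hz)
        have h2 := fun k => Nat.find_min (hex z hz) (m := k)
        rcases hk : Nat.find (hex z hz) with _ | k
        · rw [hk] at h1
          simp only [pow_zero, div_one] at h1
          exact absurd h1 (not_lt.2 (halt j hj' z hz))
        · rw [hk] at h1
          refine ⟨r₀ / 2 ^ (k + 1), by positivity, ?_, h1, ?_⟩
          · rw [pow_succ]
            have : r₀ / 2 ^ k ≤ r₀ := div_le_self hr0.le (one_le_pow₀ (by norm_num))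
            calc 2 * (r₀ / (2 ^ k * 2)) = r₀ / 2 ^ k := by field_simp
              _ ≤ _ := this
          · have : 2 * (r₀ / 2 ^ (k + 1)) = r₀ / 2 ^ k := by rw [pow_succ]; field_simp
            rw [this]
            exact not_lt.1 (h2 k (by omega))
      choose! ρ hρ0 hρr hρs hρb using hrad
      refine (hgrow (Γ j) (fun z => 2 * ρ z) r₀ (hopen j hj').measurableSet
        (fun z hz => ⟨by linarith [hρ0 z hz], hρr z hz⟩) hρb).trans (measure_mono ?_)
      refine iUnion₂_subset fun z hz => ?_
      rintro ⟨y, t⟩ ⟨hy, ht⟩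
      have hr := hρ0 z hz
      have hrr := hρr z hz
      set r := ρ z
      obtain ⟨hz1, hz2, hz3⟩ := hdom j hj' z hz
      have hsl := hslice j hj' z hz r hr (by linarith) (hρs z hz)
      simp only [mem_Ioo] at ht
      rw [Metric.mem_ball] at hy
      have hr2 : 0 < r ^ 2 := by positivity
      have hrs : (4 + 8 * m) * r ^ 2 ≤ σ := by
        have : r ^ 2 ≤ r₀ * 1 := by nlinarith
        nlinarith
      have htσ : t < z.2 + σ := by nlinarith [ht.2]
      have hzσ : z.2 < j * σ := hz.1.2.2
      have hj1 := hjσ (j + 1) (by omega)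
      push_cast at hj1
      have hsub : Metric.closedBall z.1 (2 * (2 * r)) ×ˢ Icc (z.2 + r ^ 2 / 2) t ⊆ D :=
        Set.prod_mono (hbox z hz1 _ (by linarith)) (Icc_subset_Icc (by nlinarith) (by nlinarith))
      have key := hq w z.1 (z.2 + r ^ 2 / 2) t (r / 4) (2 * r) (c ^ j / 9) (by positivity)
        (by linarith) (by positivity) (by nlinarith) (by nlinarith) (hcont.mono hsub)
        (fun p hp => h0 p (hsub hp))
        (fun p hp _ => hS p (hsub (Set.prod_mono Metric.ball_subset_closedBall Ioc_subset_Icc_self hp)))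
        hsl y hy.le
      refine ⟨⟨?_, ?_, ?_⟩, ?_⟩
      · have := hz.1.1
        rw [mem_ball_zero_iff] at this ⊢
        rw [dist_eq_norm] at hy
        have := norm_le_norm_add_norm_sub' y z.1
        push_cast
        linarith
      · simp only; nlinarith [ht.1]
      · push_cast; linarith
      · have h16 : r / 4 / (2 * (2 * r)) = 1 / 16 := by field_simp; norm_num
        rw [h16] at key
        simp only [mem_preimage, mem_Ioi]
        refine lt_of_lt_of_le ?_ key
        have : c ^ j / 9 * (1 / 16) ^ q = c ^ j * (2 * c) := by rw [hc]; ring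
        rw [this, pow_succ]
        have : 0 < c ^ j := by positivity
        nlinarith
    have hall : ∀ j ≤ J + 1, ENNReal.ofReal ((1 + κ) ^ j * η) ≤ volume (Γ j) := by
      intro j
      induction j with
      | zero =>
        intro _
        rw [pow_zero, one_mul]
        refine hvol.trans (measure_mono ?_)
        rintro p ⟨hp, hp1⟩
        simp only [hΓ, Nat.cast_zero, zero_mul, add_zero, pow_zero]
        exact ⟨hp, hp1⟩
      | succ j ih =>
        intro hj
        refine le_trans ?_ (hstep j (by omega))
        rw [pow_succ', mul_assoc, ENNReal.ofReal_mul (by linarith)]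
        gcongr
        exact ih (by omega)
    have h1 := hall (J + 1) le_rfl
    have h2 : volume (Γ (J + 1)) ≤ ENNReal.ofReal V := by
      rw [hV, ENNReal.ofReal_toReal (volume_pcyl_lt_top _ _).ne]
      refine measure_mono fun z hz => ?_
      obtain ⟨a, b, d⟩ := hdom _ le_rfl z hz
      refine ⟨by simpa using a, ?_, ?_⟩
      · simp only [Prod.snd_zero]; linarith
      · simp only [Prod.snd_zero]; linarith
    have h3 := (ENNReal.ofReal_le_ofReal_iff ENNReal.toReal_nonneg).1 (h1.trans h2)
    exact absurd hJ (not_lt.2 h3)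

/-- Growth lemma: a nonnegative supersolution which is large on a set of positive measure is
large everywhere later. -/
lemma exists_growth (n : ℕ) (hlam : 0 < lam) (hLam : 0 ≤ Lam) {η : ℝ} (hη : 0 < η) :
    ∃ c : ℝ, 0 < c ∧ ∀ (w : Spc' n × ℝ → ℝ) (x0 : Spc' n) (t0 r h : ℝ), 0 < r → 0 < h →
      ContinuousOn w (Metric.closedBall x0 (r * 8) ×ˢ Icc (t0 - 2 * r ^ 2) (t0 + 3 * r ^ 2)) →
      (∀ p ∈ Metric.closedBall x0 (r * 8) ×ˢ Icc (t0 - 2 * r ^ 2) (t0 + 3 * r ^ 2), 0 ≤ w p) →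
      (∀ p ∈ Metric.closedBall x0 (r * 8) ×ˢ Icc (t0 - 2 * r ^ 2) (t0 + 3 * r ^ 2),
        SuperAt lam Lam w p) →
      ENNReal.ofReal (η * r ^ (n + 2)) ≤
        volume {p | p ∈ Metric.ball x0 r ×ˢ Ioo (t0 - r ^ 2) t0 ∧ h < w p} →
      ∀ p ∈ Metric.closedBall x0 r ×ˢ Icc (t0 + 2 * r ^ 2) (t0 + 3 * r ^ 2), c * h ≤ w p := by
  obtain ⟨c, hc, H⟩ := exists_growth_unit n hlam hLam hη
  refine ⟨c, hc, fun w x0 t0 r h hr hh hcont hpos hsup hvol => ?_⟩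
  have hr2 : 0 < r ^ 2 := by positivity
  have hcl : ∀ q ∈ Metric.closedBall (0 : Spc' n) 8 ×ˢ Icc (-2 : ℝ) 3,
      zoom x0 t0 r q ∈ Metric.closedBall x0 (r * 8) ×ˢ Icc (t0 - 2 * r ^ 2) (t0 + 3 * r ^ 2) := by
    rintro ⟨y, s⟩ ⟨hy, hs⟩
    refine ⟨(zoom_mem_closedBall_iff (x0 := x0) hr).2 hy, ?_, ?_⟩
    · simp only [zoom]; nlinarith [hs.1]
    · simp only [zoom]; nlinarith [hs.2]
  have key := H (fun q => h⁻¹ * w (zoom x0 t0 r q))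
    (continuousOn_const.mul (hcont.comp (continuous_zoom x0 t0 r).continuousOn hcl))
    (fun q hq => mul_nonneg (inv_nonneg.2 hh.le) (hpos _ (hcl q hq)))
    (fun q hq => SuperAt.const_mul ((hsup _ (hcl q hq)).comp_zoom) (inv_nonneg.2 hh.le))
    (by
      have hrn : 0 < r ^ (n + 2) := by positivity
      refine (ENNReal.mul_le_mul_iff_right (a := ENNReal.ofReal (r ^ (n + 2)))
        (by simpa using hrn) ENNReal.ofReal_ne_top).1 ?_
      rw [← volume_zoom_image x0 t0 hr, ← ENNReal.ofReal_mul hrn.le, mul_comm]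
      refine hvol.trans (measure_mono ?_)
      rintro p ⟨⟨hp1, hp2⟩, hp3⟩
      obtain ⟨q, rfl⟩ := exists_zoom_eq x0 t0 hr p
      refine ⟨q, ⟨⟨(zoom_mem_ball_iff (x0 := x0) hr).1 (by rw [mul_one]; exact hp1), ?_⟩, ?_⟩, rfl⟩
      · simp only [zoom, mem_Ioo] at hp2
        constructor <;> nlinarith
      · rwa [lt_inv_mul_iff₀ hh, mul_one])
  rintro p ⟨hp1, hp2⟩
  obtain ⟨q, rfl⟩ := exists_zoom_eq x0 t0 hr p
  have := key q ⟨(zoom_mem_closedBall_iff (x0 := x0) hr).1 (by rw [mul_one]; exact hp1), by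
    simp only [zoom, mem_Icc] at hp2
    constructor <;> nlinarith⟩
  rwa [le_inv_mul_iff₀ hh, mul_comm] at this

end Growth

/-! ### Interior Harnack inequality -/

section Harnack

variable {n : ℕ} {lam Lam : ℝ}

/-- If a solution is almost maximal at the top of a backward cylinder, then it is bounded
below by a fraction of its maximum on a set of positive measure. -/
lemma exists_volume_ge_of_almost_max (n : ℕ) (hlam : 0 < lam) (hLam : 0 ≤ Lam) :
    ∃ μ : ℝ, 0 < μ ∧ ∀ (v : Spc' n × ℝ → ℝ) (x0 : Spc' n) (t0 r M : ℝ), 0 < r → 0 < M →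
      ContinuousOn v (Metric.closedBall x0 r ×ˢ Icc (t0 - r ^ 2) t0) →
      (∀ p ∈ Metric.closedBall x0 r ×ˢ Icc (t0 - r ^ 2) t0, v p ≤ 21 / 20 * M) →
      (∀ p ∈ Metric.ball x0 r ×ˢ Ioo (t0 - r ^ 2) t0, 0 < v p → SolAt lam Lam v p) →
      v (x0, t0) = M →
      ENNReal.ofReal (μ * r ^ (n + 2)) ≤
        volume {p | p ∈ Metric.ball x0 r ×ˢ Ioo (t0 - r ^ 2) t0 ∧ M / 2 < v p} := by
  obtain ⟨μ, hμ, H⟩ := exists_measure_estimate n hlam hLam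
  refine ⟨μ, hμ, fun v x0 t0 r M hr hM hc hle hS h0 => ?_⟩
  have e : ∀ p, 21 + (-20 / M) * v p = 21 - 20 * (v p / M) := fun p => by ring
  have key := H (fun p => 21 + (-20 / M) * v p) x0 t0 r 1 hr one_pos
    (continuousOn_const.add (continuousOn_const.mul hc))
    (fun p hp => by
      rw [e]
      have : v p / M ≤ 21 / 20 := (div_le_iff₀ hM).2 (hle p hp)
      linarith)
    (fun p hp hlt => by
      refine ((hS p hp ?_).affine _ _).superAt
      rw [e] at hlt
      by_contra hneg
      have : v p / M ≤ 0 := div_nonpos_of_nonpos_of_nonneg (not_lt.1 hneg) hM.le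
      linarith)
    (by rw [e, h0, div_self hM.ne']; norm_num)
  refine key.trans (measure_mono ?_)
  rintro p ⟨hp, hp9⟩
  refine ⟨hp, ?_⟩
  rw [e] at hp9
  have : 1 / 2 < v p / M := by linarith
  rw [lt_div_iff₀ hM] at this
  linarith

lemma exists_harnack_unit (n : ℕ) (hlam : 0 < lam) (hLam : 0 ≤ Lam) {θ Θ : ℝ} (hθ : 0 < θ)
    (hθΘ : θ ≤ Θ) :
    ∃ C : ℝ, 0 < C ∧ ∀ (v : Spc' n × ℝ → ℝ) (T : ℝ), θ ≤ T → T ≤ Θ →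
      ContinuousOn v (Metric.closedBall 0 1 ×ˢ Icc (-1) T) →
      (∀ p ∈ Metric.closedBall (0 : Spc' n) 1 ×ˢ Icc (-1) T, 0 ≤ v p) →
      (∀ p ∈ Metric.closedBall (0 : Spc' n) 1 ×ˢ Icc (-1) T, SolAt lam Lam v p) →
      ∀ x ∈ Metric.closedBall (0 : Spc' n) (1 / 16), ∀ y ∈ Metric.closedBall (0 : Spc' n) (1 / 16),
        v (y, 0) ≤ C * v (x, T) := by
  obtain ⟨μ, hμ, hM⟩ := exists_volume_ge_of_almost_max n hlam hLam
  obtain ⟨c, hc, hG⟩ := exists_growth n hlam hLam hμ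
  obtain ⟨q, hq⟩ := exists_propagation n (Lam := Lam) hlam (θ₁ := θ / 2 / (3 / 16) ^ 2)
    (θ₂ := (Θ + 1) / (3 / 16) ^ 2) (by positivity) (by gcongr; linarith)
  set γ := q + 1
  set ε : ℝ := min (min (1 / 8) (θ / 4)) (1 / (21 * γ)) with hε
  have hγ : (1 : ℝ) ≤ γ := by simp [γ]
  have hε0 : 0 < ε := by positivity
  have hε1 : ε ≤ 1 / 8 := (min_le_left _ _).trans (min_le_left _ _)
  have hε2 : ε ≤ θ / 4 := (min_le_left _ _).trans (min_le_right _ _)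
  have hε3 : ε * (21 * γ) ≤ 1 := by
    rw [← le_div_iff₀ (by positivity)]; exact min_le_right _ _
  have hpow : 20 / 21 ≤ (1 - ε) ^ γ := by
    have := one_add_mul_le_pow (show -2 ≤ -ε by linarith) γ
    rw [← sub_eq_add_neg] at this
    nlinarith
  refine ⟨(1 / 16 : ℝ)⁻¹ ^ γ * (c / 2 * (ε / (2 * (3 / 16))) ^ q)⁻¹, by positivity, ?_⟩
  intro v T hT1 hT2 hcont h0 hS x hx y hy
  set D := Metric.closedBall (0 : Spc' n) 1 ×ˢ Icc (-1 : ℝ) T with hD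
  rw [mem_closedBall_zero_iff] at hx hy
  have hxT : (x, T) ∈ D := ⟨mem_closedBall_zero_iff.2 (by simp only; linarith), by
    constructor <;> simp only <;> linarith⟩
  have hyT : (y, (0 : ℝ)) ∈ D := ⟨mem_closedBall_zero_iff.2 (by simp only; linarith), by
    constructor <;> simp only <;> linarith⟩
  rcases (h0 _ hyT).eq_or_lt with hy0 | hy0
  · rw [← hy0]
    have := h0 _ hxT
    positivity
  set K := Metric.closedBall (0 : Spc' n) (1 / 8) ×ˢ Icc (-1 : ℝ) 0 with hK
  have hKD : K ⊆ D := Set.prod_mono (Metric.closedBall_subset_closedBall (by norm_num))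
    (Icc_subset_Icc le_rfl (by linarith))
  set ρ : Spc' n × ℝ → ℝ := fun p => min (1 / 8 - ‖p.1‖) (p.2 + 1) with hρ
  have hρc : Continuous ρ := by fun_prop
  have hyK : (y, (0 : ℝ)) ∈ K := ⟨mem_closedBall_zero_iff.2 (by simp only; linarith), by simp⟩
  have hρy : 1 / 16 ≤ ρ (y, 0) := le_min (by simp only; linarith) (by norm_num)
  obtain ⟨⟨x1, t1⟩, hP, hmax⟩ := ((isCompact_closedBall (0 : Spc' n) (1 / 8)).prod
    (isCompact_Icc (a := (-1 : ℝ)) (b := 0))).exists_isMaxOn ⟨_, hyK⟩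
    ((hcont.mono hKD).mul ((hρc.pow γ).continuousOn))
  have hmax' : ∀ p ∈ K, v p * ρ p ^ γ ≤ v (x1, t1) * ρ (x1, t1) ^ γ := fun p hp => hmax hp
  set M := v (x1, t1) with hMdef
  set ρ₀ := ρ (x1, t1) with hρ₀
  have hM0 : 0 ≤ M := h0 _ (hKD hP)
  have hρnn : ∀ p ∈ K, 0 ≤ ρ p := fun p hp => by
    have h1 := mem_closedBall_zero_iff.1 hp.1
    exact le_min (by linarith) (by linarith [hp.2.1])
  have hpos : 0 < M * ρ₀ ^ γ := lt_of_lt_of_le (by positivity) (hmax' _ hyK)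
  have hρ0 : 0 < ρ₀ := by
    refine lt_of_le_of_ne (hρnn _ hP) fun h => ?_
    rw [← h, zero_pow (by simp [γ]), mul_zero] at hpos
    exact lt_irrefl _ hpos
  have hMpos : 0 < M := by
    refine lt_of_le_of_ne hM0 fun h => ?_
    rw [← h, zero_mul] at hpos
    exact lt_irrefl _ hpos
  have hρx : ρ₀ ≤ 1 / 8 - ‖x1‖ := min_le_left _ _
  have hρt : ρ₀ ≤ t1 + 1 := min_le_right _ _
  have ht1 : t1 ≤ 0 := hP.2.2
  have hx1 := norm_nonneg x1
  have hρ1 : ρ₀ ≤ 1 / 8 := by linarith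
  set r := ε * ρ₀ with hr
  have hr0 : 0 < r := by positivity
  have hrε : r ≤ ε / 8 := by rw [hr]; nlinarith
  have hrρ : r ≤ ρ₀ / 8 := by rw [hr]; nlinarith
  have hr2 : r ^ 2 ≤ r / 64 := by nlinarith
  have hr20 : 0 < r ^ 2 := by positivity
  have hnear : ∀ p ∈ Metric.closedBall x1 r ×ˢ Icc (t1 - r ^ 2) t1,
      p ∈ K ∧ (1 - ε) * ρ₀ ≤ ρ p := by
    rintro ⟨z, s⟩ ⟨hz, hs⟩
    rw [Metric.mem_closedBall, dist_eq_norm] at hz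
    have hz' := norm_le_norm_add_norm_sub' z x1
    simp only [mem_Icc] at hs
    have : (1 - ε) * ρ₀ = ρ₀ - r := by rw [hr]; ring
    refine ⟨⟨mem_closedBall_zero_iff.2 (by simp only at *; linarith), ?_, ?_⟩, ?_⟩
    · simp only; linarith
    · simp only; linarith
    · rw [this]
      refine le_min ?_ ?_ <;> simp only at * <;> linarith
  have hbd : ∀ p ∈ Metric.closedBall x1 r ×ˢ Icc (t1 - r ^ 2) t1, v p ≤ 21 / 20 * M := by
    intro p hp
    obtain ⟨hpK, hpρ⟩ := hnear p hp
    have h1 : v p * ((1 - ε) * ρ₀) ^ γ ≤ M * ρ₀ ^ γ := by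
      refine le_trans ?_ (hmax' p hpK)
      refine mul_le_mul_of_nonneg_left ?_ (h0 p (hKD hpK))
      exact pow_le_pow_left₀ (mul_nonneg (by linarith) hρ0.le) hpρ _
    rw [mul_pow, ← mul_assoc] at h1
    have h2 := le_of_mul_le_mul_right h1 (by positivity)
    nlinarith [h0 p (hKD hpK)]
  have hsub1 : Metric.closedBall x1 r ×ˢ Icc (t1 - r ^ 2) t1 ⊆ D := fun p hp => hKD (hnear p hp).1
  have hvol := hM v x1 t1 r M hr0 hMpos (hcont.mono hsub1) hbd
    (fun p hp _ => hS p (hsub1 (Set.prod_mono Metric.ball_subset_closedBall Ioo_subset_Icc_self hp)))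
    rfl
  have hball : ∀ s ≤ 7 / 8, Metric.closedBall x1 s ⊆ Metric.closedBall (0 : Spc' n) 1 :=
    fun s hs => Metric.closedBall_subset_closedBall' (by rw [dist_zero_right]; linarith)
  have hsub2 : Metric.closedBall x1 (r * 8) ×ˢ Icc (t1 - 2 * r ^ 2) (t1 + 3 * r ^ 2) ⊆ D :=
    Set.prod_mono (hball _ (by linarith)) (Icc_subset_Icc (by linarith) (by linarith))
  have hgr := hG v x1 t1 r (M / 2) hr0 (by positivity) (hcont.mono hsub2)
    (fun p hp => h0 p (hsub2 hp)) (fun p hp => (hS p (hsub2 hp)).superAt) hvol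
  have hsub3 : Metric.closedBall x1 (2 * (3 / 16)) ×ˢ Icc (t1 + 2 * r ^ 2) T ⊆ D :=
    Set.prod_mono (hball _ (by norm_num)) (Icc_subset_Icc (by linarith) le_rfl)
  have hpr := hq v x1 (t1 + 2 * r ^ 2) T r (3 / 16) (c * (M / 2)) hr0 (by linarith) (by positivity)
    (by rw [div_mul_cancel₀ _ (by norm_num)]; linarith)
    (by rw [div_mul_cancel₀ _ (by norm_num)]; linarith)
    (hcont.mono hsub3) (fun p hp => h0 p (hsub3 hp))
    (fun p hp _ => (hS p (hsub3 (Set.prod_mono Metric.ball_subset_closedBall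
      Ioc_subset_Icc_self hp))).superAt)
    (fun z hz => hgr (z, t1 + 2 * r ^ 2) ⟨hz, by constructor <;> simp only <;> linarith⟩) x
    (by
      rw [Metric.mem_closedBall, dist_eq_norm]
      linarith [norm_sub_le x x1])
  have hpr' : (c / 2 * (ε / (2 * (3 / 16))) ^ q) * (M * ρ₀ ^ γ) ≤ v (x, T) := by
    refine le_trans ?_ hpr
    have : c * (M / 2) * (r / (2 * (3 / 16))) ^ q =
        (c / 2 * (ε / (2 * (3 / 16))) ^ q) * (M * ρ₀ ^ q) := by
      rw [hr, mul_div_right_comm, mul_pow]; ring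
    rw [this]
    have : ρ₀ ^ γ ≤ ρ₀ ^ q := pow_le_pow_of_le_one hρ0.le (by linarith) (Nat.le_succ q)
    gcongr
  have hy1 : v (y, 0) * (1 / 16) ^ γ ≤ M * ρ₀ ^ γ := by
    refine le_trans ?_ (hmax' _ hyK)
    gcongr
  rw [mul_assoc, inv_pow, ← div_eq_inv_mul, le_div_iff₀ (by positivity)]
  refine hy1.trans ?_
  rw [← div_eq_inv_mul, le_div_iff₀ (by positivity), mul_comm]
  exact hpr'

/-- Interior Harnack inequality. -/
lemma exists_harnack (n : ℕ) (hlam : 0 < lam) (hLam : 0 ≤ Lam) {θ Θ : ℝ} (hθ : 0 < θ)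
    (hθΘ : θ ≤ Θ) :
    ∃ C : ℝ, 0 < C ∧ ∀ (v : Spc' n × ℝ → ℝ) (x0 : Spc' n) (t0 t R : ℝ), 0 < R →
      θ * R ^ 2 ≤ t - t0 → t - t0 ≤ Θ * R ^ 2 →
      ContinuousOn v (Metric.closedBall x0 R ×ˢ Icc (t0 - R ^ 2) t) →
      (∀ p ∈ Metric.closedBall x0 R ×ˢ Icc (t0 - R ^ 2) t, 0 ≤ v p) →
      (∀ p ∈ Metric.closedBall x0 R ×ˢ Icc (t0 - R ^ 2) t, SolAt lam Lam v p) →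
      ∀ x ∈ Metric.closedBall x0 (R * (1 / 16)), ∀ y ∈ Metric.closedBall x0 (R * (1 / 16)),
        v (y, t0) ≤ C * v (x, t) := by
  obtain ⟨C, hC, H⟩ := exists_harnack_unit n hlam hLam hθ hθΘ
  refine ⟨C, hC, fun v x0 t0 t R hR h1 h2 hcont h0 hS x hx y hy => ?_⟩
  have hR2 : 0 < R ^ 2 := by positivity
  have hcl : ∀ q ∈ Metric.closedBall (0 : Spc' n) 1 ×ˢ Icc (-1 : ℝ) ((t - t0) / R ^ 2),
      zoom x0 t0 R q ∈ Metric.closedBall x0 R ×ˢ Icc (t0 - R ^ 2) t := by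
    rintro ⟨y, s⟩ ⟨hy, hs⟩
    simp only [mem_Icc, le_div_iff₀ hR2] at hs
    refine ⟨?_, ?_, ?_⟩
    · have := (zoom_mem_closedBall_iff (x0 := x0) hR).2 hy
      rwa [mul_one] at this
    · simp only [zoom]; nlinarith [hs.1]
    · simp only [zoom]; nlinarith [hs.2]
  have key := H (fun q => v (zoom x0 t0 R q)) ((t - t0) / R ^ 2) ((le_div_iff₀ hR2).2 h1)
    ((div_le_iff₀ hR2).2 h2) (hcont.comp (continuous_zoom x0 t0 R).continuousOn hcl)
    (fun q hq => h0 _ (hcl q hq)) (fun q hq => (hS _ (hcl q hq)).comp_zoom)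
  obtain ⟨⟨x', s⟩, hx'⟩ := exists_zoom_eq x0 t0 hR (x, t)
  obtain ⟨⟨y', s'⟩, hy'⟩ := exists_zoom_eq x0 t0 hR (y, t0)
  simp only [zoom, Prod.mk.injEq] at hx' hy'
  rw [← hx'.1] at hx ⊢
  rw [← hy'.1] at hy ⊢
  have := key x' ((zoom_mem_closedBall_iff hR).1 hx) y' ((zoom_mem_closedBall_iff hR).1 hy)
  simp only [zoom, mul_zero, add_zero] at this
  rwa [mul_div_cancel₀ _ hR2.ne', add_sub_cancel] at this

end Harnack

/-! ### Joint continuity of separately regular nonnegative solutions -/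

section JointContinuity

variable {n : ℕ} {lam Lam : ℝ}

/-- The closed box of size `δ` around `p`. -/
def box {n : ℕ} (p : Spc' n × ℝ) (δ : ℝ) : Set (Spc' n × ℝ) :=
  Metric.closedBall p.1 δ ×ˢ Icc (p.2 - δ) (p.2 + δ)

lemma exists_cross_bounds (n : ℕ) (hlam : 0 < lam) (hLam : 0 ≤ Lam) :
    ∃ C : ℝ, 1 ≤ C ∧ ∀ (w : Spc' n × ℝ → ℝ) (F : Set (Spc' n × ℝ)) (p₀ : Spc' n × ℝ) (δ ℓ : ℝ),
      0 < δ → δ ≤ 1 → 0 ≤ ℓ → IsCompact F → p₀ ∈ F → F ⊆ box p₀ δ →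
      (∀ p ∈ box p₀ δ, SolAt lam Lam w p) → (∀ p ∈ box p₀ δ, 0 ≤ w p) →
      (∀ p ∈ box p₀ δ, p ∉ F → ContinuousAt w p) →
      ((∀ p ∈ box p₀ δ, (∃ q ∈ F, q.1 = p.1 ∨ q.2 = p.2) → w p ≤ ℓ) →
        ∀ p ∈ box p₀ (δ / 5000), w p ≤ C * ℓ) ∧
      ((∀ p ∈ box p₀ δ, (∃ q ∈ F, q.1 = p.1 ∨ q.2 = p.2) → ℓ ≤ w p) →
        ∀ p ∈ box p₀ (δ / 5000), ℓ ≤ C * w p) := by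
  obtain ⟨C₀, hC₀, H⟩ := exists_harnack n hlam hLam (θ := 2) (Θ := 16384) two_pos (by norm_num)
  set C := max C₀ 1 with hC
  have hC1 : 1 ≤ C := le_max_right _ _
  have hCC : C ≤ C * C := le_mul_of_one_le_left (by linarith) hC1
  refine ⟨C * C, hC1.trans hCC, ?_⟩
  rintro w F ⟨x₀, t₀⟩ δ ℓ hδ hδ1 hℓ hF hp₀ hFb hS h0 hcont
  -- Harnack on cylinders avoiding `F`
  have harn : ∀ (y : Spc' n) (s t R : ℝ), 0 < R → 2 * R ^ 2 ≤ t - s → t - s ≤ 16384 * R ^ 2 →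
      dist y x₀ + R ≤ δ → t₀ - δ ≤ s - R ^ 2 → t ≤ t₀ + δ →
      (∀ z τ, dist z y ≤ R → s - R ^ 2 ≤ τ → τ ≤ t → (z, τ) ∉ F) →
      ∀ x x', dist x y ≤ R * (1 / 16) → dist x' y ≤ R * (1 / 16) → w (x', s) ≤ C * w (x, t) := by
    intro y s t R hR h1 h2 h3 h4 h5 h6 x x' hx hx'
    have hsub : Metric.closedBall y R ×ˢ Icc (s - R ^ 2) t ⊆ box (x₀, t₀) δ :=
      Set.prod_mono (Metric.closedBall_subset_closedBall' (by linarith)) (Icc_subset_Icc h4 h5)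
    have hxt : (x, t) ∈ box (x₀, t₀) δ := hsub ⟨by
      rw [Metric.mem_closedBall]; simp only; linarith, by
      constructor <;> simp only <;> nlinarith⟩
    refine (H w y s t R hR h1 h2 (fun p hp => (hcont p (hsub hp)
      (h6 p.1 p.2 hp.1 hp.2.1 hp.2.2)).continuousWithinAt) (fun p hp => h0 p (hsub hp))
      (fun p hp => hS p (hsub hp)) x hx x' hx').trans ?_
    exact mul_le_mul_of_nonneg_right (le_max_left _ _) (h0 _ hxt)
  have hgeo : ∀ p ∈ box (x₀, t₀) (δ / 5000), (∀ q ∈ F, q.1 ≠ p.1) → ∃ d x, 0 < d ∧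
      d ≤ δ / 5000 ∧ dist x p.1 = d ∧ (∃ τ, (x, τ) ∈ F) ∧ (∀ q ∈ F, d ≤ dist q.1 p.1) := by
    rintro ⟨y, s⟩ ⟨hy, hs⟩ hne
    obtain ⟨x, ⟨q, hq, rfl⟩, hx⟩ := (hF.image continuous_fst).exists_infDist_eq_dist
      ⟨_, mem_image_of_mem _ hp₀⟩ y
    have hle : ∀ q' ∈ F, dist q.1 y ≤ dist q'.1 y := fun q' hq' => by
      rw [dist_comm _ y, ← hx, dist_comm _ y]
      exact Metric.infDist_le_dist_of_mem (mem_image_of_mem _ hq')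
    refine ⟨dist q.1 y, q.1, dist_pos.2 (hne q hq), (hle _ hp₀).trans ?_, rfl, ⟨q.2, hq⟩, hle⟩
    rw [dist_comm]; exact hy
  constructor
  · rintro hup ⟨y, s⟩ hp
    have hpb : (y, s) ∈ box (x₀, t₀) δ :=
      Set.prod_mono (Metric.closedBall_subset_closedBall (by linarith))
        (Icc_subset_Icc (by linarith) (by linarith)) hp
    have hCℓ : ℓ ≤ C * C * ℓ := le_mul_of_one_le_left hℓ (hC1.trans hCC)
    by_cases hcross : ∃ q ∈ F, q.1 = (y, s).1 ∨ q.2 = (y, s).2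
    · exact (hup _ hpb hcross).trans hCℓ
    push Not at hcross
    obtain ⟨d, x, hd, hdδ, hxd, ⟨τ₀, hxF⟩, hdF⟩ := hgeo _ hp fun q hq => (hcross q hq).1
    obtain ⟨hy, hs⟩ := hp
    simp only [Metric.mem_closedBall, mem_Icc] at hy hs hxd hdF
    have hd2 : d ^ 2 ≤ d * (δ / 5000) := by nlinarith
    have hd2' : d ^ 2 ≤ δ / 5000 / 5000 := by nlinarith
    have hd20 : 0 < d ^ 2 := by positivity
    by_cases hb : ∃ q ∈ F, s < q.2 ∧ q.2 ≤ s + 4096 * d ^ 2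
    · obtain ⟨⟨z, b⟩, hq, hb1, hb2⟩ := hb
      simp only at hb1 hb2
      set R := √(b - s) / 128 with hR
      have hRsq : R ^ 2 = (b - s) / 16384 := by
        rw [hR, div_pow, Real.sq_sqrt (by linarith)]; norm_num
      have hR0 : 0 < R := div_pos (Real.sqrt_pos.2 (by linarith)) (by norm_num)
      have hRd : R ≤ d / 2 := abs_le_of_sq_le_sq' (by nlinarith) (by positivity) |>.2
      have h1 := harn y s b R hR0 (by linarith) (by linarith) (by linarith) (by linarith)
        (by linarith) (fun z' τ' hz' _ _ hmem => by
          have := hdF _ hmem; simp only at this; linarith) y y (by simp [hR0.le]) (by simp [hR0.le])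
      have h2 := hup (y, b) ⟨hpb.1, by constructor <;> simp only <;> linarith⟩
        ⟨_, hq, Or.inr rfl⟩
      calc w (y, s) ≤ C * w (y, b) := h1
        _ ≤ C * ℓ := by gcongr
        _ ≤ _ := by gcongr
    · push Not at hb
      have hslab : ∀ z τ, s ≤ τ → τ ≤ s + 4096 * d ^ 2 → (z, τ) ∉ F := fun z τ h1 h2 hmem => by
        rcases h1.eq_or_lt with h | h
        · exact (hcross _ hmem).2 h.symm
        · exact absurd h2 (not_le.2 (hb _ hmem h))
      have h1 := harn y s (s + 2048 * d ^ 2) (d / 2) (by positivity) (by nlinarith) (by nlinarith)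
        (by linarith) (by nlinarith) (by linarith) (fun z' τ' hz' _ _ hmem => by
          have := hdF _ hmem; simp only at this; linarith) y y
          (by rw [dist_self]; positivity) (by rw [dist_self]; positivity)
      have h2 := harn y (s + 2048 * d ^ 2) (s + 4096 * d ^ 2) (32 * d) (by positivity)
        (by nlinarith) (by nlinarith) (by linarith) (by nlinarith) (by linarith)
        (fun z' τ' _ h1 h2 => hslab z' τ' (by nlinarith) h2) x y (by linarith)
          (by rw [dist_self]; positivity)
      have h3 := hup (x, s + 4096 * d ^ 2) ⟨(hFb hxF).1, by
        constructor <;> simp only <;> linarith⟩ ⟨_, hxF, Or.inl rfl⟩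
      calc w (y, s) ≤ C * w (y, s + 2048 * d ^ 2) := h1
        _ ≤ C * (C * w (x, s + 4096 * d ^ 2)) := by gcongr
        _ ≤ C * (C * ℓ) := by gcongr
        _ = _ := by ring
  · rintro hlo ⟨y, s⟩ hp
    have hpb : (y, s) ∈ box (x₀, t₀) δ :=
      Set.prod_mono (Metric.closedBall_subset_closedBall (by linarith))
        (Icc_subset_Icc (by linarith) (by linarith)) hp
    have hw0 := h0 _ hpb
    have hCw : C * w (y, s) ≤ C * C * w (y, s) := mul_le_mul_of_nonneg_right hCC hw0
    by_cases hcross : ∃ q ∈ F, q.1 = (y, s).1 ∨ q.2 = (y, s).2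
    · exact (hlo _ hpb hcross).trans (le_mul_of_one_le_left hw0 (hC1.trans hCC))
    refine le_trans ?_ hCw
    push Not at hcross
    obtain ⟨d, x, hd, hdδ, hxd, ⟨τ₀, hxF⟩, hdF⟩ := hgeo _ hp fun q hq => (hcross q hq).1
    obtain ⟨hy, hs⟩ := hp
    simp only [Metric.mem_closedBall, mem_Icc] at hy hs hxd hdF
    have hd2 : d ^ 2 ≤ d * (δ / 5000) := by nlinarith
    have hd2' : d ^ 2 ≤ δ / 5000 / 5000 := by nlinarith
    have hd20 : 0 < d ^ 2 := by positivity
    by_cases hb : ∃ q ∈ F, q.2 < s ∧ s - 4096 * d ^ 2 ≤ q.2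
    · obtain ⟨⟨z, b⟩, hq, hb1, hb2⟩ := hb
      simp only at hb1 hb2
      set R := √(s - b) / 128 with hR
      have hRsq : R ^ 2 = (s - b) / 16384 := by
        rw [hR, div_pow, Real.sq_sqrt (by linarith)]; norm_num
      have hR0 : 0 < R := div_pos (Real.sqrt_pos.2 (by linarith)) (by norm_num)
      have hRd : R ≤ d / 2 := abs_le_of_sq_le_sq' (by nlinarith) (by positivity) |>.2
      have h1 := harn y b s R hR0 (by linarith) (by linarith) (by linarith) (by linarith)
        (by linarith) (fun z' τ' hz' _ _ hmem => by
          have := hdF _ hmem; simp only at this; linarith) y y (by simp [hR0.le]) (by simp [hR0.le])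
      exact (hlo (y, b) ⟨hpb.1, by constructor <;> simp only <;> linarith⟩
        ⟨_, hq, Or.inr rfl⟩).trans h1
    · push Not at hb
      have hslab : ∀ z τ, s - 4096 * d ^ 2 ≤ τ → τ ≤ s → (z, τ) ∉ F := fun z τ h1 h2 hmem => by
        rcases h2.eq_or_lt with h | h
        · exact (hcross _ hmem).2 h
        · exact absurd h1 (not_le.2 (hb _ hmem h))
      have h2 := harn y (s - 2048 * d ^ 2) s (32 * d) (by positivity)
        (by nlinarith) (by nlinarith) (by linarith) (by nlinarith) (by linarith)
        (fun z' τ' _ h1 h2 => hslab z' τ' (by nlinarith) h2) y x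
          (by rw [dist_self]; positivity) (by linarith)
      exact (hlo (x, s - 2048 * d ^ 2) ⟨(hFb hxF).1, by
        constructor <;> simp only <;> linarith⟩ ⟨_, hxF, Or.inl rfl⟩).trans h2

lemma box_eq_closedBall (p : Spc' n × ℝ) (δ : ℝ) : box p δ = Metric.closedBall p δ := by
  rw [box, ← Real.closedBall_eq_Icc, closedBall_prod_same]

lemma nhds_basis_box (p : Spc' n × ℝ) : (𝓝 p).HasBasis (fun δ => 0 < δ) (box p) := by
  have : box p = Metric.closedBall p := funext (box_eq_closedBall p)
  rw [this]
  exact Metric.nhds_basis_closedBall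

lemma box_mono (p : Spc' n × ℝ) {δ δ' : ℝ} (h : δ ≤ δ') : box p δ ⊆ box p δ' := by
  simpa only [box_eq_closedBall] using Metric.closedBall_subset_closedBall h

lemma isCompact_box (p : Spc' n × ℝ) (δ : ℝ) : IsCompact (box p δ) :=
  (isCompact_closedBall _ _).prod isCompact_Icc

/-- A nonnegative solution is continuous at a point as soon as it is close to its value there on
all horizontal and vertical lines through nearby points outside an open set of continuity. -/
lemma continuousAt_of_crosses (hlam : 0 < lam) (hLam : 0 ≤ Lam) {u : Spc' n × ℝ → ℝ}
    {Ω G : Set (Spc' n × ℝ)} (hΩ : IsOpen Ω) (hG : IsOpen G) (hGc : ∀ p ∈ G, ContinuousAt u p)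
    (hS : ∀ p ∈ Ω, SolAt lam Lam u p) (h0 : ∀ p ∈ Ω, 0 ≤ u p) {p₀ : Spc' n × ℝ} (hp₀ : p₀ ∈ Ω)
    (hp₀G : p₀ ∉ G)
    (hcross : ∀ ε > 0, ∃ δ > 0, ∀ p ∈ box p₀ δ, ∀ q ∈ box p₀ δ, q ∉ G →
      (q.1 = p.1 ∨ q.2 = p.2) → |u p - u p₀| ≤ ε) : ContinuousAt u p₀ := by
  obtain ⟨C, hC, H⟩ := exists_cross_bounds n hlam hLam
  set m := u p₀ with hm
  have hm0 : 0 ≤ m := h0 _ hp₀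
  have setup : ∀ ε > 0, ∀ U ∈ 𝓝 p₀, ∃ δ > 0, δ ≤ 1 ∧ box p₀ δ ⊆ Ω ∩ U ∧
      ∀ p ∈ box p₀ δ, (∃ q ∈ box p₀ δ ∩ Gᶜ, q.1 = p.1 ∨ q.2 = p.2) → |u p - m| ≤ ε := by
    intro ε hε U hU
    obtain ⟨δ₁, h1, h1'⟩ := hcross ε hε
    obtain ⟨δ₂, h2, h2'⟩ := (nhds_basis_box p₀).mem_iff.1 (inter_mem (hΩ.mem_nhds hp₀) hU)
    refine ⟨min (min δ₁ δ₂) 1, by positivity, min_le_right _ _, (box_mono _ ?_).trans h2', ?_⟩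
    · exact (min_le_left _ _).trans (min_le_right _ _)
    · rintro p hp ⟨q, ⟨hq, hqG⟩, hpq⟩
      have := box_mono p₀ ((min_le_left (min δ₁ δ₂) 1).trans (min_le_left _ _))
      exact h1' p (this hp) q (this hq) hqG hpq
  have hbdd : ∀ δ > 0, p₀ ∈ box p₀ δ ∩ Gᶜ := fun δ hδ =>
    ⟨mem_of_mem_nhds ((nhds_basis_box p₀).mem_of_mem hδ), hp₀G⟩
  have hcpt : ∀ δ, IsCompact (box p₀ δ ∩ Gᶜ) := fun δ =>
    (isCompact_box p₀ δ).inter_right hG.isClosed_compl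
  have hdc : ∀ δ, ∀ p ∈ box p₀ δ, p ∉ box p₀ δ ∩ Gᶜ → ContinuousAt u p := fun δ p hp hp' =>
    hGc p (by_contra fun h => hp' ⟨hp, h⟩)
  -- local boundedness
  have hbound : ∀ᶠ p in 𝓝 p₀, u p ≤ C * (m + 1) := by
    obtain ⟨δ, hδ, hδ1, hsub, hcr⟩ := setup 1 one_pos univ univ_mem
    have hsub' : box p₀ δ ⊆ Ω := hsub.trans inter_subset_left
    have := (H u _ p₀ δ (m + 1) hδ hδ1 (by linarith) (hcpt δ) (hbdd δ hδ) inter_subset_left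
      (fun p hp => hS p (hsub' hp)) (fun p hp => h0 p (hsub' hp)) (hdc δ)).1
      (fun p hp hq => by linarith [(abs_le.1 (hcr p hp hq)).2])
    exact mem_of_superset ((nhds_basis_box p₀).mem_of_mem (by positivity : 0 < δ / 5000)) this
  set κ := 1 - 1 / (2 * C) with hκ
  have hC0 : 0 < C := by linarith
  have hκ0 : 0 ≤ κ := by
    have : 1 / (2 * C) ≤ 1 := by rw [div_le_one (by positivity)]; linarith
    linarith
  have hκ1 : κ < 1 := by
    have : 0 < 1 / (2 * C) := by positivity
    linarith
  have hstep : ∀ σ : ℝ, |σ| = 1 → ∀ b > 0, (∀ᶠ p in 𝓝 p₀, σ * (u p - m) ≤ b) →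
      ∀ᶠ p in 𝓝 p₀, σ * (u p - m) ≤ κ * b := by
    intro σ hσ b hb hev
    obtain ⟨δ, hδ, hδ1, hsub, hcr⟩ := setup (b / 2) (by positivity) _ hev
    have := (H (fun p => (b + σ * m) + (-σ) * u p) _ p₀ δ (b / 2) hδ hδ1 (by positivity) (hcpt δ)
      (hbdd δ hδ) inter_subset_left (fun p hp => (hS p (hsub hp).1).affine _ _)
      (fun p hp => by
        have : σ * (u p - m) ≤ b := (hsub hp).2
        linarith)
      (fun p hp hp' => (continuousAt_const.add (continuousAt_const.mul (hdc δ p hp hp'))))).2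
      (fun p hp hq => by
        have h1 := hcr p hp hq
        have h2 : σ * (u p - m) ≤ b / 2 := by
          refine (le_abs_self _).trans ?_
          rwa [abs_mul, hσ, one_mul]
        linarith)
    refine mem_of_superset ((nhds_basis_box p₀).mem_of_mem (by positivity : 0 < δ / 5000))
      fun p hp => ?_
    have h1 := this p hp
    change σ * (u p - m) ≤ κ * b
    have h2 : b / (2 * C) ≤ (b + σ * m) + (-σ) * u p := by
      rw [div_le_iff₀ (by positivity)]; linarith
    have h3 : κ * b = b - b / (2 * C) := by rw [hκ]; ring
    rw [h3]; linarith
  have hiter : ∀ σ : ℝ, |σ| = 1 → (∀ᶠ p in 𝓝 p₀, σ * (u p - m) ≤ C * (m + 1)) → ∀ ε > 0,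
      ∀ᶠ p in 𝓝 p₀, σ * (u p - m) ≤ ε := by
    intro σ hσ hst ε hε
    have hb : 0 < C * (m + 1) := by positivity
    have hk : ∀ k : ℕ, ∀ᶠ p in 𝓝 p₀, σ * (u p - m) ≤ max (κ ^ k * (C * (m + 1))) ε := by
      intro k
      induction k with
      | zero => filter_upwards [hst] with p hp using hp.trans (by simp)
      | succ k ih =>
        filter_upwards [hstep σ hσ _ (lt_max_of_lt_right hε) ih] with p hp
        refine hp.trans ?_
        rw [mul_max_of_nonneg _ _ hκ0, pow_succ', mul_assoc]
        exact max_le_max le_rfl (by nlinarith)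
    have hlim : Tendsto (fun k : ℕ => κ ^ k * (C * (m + 1))) atTop (𝓝 (0 * (C * (m + 1)))) :=
      (tendsto_pow_atTop_nhds_zero_of_lt_one hκ0 hκ1).mul_const _
    rw [zero_mul] at hlim
    obtain ⟨k, hk'⟩ := (hlim.eventually (gt_mem_nhds hε)).exists
    filter_upwards [hk k] with p hp
    rwa [max_eq_right hk'.le] at hp
  have hA := hiter 1 (by simp) (by filter_upwards [hbound] with p hp; linarith)
  have hB := hiter (-1) (by simp) (by
    filter_upwards [hΩ.mem_nhds hp₀] with p hp
    nlinarith [h0 p hp])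
  rw [ContinuousAt, Metric.tendsto_nhds]
  intro ε hε
  filter_upwards [hA (ε / 2) (by positivity), hB (ε / 2) (by positivity)] with p h1 h2
  rw [Real.dist_eq, abs_lt]
  constructor <;> linarith

/-- A nonnegative function which solves the equation separately is jointly continuous. -/
lemma continuousOn_of_solAt (hlam : 0 < lam) (hLam : 0 ≤ Lam) {u : Spc' n × ℝ → ℝ}
    {Ω : Set (Spc' n × ℝ)} (hΩ : IsOpen Ω) (hS : ∀ p ∈ Ω, SolAt lam Lam u p)
    (h0 : ∀ p ∈ Ω, 0 ≤ u p) : ContinuousOn u Ω := by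
  set G := {p | ∀ᶠ q in 𝓝 p, ContinuousAt u q} with hG
  have hGo : IsOpen G := isOpen_setOfPred_eventually_nhds
  have hGc : ∀ p ∈ G, ContinuousAt u p := fun p hp => hp.self_of_nhds
  suffices hall : Ω ⊆ G from fun p hp => (hGc p (hall hp)).continuousWithinAt
  by_contra hne
  rw [not_subset] at hne
  obtain ⟨p₁, hp₁, hp₁G⟩ := hne
  set F := Ω ∩ Gᶜ with hF
  have hlc : IsLocallyClosed F := ⟨Ω, Gᶜ, hΩ, hGo.isClosed_compl, rfl⟩
  have : LocallyCompactSpace F := hlc.locallyCompactSpace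
  have : Nonempty F := ⟨⟨p₁, hp₁, hp₁G⟩⟩
  have hxd : ∀ p ∈ Ω, DifferentiableAt ℝ (fun y => u (y, p.2)) p.1 := fun p hp =>
    (hS p hp).1.differentiableAt (by norm_num)
  have htd : ∀ p ∈ Ω, DifferentiableAt ℝ (fun s => u (p.1, s)) p.2 := fun p hp => by
    obtain ⟨-, a, S, ha, -⟩ := hS p hp
    exact ha.differentiableAt
  set E : ℕ → Set F := fun N => {p |
    (∀ y, dist y p.1.1 ≤ 1 / (N + 1) → |u (y, p.1.2) - u p.1| ≤ N * dist y p.1.1) ∧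
    (∀ s, dist s p.1.2 ≤ 1 / (N + 1) → |u (p.1.1, s) - u p.1| ≤ N * dist s p.1.2)} with hE
  have hcov : ⋃ N, closure (E N) = univ := by
    refine eq_univ_of_forall fun p => mem_iUnion.2 ?_
    obtain ⟨c₁, h₁⟩ := (hxd _ p.2.1).isBigO_sub.bound
    obtain ⟨c₂, h₂⟩ := (htd _ p.2.1).isBigO_sub.bound
    obtain ⟨ε₁, hε₁, h₁⟩ := Metric.eventually_nhds_iff.1 h₁
    obtain ⟨ε₂, hε₂, h₂⟩ := Metric.eventually_nhds_iff.1 h₂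
    obtain ⟨N₁, hN₁⟩ := exists_nat_one_div_lt (lt_min hε₁ hε₂)
    obtain ⟨N₂, hN₂⟩ := exists_nat_ge (max c₁ c₂)
    have hle : (1 : ℝ) / ((max N₁ N₂ : ℕ) + 1) < min ε₁ ε₂ :=
      (one_div_le_one_div_of_le (by positivity)
        (by exact_mod_cast Nat.succ_le_succ (le_max_left N₁ N₂))).trans_lt hN₁
    have hge : max c₁ c₂ ≤ (max N₁ N₂ : ℕ) :=
      hN₂.trans (by exact_mod_cast le_max_right N₁ N₂)
    refine ⟨max N₁ N₂, subset_closure ⟨fun y hy => ?_, fun s hs => ?_⟩⟩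
    · have := h₁ ((hy.trans_lt hle).trans_le (min_le_left _ _))
      rw [Real.norm_eq_abs, ← dist_eq_norm] at this
      exact this.trans (mul_le_mul_of_nonneg_right ((le_max_left _ _).trans hge) dist_nonneg)
    · have := h₂ ((hs.trans_lt hle).trans_le (min_le_right _ _))
      rw [Real.norm_eq_abs, ← dist_eq_norm] at this
      exact this.trans (mul_le_mul_of_nonneg_right ((le_max_right _ _).trans hge) dist_nonneg)
  obtain ⟨N, hN⟩ := nonempty_interior_of_iUnion_of_closed (fun N => isClosed_closure) hcov
  obtain ⟨q, hq⟩ := hN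
  obtain ⟨W, hWo, hW⟩ := isOpen_induced_iff.1 (isOpen_interior (s := closure (E N)))
  have hqW : q.1 ∈ W := by rw [← hW] at hq; exact hq
  obtain ⟨δ₀, hδ₀, hδW⟩ := Metric.isOpen_iff.1 (hWo.inter hΩ) q.1 ⟨hqW, q.2.1⟩
  set δ := min δ₀ (1 / (4 * (N + 1))) with hδ
  have hδ0 : 0 < δ := by positivity
  have hδN : 2 * δ ≤ 1 / (N + 1) := by
    have := min_le_right δ₀ (1 / (4 * ((N : ℝ) + 1)))
    have e : 1 / (4 * ((N : ℝ) + 1)) = 1 / (N + 1) / 4 := by field_simp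
    have : 0 < 1 / ((N : ℝ) + 1) := by positivity
    linarith
  have hBall : Metric.ball q.1 δ ⊆ W ∩ Ω := (Metric.ball_subset_ball (min_le_left _ _)).trans hδW
  have hmem : ∀ x t, (x, t) ∈ Metric.ball q.1 δ ↔ dist x q.1.1 < δ ∧ dist t q.1.2 < δ := by
    intro x t
    rw [Metric.mem_ball, Prod.dist_eq, max_lt_iff]
  have hlip : ∀ x t y s, (x, t) ∈ F → (x, t) ∈ Metric.ball q.1 δ → (y, s) ∈ Metric.ball q.1 δ →
      |u (y, t) - u (x, s)| ≤ N * (dist y x + dist s t) := by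
    intro x t y s hxF hxt hys
    have hcl : (⟨(x, t), hxF⟩ : F) ∈ closure (E N) := by
      refine interior_subset ?_
      rw [← hW]
      exact (hBall hxt).1
    obtain ⟨f, hfE, hf⟩ := mem_closure_iff_seq_limit.1 hcl
    have hf' : Tendsto (fun k => (f k).1) atTop (𝓝 (x, t)) :=
      (continuous_subtype_val.tendsto _).comp hf
    have hf1 : Tendsto (fun k => (f k).1.1) atTop (𝓝 x) := (continuous_fst.tendsto _).comp hf'
    have hf2 : Tendsto (fun k => (f k).1.2) atTop (𝓝 t) := (continuous_snd.tendsto _).comp hf'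
    have hyt : (y, t) ∈ Ω :=
      (hBall ((hmem y t).2 ⟨((hmem y s).1 hys).1, ((hmem x t).1 hxt).2⟩)).2
    have hxs : (x, s) ∈ Ω :=
      (hBall ((hmem x s).2 ⟨((hmem x t).1 hxt).1, ((hmem y s).1 hys).2⟩)).2
    have l1 : Tendsto (fun k => u (y, (f k).1.2)) atTop (𝓝 (u (y, t))) :=
      ((htd _ hyt).continuousAt.tendsto).comp hf2
    have l2 : Tendsto (fun k => u ((f k).1.1, s)) atTop (𝓝 (u (x, s))) :=
      ((hxd _ hxs).continuousAt.tendsto).comp hf1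
    refine le_of_tendsto_of_tendsto ((l1.sub l2).abs)
      (((tendsto_const_nhds.dist hf1).add (tendsto_const_nhds.dist hf2)).const_mul (N : ℝ)) ?_
    filter_upwards [hf'.eventually (Metric.isOpen_ball.mem_nhds hxt)] with k hk
    have hk' := (hmem _ _).1 hk
    have hys' := (hmem _ _).1 hys
    obtain ⟨e1, e2⟩ := hfE k
    have d1 := e1 y (by linarith [dist_triangle_right y (f k).1.1 q.1.1])
    have d2 := e2 s (by linarith [dist_triangle_right s (f k).1.2 q.1.2])
    calc |u (y, (f k).1.2) - u ((f k).1.1, s)|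
        = |(u (y, (f k).1.2) - u (f k).1) - (u ((f k).1.1, s) - u (f k).1)| := by congr 1; ring
      _ ≤ _ := abs_sub _ _
      _ ≤ _ := by rw [mul_add]; exact add_le_add d1 d2
  refine q.2.2 ?_
  have hcont : ∀ p ∈ Metric.ball q.1 δ, ContinuousAt u p := by
    rintro ⟨x₀, t₀⟩ hp
    by_cases hpG : (x₀, t₀) ∈ G
    · exact hGc _ hpG
    refine continuousAt_of_crosses hlam hLam hΩ hGo hGc hS h0 (hBall hp).2 hpG fun ε hε => ?_
    obtain ⟨δ₁, hδ₁, hsub⟩ := (nhds_basis_box (x₀, t₀)).mem_iff.1 (Metric.isOpen_ball.mem_nhds hp)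
    have hp0F : (x₀, t₀) ∈ F := ⟨(hBall hp).2, hpG⟩
    have hN0 : (0 : ℝ) ≤ N := Nat.cast_nonneg N
    refine ⟨min δ₁ (ε / (4 * N + 1)), by positivity, ?_⟩
    set δ₂ := min δ₁ (ε / (4 * N + 1))
    have hδ2 : 4 * N * δ₂ ≤ ε := by
      have h1 : δ₂ ≤ ε / (4 * N + 1) := min_le_right _ _
      have h2 : 0 < δ₂ := by positivity
      rw [le_div_iff₀ (by positivity)] at h1
      nlinarith
    have hsub2 := (box_mono (x₀, t₀) (min_le_left δ₁ (ε / (4 * N + 1)))).trans hsub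
    rintro ⟨y, s⟩ hys ⟨x, t⟩ hxt hxtG hor
    have hys' := hsub2 hys
    have hxt' := hsub2 hxt
    have hxF : (x, t) ∈ F := ⟨(hBall hxt').2, hxtG⟩
    rw [box_eq_closedBall, Metric.mem_closedBall, Prod.dist_eq, max_le_iff] at hys hxt
    simp only at hys hxt hor
    rcases hor with rfl | rfl
    · have a1 := hlip x t x₀ s hxF hxt' ((hmem _ _).2 ⟨((hmem _ _).1 hp).1, ((hmem _ _).1 hys').2⟩)
      have a2 := hlip x₀ t₀ x₀ t hp0F hp
        ((hmem _ _).2 ⟨((hmem _ _).1 hp).1, ((hmem _ _).1 hxt').2⟩)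
      rw [dist_self, zero_add] at a2
      have b1 : N * (dist x₀ x + dist s t) ≤ N * (3 * δ₂) := by
        gcongr
        rw [dist_comm x₀ x]
        linarith [dist_triangle_right s t t₀]
      have b2 : N * dist t t₀ ≤ N * δ₂ := by gcongr; exact hxt.2
      rw [abs_le] at *
      constructor <;> linarith [a1.1, a1.2, a2.1, a2.2]
    · have a1 := hlip x t y t₀ hxF hxt' ((hmem _ _).2 ⟨((hmem _ _).1 hys').1, ((hmem _ _).1 hp).2⟩)
      have a2 := hlip x₀ t₀ x t₀ hp0F hp
        ((hmem _ _).2 ⟨((hmem _ _).1 hxt').1, ((hmem _ _).1 hp).2⟩)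
      rw [dist_self, add_zero] at a2
      have b1 : N * (dist y x + dist t₀ t) ≤ N * (3 * δ₂) := by
        gcongr
        rw [dist_comm t₀ t]
        linarith [dist_triangle_right y x x₀]
      have b2 : N * dist x x₀ ≤ N * δ₂ := by gcongr; exact hxt.1
      rw [abs_le] at *
      constructor <;> linarith [a1.1, a1.2, a2.1, a2.2]
  exact mem_of_superset (Metric.isOpen_ball.mem_nhds (Metric.mem_ball_self hδ0)) hcont

end JointContinuity

section Frozen

variable {m : ℕ} {lam Lam : ℝ} {A : Spc m → Matrix (Fin (m + 1)) (Fin (m + 1)) ℝ}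

lemma sHess_eq_hessForm {u : Spc m × ℝ → ℝ} {p : Spc m × ℝ}
    (hu : ContDiffAt ℝ 2 (fun y => u (y, p.2)) p.1) (i j : Fin (m + 1)) :
    sHess u p i j = hessForm (n := m + 1) (fun y => u (y, p.2)) p.1 (EuclideanSpace.single i 1)
      (EuclideanSpace.single j 1) := by
  have h := hu.hasFDerivAt_fderiv_hessForm
  have h2 : HasFDerivAt (fun y => fderiv ℝ (fun z => u (z, p.2)) y (eVec m j))
      ((hessForm (n := m + 1) (fun y => u (y, p.2)) p.1).flip (eVec m j)) p.1 := by
    refine (h.clm_apply (hasFDerivAt_const (eVec m j) p.1)).congr_fderiv ?_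
    ext v
    simp
  rw [sHess, h2.fderiv]
  rfl

/-- Solutions of `u_t = Lu` solve an equation with some elliptic coefficients at each point. -/
lemma SolvesL.solAt {u : Spc m × ℝ → ℝ} {Ω : Set (Spc m × ℝ)} (hA : IsElliptic lam Lam A)
    (hu : SolvesL A u Ω) {p : Spc m × ℝ} (hp : p ∈ Ω) : SolAt (n := m + 1) lam Lam u p := by
  obtain ⟨hc, ht⟩ := hu p hp
  refine ⟨hc, _, A p.1, ht, ⟨hA.1 _, fun ξ => hA.2 _ ξ⟩, ?_⟩
  simp only [tracePair, Lop]
  exact Finset.sum_congr rfl fun i _ => Finset.sum_congr rfl fun j _ => by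
    rw [sHess_eq_hessForm hc]

end Frozen

/-! ### Geometry near the graph -/

section Geometry

variable {m : ℕ} {K : ℝ} {g : Spc' m → ℝ → ℝ}

@[simp] lemma xprime_mkPt (x' : Spc' m) (a : ℝ) : xprime (mkPt x' a) = x' := by
  ext i
  simp [xprime, mkPt, Fin.castSucc_ne_last]

@[simp] lemma xlast_mkPt (x' : Spc' m) (a : ℝ) : xlast (mkPt x' a) = a := by
  simp [xlast, mkPt]

@[simp] lemma mkPt_xprime_xlast (x : Spc m) : mkPt (xprime x) (xlast x) = x := by
  ext i
  refine Fin.lastCases ?_ (fun i => ?_) i <;> simp [xprime, xlast, mkPt, Fin.castSucc_ne_last]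

lemma xprime_sub (x y : Spc m) : xprime (x - y) = xprime x - xprime y := by
  ext i; simp [xprime]

lemma xlast_sub (x y : Spc m) : xlast (x - y) = xlast x - xlast y := by
  simp [xlast]

lemma mkPt_sub (x' y' : Spc' m) (a b : ℝ) : mkPt x' a - mkPt y' b = mkPt (x' - y') (a - b) := by
  ext i
  refine Fin.lastCases ?_ (fun i => ?_) i <;> simp [mkPt, Fin.castSucc_ne_last]

lemma norm_sq_eq (x : Spc m) : ‖x‖ ^ 2 = ‖xprime x‖ ^ 2 + xlast x ^ 2 := by
  rw [EuclideanSpace.norm_sq_eq, EuclideanSpace.norm_sq_eq, Fin.sum_univ_castSucc]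
  simp [xprime, xlast]

lemma norm_xprime_le (x : Spc m) : ‖xprime x‖ ≤ ‖x‖ :=
  le_of_sq_le_sq (by rw [norm_sq_eq x]; nlinarith [sq_nonneg (xlast x)]) (norm_nonneg x)

lemma abs_xlast_le (x : Spc m) : |xlast x| ≤ ‖x‖ :=
  abs_le_of_sq_le_sq (by rw [norm_sq_eq x]; nlinarith [sq_nonneg ‖xprime x‖]) (norm_nonneg x)

lemma norm_mkPt_le (x' : Spc' m) (a : ℝ) : ‖mkPt x' a‖ ≤ ‖x'‖ + |a| := by
  refine le_of_sq_le_sq ?_ (by positivity)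
  rw [norm_sq_eq, xprime_mkPt, xlast_mkPt, add_sq, sq_abs]
  nlinarith [norm_nonneg x', abs_nonneg a, mul_nonneg (norm_nonneg x') (abs_nonneg a)]

lemma dist_mkPt_le (x' y' : Spc' m) (a b : ℝ) :
    dist (mkPt x' a) (mkPt y' b) ≤ ‖x' - y'‖ + |a - b| := by
  rw [dist_eq_norm, mkPt_sub]
  exact norm_mkPt_le _ _

lemma continuous_xprime : Continuous (xprime : Spc m → Spc' m) :=
  LipschitzWith.continuous (K := 1) <| LipschitzWith.of_dist_le_mul fun x y => by
    rw [dist_eq_norm, dist_eq_norm, ← xprime_sub, NNReal.coe_one, one_mul]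
    exact norm_xprime_le _

lemma continuous_xlast : Continuous (xlast : Spc m → ℝ) :=
  LipschitzWith.continuous (K := 1) <| LipschitzWith.of_dist_le_mul fun x y => by
    rw [dist_eq_norm, dist_eq_norm, Real.norm_eq_abs, ← xlast_sub, NNReal.coe_one, one_mul]
    exact abs_xlast_le _

lemma continuous_hGamma (hg : Continuous fun q : Spc' m × ℝ => g q.1 q.2) :
    Continuous (hGamma g) :=
  (continuous_xlast.comp continuous_fst).sub
    (hg.comp ((continuous_xprime.comp continuous_fst).prodMk continuous_snd))

lemma hGamma_mkPt (x' : Spc' m) (t d : ℝ) : hGamma g (mkPt x' (g x' t + d), t) = d := by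
  simp [hGamma]

lemma mem_cyl_iff {r : ℝ} {p : Spc m × ℝ} : p ∈ Cyl g r ↔
    ‖xprime p.1‖ < r ∧ -r ^ 2 < p.2 ∧ p.2 < r ^ 2 ∧ 0 < hGamma g p ∧ hGamma g p < r := by
  rw [hGamma, sub_pos, sub_lt_iff_lt_add']; rfl

lemma isOpen_cyl (hg : Continuous fun q : Spc' m × ℝ => g q.1 q.2) (r : ℝ) :
    IsOpen (Cyl g r) := by
  have h := continuous_hGamma hg
  have : Cyl g r = {p | ‖xprime p.1‖ < r} ∩ ({p | -r ^ 2 < p.2} ∩ ({p | p.2 < r ^ 2} ∩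
      ({p | 0 < hGamma g p} ∩ {p | hGamma g p < r}))) := by
    ext p; exact mem_cyl_iff
  rw [this]
  exact (isOpen_lt (continuous_xprime.comp continuous_fst).norm continuous_const).inter
    ((isOpen_lt continuous_const continuous_snd).inter
    ((isOpen_lt continuous_snd continuous_const).inter
    ((isOpen_lt continuous_const h).inter (isOpen_lt h continuous_const))))

lemma HolderSemi.abs_sub_le (hg : HolderSemi 1 (1 / 2) K g) (hK : 0 ≤ K) {x' y' : Spc' m}
    {t s ρ σ : ℝ} (hx : ‖x' - y'‖ ≤ ρ) (hσ : 0 ≤ σ) (ht : |t - s| ≤ σ ^ 2) :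
    |g x' t - g y' s| ≤ K * (ρ + σ) := by
  refine (hg x' y' t s).trans (mul_le_mul_of_nonneg_left (add_le_add ?_ ?_) hK)
  · rwa [Real.rpow_one]
  · rw [← Real.sqrt_eq_rpow]
    exact Real.sqrt_le_iff.2 ⟨hσ, ht⟩

lemma HolderSemi.abs_hGamma_sub_le (hg : HolderSemi 1 (1 / 2) K g) (hK : 0 ≤ K) {x y : Spc m}
    {t s ρ σ : ℝ} (hx : dist x y ≤ ρ) (hσ : 0 ≤ σ) (ht : |t - s| ≤ σ ^ 2) :
    |hGamma g (x, t) - hGamma g (y, s)| ≤ ρ + K * (ρ + σ) := by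
  rw [dist_eq_norm] at hx
  have h1 := (abs_xlast_le (x - y)).trans hx
  have h2 := hg.abs_sub_le hK ((xprime_sub x y ▸ norm_xprime_le (x - y)).trans hx) hσ ht
  rw [xlast_sub] at h1
  rw [abs_le] at *
  simp only [hGamma]
  constructor <;> linarith

/-- Cylinders of small size compared with the height above the graph stay in the domain. -/
lemma HolderSemi.prod_subset_cyl (hg : HolderSemi 1 (1 / 2) K g) (hK : 0 ≤ K) {x : Spc m}
    {t a b ρ σ : ℝ} (hx : ‖xprime x‖ + ρ < 1) (ha : -1 < a) (hb : b < 1) (hσ : 0 ≤ σ)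
    (hta : t - σ ^ 2 ≤ a) (htb : b ≤ t + σ ^ 2)
    (h1 : ρ + K * (ρ + σ) < hGamma g (x, t)) (h2 : hGamma g (x, t) + (ρ + K * (ρ + σ)) < 1) :
    Metric.closedBall x ρ ×ˢ Icc a b ⊆ Cyl g 1 := by
  rintro ⟨y, s⟩ ⟨hy, hs⟩
  simp only [mem_Icc, Metric.mem_closedBall] at hy hs
  have h3 := hg.abs_hGamma_sub_le hK (t := s) (s := t) hy hσ
    (abs_le.2 ⟨by linarith, by linarith⟩)
  rw [abs_le] at h3
  have h4 := norm_xprime_le (y - x)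
  rw [← dist_eq_norm, xprime_sub] at h4
  have h5 := norm_le_norm_add_norm_sub' (xprime y) (xprime x)
  refine mem_cyl_iff.2 ⟨?_, ?_, ?_, ?_, ?_⟩ <;> linarith

end Geometry

/-! ### Chains from the boundary to the reference point -/

section Chain

variable {m : ℕ} {lam Lam K : ℝ}

/-- Nonnegative continuous pointwise solutions with respect to varying elliptic coefficients. -/
structure NonnegSol {n : ℕ} (lam Lam : ℝ) (u : Spc' n × ℝ → ℝ) (Ω : Set (Spc' n × ℝ)) : Prop where
  continuousOn : ContinuousOn u Ω
  nonneg : ∀ p ∈ Ω, 0 ≤ u p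
  solAt : ∀ p ∈ Ω, SolAt lam Lam u p

lemma exists_chain_step (n : ℕ) (hlam : 0 < lam) {θ₁ θ₂ : ℝ} (hθ₁ : 0 < θ₁) (hθ : θ₁ ≤ θ₂) :
    ∃ q : ℕ, ∀ (u : Spc' n × ℝ → ℝ) (Ω : Set (Spc' n × ℝ)) (x0 x1 : Spc' n)
      (t0 t1 δ δ' R h : ℝ), NonnegSol lam Lam u Ω → 0 < δ → δ ≤ R → 0 ≤ h → θ₁ * R ^ 2 ≤ t1 - t0 →
      t1 - t0 ≤ θ₂ * R ^ 2 → Metric.closedBall x0 (2 * R) ×ˢ Icc t0 t1 ⊆ Ω →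
      (∀ x ∈ Metric.closedBall x0 δ, h ≤ u (x, t0)) → δ' + dist x1 x0 ≤ R →
      ∀ x ∈ Metric.closedBall x1 δ', h * (δ / (2 * R)) ^ q ≤ u (x, t1) := by
  obtain ⟨q, hq⟩ := exists_propagation n (Lam := Lam) hlam hθ₁ hθ
  refine ⟨q, fun u Ω x0 x1 t0 t1 δ δ' R h hu hδ hδR hh h1 h2 hsub hstart hd x hx => ?_⟩
  exact hq u x0 t0 t1 δ R h hδ hδR hh h1 h2 (hu.continuousOn.mono hsub)
    (fun p hp => hu.nonneg p (hsub hp))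
    (fun p hp _ => (hu.solAt p (hsub
      (Set.prod_mono Metric.ball_subset_closedBall Ioc_subset_Icc_self hp))).superAt)
    hstart x (Metric.closedBall_subset_closedBall' hd hx)

/-- The aperture of the chains. -/
def aperture (K : ℝ) : ℝ := 1 / (100 * (1 + K) ^ 2)

lemma aperture_pos (hK : 0 ≤ K) : 0 < aperture K := by unfold aperture; positivity

lemma aperture_mul (hK : 0 ≤ K) : aperture K * (1 + K) ^ 2 = 1 / 100 := by
  unfold aperture; field_simp

set_option maxHeartbeats 800000 in
/-- Moving away from the boundary, a positive solution decays at most polynomially. -/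
lemma exists_climb (m : ℕ) (hlam : 0 < lam) (hK : 0 ≤ K) :
    ∃ γ : ℕ, ∀ (g : Spc' m → ℝ → ℝ) (u : Spc m × ℝ → ℝ) (x' : Spc' m) (t d h : ℝ),
      HolderSemi 1 (1 / 2) K g → NonnegSol (n := m + 1) lam Lam u (Cyl g 1) → ‖x'‖ ≤ 3 / 4 →
      0 ≤ h → 0 < d → d ≤ 11 / 100 → -(1 / 2) ≤ t → t - d ^ 2 ≤ 46 / 100 →
      (∀ x ∈ Metric.closedBall (mkPt x' (g x' t + d)) (aperture K * d), h ≤ u (x, t)) →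
      ∃ t' d', 1 / 10 ≤ d' ∧ d' ≤ 11 / 100 ∧ -(1 / 2) ≤ t' ∧ t' - d' ^ 2 ≤ 46 / 100 ∧
        ∀ x ∈ Metric.closedBall (mkPt x' (g x' t' + d')) (aperture K * d'),
          h * (d / d') ^ γ ≤ u (x, t') := by
  obtain ⟨q, hq⟩ := exists_chain_step (m + 1) (Lam := Lam) hlam
    (θ₁ := 1 / (3 + K) ^ 2) (by positivity) le_rfl
  set ε := aperture K with hε
  have hε0 : 0 < ε := aperture_pos hK
  have e1 : ε * (1 + K) ^ 2 = 1 / 100 := aperture_mul hK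
  have hεK : 0 ≤ ε * K := by positivity
  have hεK2 : 0 ≤ ε * K ^ 2 := by positivity
  have e2 : ε * (3 + K) ≤ 3 / 100 := by nlinarith
  have e3 : ε * (2 * (3 + K) * (1 + K) + K) ≤ 7 / 100 := by nlinarith
  have e4 : ε ≤ 1 / 100 := by nlinarith
  obtain ⟨γ, hγ⟩ := pow_unbounded_of_one_lt ((2 * (3 + K)) ^ q) (by linarith : 1 < 1 + ε)
  refine ⟨γ, fun g u x' t d h hg hu hx' hh hd hd1 ht1 ht2 hstart => ?_⟩
  obtain ⟨k, hk⟩ := pow_unbounded_of_one_lt (1 / 10 / d) (by linarith : 1 < 1 + ε)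
  rw [div_lt_iff₀ hd] at hk
  induction k generalizing t d h with
  | zero =>
    refine ⟨t, d, by linarith, hd1, ht1, ht2, ?_⟩
    simpa [div_self hd.ne'] using hstart
  | succ k ih =>
    rcases le_or_gt (1 / 10) d with hd2 | hd2
    · refine ⟨t, d, hd2, hd1, ht1, ht2, ?_⟩
      simpa [div_self hd.ne'] using hstart
    set R := (3 + K) * ε * d with hR
    set s := t + (ε * d) ^ 2 with hs
    have hεd : 0 < ε * d := by positivity
    have hR1 : ε * d ≤ R := by rw [hR]; nlinarith
    have hR2 : R ≤ 3 / 1000 := by rw [hR]; nlinarith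
    have hR0 : 0 < R := hεd.trans_le hR1
    have hεd' : ε * d ≤ 1 / 1000 := by nlinarith
    have hts : t ≤ s := by rw [hs]; nlinarith
    have hd2' : d ^ 2 ≤ 1 / 100 := by nlinarith
    have hs1 : s - ((1 + ε) * d) ^ 2 ≤ 46 / 100 := by
      rw [hs]; nlinarith [mul_nonneg hε0.le (sq_nonneg d)]
    have hlip : 2 * R + K * (2 * R + ε * d) ≤ 7 / 100 * d := by
      have := mul_le_mul_of_nonneg_right e3 hd.le
      rw [hR]; linarith
    have hgap := hg.abs_sub_le hK (x' := x') (y' := x') (t := s) (s := t) (ρ := 0) (σ := ε * d)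
      (by simp) hεd.le (by rw [hs, add_sub_cancel_left, abs_of_nonneg (by positivity)])
    have hsub : Metric.closedBall (mkPt x' (g x' t + d)) (2 * R) ×ˢ Icc t s ⊆ Cyl g 1 := by
      refine hg.prod_subset_cyl hK (t := t) (σ := ε * d) ?_ (by linarith) ?_ hεd.le
        (by nlinarith) hs.le ?_ ?_
      · rw [xprime_mkPt]; linarith
      · nlinarith
      · rw [hGamma_mkPt]; linarith
      · rw [hGamma_mkPt]; linarith
    have hθ : 1 / (3 + K) ^ 2 * R ^ 2 = s - t := by
      rw [hR, hs]; field_simp; ring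
    have hdist : dist (mkPt x' (g x' s + (1 + ε) * d)) (mkPt x' (g x' t + d)) ≤
        ε * d + K * (ε * d) := by
      refine (dist_mkPt_le _ _ _ _).trans ?_
      rw [sub_self, norm_zero, zero_add, abs_le]
      rw [abs_le] at hgap
      constructor <;> linarith
    have hgrow : ε * ((1 + ε) * d) ≤ 2 * (ε * d) := by
      rw [mul_left_comm]
      exact mul_le_mul_of_nonneg_right (by linarith) hεd.le
    have hstep := hq u _ (mkPt x' (g x' t + d)) (mkPt x' (g x' s + (1 + ε) * d)) t s (ε * d)
      (ε * ((1 + ε) * d)) R h hu hεd hR1 hh hθ.le hθ.ge hsub hstart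
      (by rw [hR]; linarith)
    obtain ⟨t', d', a1, a2, a3, a4, a5⟩ := ih s ((1 + ε) * d) _
      (by positivity) (by positivity) (by nlinarith) (by linarith) hs1 hstep
      (by rw [pow_succ] at hk; linarith)
    refine ⟨t', d', a1, a2, a3, a4, fun x hx => le_trans ?_ (a5 x hx)⟩
    have hd'0 : 0 < d' := by linarith
    have b1 : ε * d / (2 * R) = 1 / (2 * (3 + K)) := by rw [hR]; field_simp
    have b2 : (1 + ε) * d / d' = (1 + ε) * (d / d') := by ring
    rw [b1, b2, mul_pow, one_div, inv_pow, mul_assoc]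
    refine mul_le_mul_of_nonneg_left ?_ hh
    rw [← mul_assoc]
    refine le_mul_of_one_le_left (by positivity) ?_
    rw [← div_eq_inv_mul, one_le_div (by positivity)]
    exact hγ.le

end Chain

section Walk

variable {m : ℕ} {lam Lam K : ℝ}

set_option maxHeartbeats 800000 in
/-- Positivity at unit distance from the boundary reaches the reference point. -/
lemma exists_walk (m : ℕ) (hlam : 0 < lam) (hK : 0 ≤ K) :
    ∃ c : ℝ, 0 < c ∧ ∀ (g : Spc' m → ℝ → ℝ) (u : Spc m × ℝ → ℝ) (x' : Spc' m) (t d h : ℝ),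
      HolderSemi 1 (1 / 2) K g → NonnegSol (n := m + 1) lam Lam u (Cyl g 1) → ‖x'‖ ≤ 3 / 4 →
      0 ≤ h → 1 / 10 ≤ d → d ≤ 4 / 5 → -(1 / 2) ≤ t → t ≤ 48 / 100 →
      (∀ x ∈ Metric.closedBall (mkPt x' (g x' t + d)) (aperture K * (1 / 10)), h ≤ u (x, t)) →
      c * h ≤ u (Ebar g) := by
  set ε := aperture K with hε
  have hε0 : 0 < ε := aperture_pos hK
  have e1 : ε * (1 + K) ^ 2 = 1 / 100 := aperture_mul hK
  set r := ε / 10 with hr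
  have hr0 : 0 < r := by positivity
  set s := r / (4 * (1 + K)) with hs
  have hs0 : 0 < s := by positivity
  have hsK : s * (1 + K) = r / 4 := by rw [hs]; field_simp
  have hrK : r * (1 + K) ≤ 1 / 1000 := by
    rw [hr]; nlinarith [mul_nonneg hε0.le hK, mul_nonneg hε0.le (sq_nonneg K)]
  have hrK0 : 0 ≤ r * K := by positivity
  have hsK0 : 0 ≤ s * K := by positivity
  obtain ⟨N, hN⟩ := exists_nat_ge (1 / s ^ 2)
  have hN0 : (0 : ℝ) < N := lt_of_lt_of_le (by positivity) hN
  set η : ℝ := 1 / N with hη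
  have hη0 : 0 < η := by positivity
  have hηs : η ≤ s ^ 2 := by
    rw [hη, div_le_iff₀ hN0]
    rwa [div_le_iff₀' (by positivity)] at hN
  obtain ⟨q, hq⟩ := exists_chain_step (m + 1) (Lam := Lam) hlam
    (θ₁ := η / 50 / (2 * r) ^ 2) (θ₂ := η / (2 * r) ^ 2) (by positivity)
    (div_le_div_of_nonneg_right (by linarith) (by positivity))
  refine ⟨((1 / 4) ^ q) ^ N, by positivity, fun g u x' t d h hg hu hx' hh hd0 hd1 ht0 ht1 hst => ?_⟩
  set X : ℝ → Spc' m := fun a => (1 - a) • x' with hX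
  set T : ℝ → ℝ := fun a => (1 - a) * t + a / 2 with hT
  set D : ℝ → ℝ := fun a => (1 - a) * d + a / 2 with hD
  set Y : ℝ → Spc m := fun a => mkPt (X a) (g (X a) (T a) + D a) with hY
  have ht2 : 1 / 50 ≤ 1 / 2 - t := by linarith
  have hs1 : s ≤ 1 / 4000 := by linarith
  have hηK : (2 + K) * η ≤ r / 2 := by
    have h1 : (2 + K) * η ≤ (2 + K) * s ^ 2 := mul_le_mul_of_nonneg_left hηs (by linarith)
    have h2 : (2 + K) * s ^ 2 = s * (s + r / 4) := by rw [← hsK]; ring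
    have h3 := mul_le_mul_of_nonneg_right hs1 (by positivity : 0 ≤ s + r / 4)
    linarith
  have hmove : ∀ a, 0 ≤ a → a + η ≤ 1 → ‖X (a + η) - X a‖ ≤ η ∧ |T (a + η) - T a| ≤ η ∧
      |D (a + η) - D a| ≤ η := by
    intro a ha ha1
    refine ⟨?_, ?_, ?_⟩
    · have : X (a + η) - X a = (-η) • x' := by
        simp only [hX]; rw [← sub_smul]; congr 1; ring
      rw [this, norm_smul, norm_neg, Real.norm_of_nonneg hη0.le]
      exact mul_le_of_le_one_right hη0.le (by linarith)
    · have : T (a + η) - T a = η * (1 / 2 - t) := by simp only [hT]; ring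
      rw [this, abs_of_nonneg (mul_nonneg hη0.le (by linarith))]
      exact mul_le_of_le_one_right hη0.le (by linarith)
    · have : D (a + η) - D a = η * (1 / 2 - d) := by simp only [hD]; ring
      rw [this, abs_mul, abs_of_pos hη0]
      exact mul_le_of_le_one_right hη0.le (abs_le.2 ⟨by linarith, by linarith⟩)
  have hstep : ∀ a h', 0 ≤ a → a + η ≤ 1 → 0 ≤ h' →
      (∀ x ∈ Metric.closedBall (Y a) r, h' ≤ u (x, T a)) →
      ∀ x ∈ Metric.closedBall (Y (a + η)) r, h' * (1 / 4) ^ q ≤ u (x, T (a + η)) := by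
    intro a h' ha ha1 hh' hball
    obtain ⟨m1, m2, m3⟩ := hmove a ha ha1
    have hTd : T (a + η) - T a = η * (1 / 2 - t) := by simp only [hT]; ring
    have ha0 : 0 ≤ 1 - a := by linarith
    have hTa : -(1 / 2) ≤ T a := by
      simp only [hT]; linarith [mul_nonneg ha0 (by linarith : 0 ≤ t + 1 / 2)]
    have hTb : T (a + η) ≤ 1 / 2 := by
      simp only [hT]
      linarith [mul_nonneg (sub_nonneg.2 ha1) (by linarith : 0 ≤ 1 / 2 - t)]
    have hDa : 1 / 10 ≤ D a := by
      simp only [hD]; linarith [mul_nonneg ha0 (sub_nonneg.2 hd0)]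
    have hDb : D a ≤ 4 / 5 := by
      simp only [hD]; linarith [mul_nonneg ha0 (sub_nonneg.2 hd1)]
    have hXa : ‖X a‖ ≤ 3 / 4 := by
      simp only [hX]
      rw [norm_smul, Real.norm_of_nonneg ha0]
      exact (mul_le_of_le_one_left (norm_nonneg x') (by linarith)).trans hx'
    have hρ : 2 * (2 * r) + K * (2 * (2 * r) + s) ≤ 5 / 1000 := by linarith
    have hsub : Metric.closedBall (Y a) (2 * (2 * r)) ×ˢ Icc (T a) (T (a + η)) ⊆ Cyl g 1 := by
      refine hg.prod_subset_cyl hK (t := T a) (σ := s) ?_ (by linarith) (by linarith) hs0.le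
        (by linarith [sq_nonneg s]) (by linarith [(abs_le.1 m2).2]) ?_ ?_
      · simp only [hY, xprime_mkPt]; linarith
      · rw [hY, hGamma_mkPt]; linarith
      · rw [hY, hGamma_mkPt]; linarith
    have hgap := hg.abs_sub_le hK m1 hs0.le (m2.trans hηs)
    have hdist : dist (Y (a + η)) (Y a) ≤ r := by
      refine (dist_mkPt_le _ _ _ _).trans ?_
      have : |g (X (a + η)) (T (a + η)) + D (a + η) - (g (X a) (T a) + D a)| ≤
          K * (η + s) + η := by
        rw [add_sub_add_comm]
        exact (abs_add_le _ _).trans (add_le_add hgap m3)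
      linarith
    have hr4 : r / (2 * (2 * r)) = 1 / 4 := by field_simp; norm_num
    have := hq u _ (Y a) (Y (a + η)) (T a) (T (a + η)) r r (2 * r) h' hu hr0 (by linarith) hh'
      (by rw [div_mul_cancel₀ _ (by positivity), hTd]; linarith [mul_le_mul_of_nonneg_left ht2 hη0.le])
      (by rw [div_mul_cancel₀ _ (by positivity)]; exact (abs_le.1 m2).2) hsub hball (by linarith)
    rwa [hr4] at this
  have hiter : ∀ i : ℕ, i ≤ N → ∀ x ∈ Metric.closedBall (Y (i * η)) r,
      h * ((1 / 4) ^ q) ^ i ≤ u (x, T (i * η)) := by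
    intro i
    induction i with
    | zero =>
      intro _ x hx
      have hX0 : X 0 = x' := by simp [hX]
      have hT0 : T 0 = t := by simp [hT]
      have hD0 : D 0 = d := by simp [hD]
      have hY0 : Y 0 = mkPt x' (g x' t + d) := by rw [hY]; simp only; rw [hX0, hT0, hD0]
      simp only [Nat.cast_zero, zero_mul, pow_zero, mul_one] at hx ⊢
      rw [hT0]
      rw [hY0] at hx
      refine hst x (Metric.closedBall_subset_closedBall ?_ hx)
      rw [hr, mul_one_div]
    | succ i ih =>
      intro hi
      have hi' : (i : ℝ) + 1 ≤ N := by exact_mod_cast hi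
      have hiη : (i : ℝ) * η + η ≤ 1 := by
        have : (i : ℝ) * η + η = (i + 1) / N := by rw [hη]; ring
        rw [this]; exact (div_le_one hN0).2 hi'
      have := hstep (i * η) _ (by positivity) hiη (by positivity) (ih (by omega))
      push_cast
      rw [add_mul, one_mul, pow_succ, ← mul_assoc]
      exact this
  have hNη : (N : ℝ) * η = 1 := by rw [hη]; field_simp
  have hlast := hiter N le_rfl (Y (N * η)) (Metric.mem_closedBall_self hr0.le)
  have hX1 : X 1 = 0 := by simp [hX]
  have hT1 : T 1 = 1 / 2 := by simp [hT]
  have hD1 : D 1 = 1 / 2 := by simp [hD]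
  have hE : (Y 1, T 1) = Ebar g := by rw [hY]; simp only; rw [hX1, hT1, hD1]; rfl
  rw [hNη, hE] at hlast
  rwa [mul_comm]

/-- A lower bound on a ball inside the domain gives a lower bound at the reference point. -/
lemma exists_chain (m : ℕ) (hlam : 0 < lam) (hK : 0 ≤ K) :
    ∃ γ : ℕ, ∃ c : ℝ, 0 < c ∧ ∀ (g : Spc' m → ℝ → ℝ) (u : Spc m × ℝ → ℝ) (x : Spc m)
      (t δ h : ℝ), HolderSemi 1 (1 / 2) K g → NonnegSol (n := m + 1) lam Lam u (Cyl g 1) →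
      ‖xprime x‖ ≤ 3 / 4 → 0 ≤ h → 0 < δ → δ ≤ aperture K * hGamma g (x, t) →
      hGamma g (x, t) ≤ 4 / 5 → -(1 / 2) ≤ t → t ≤ 46 / 100 →
      (∀ y ∈ Metric.closedBall x δ, h ≤ u (y, t)) → c * δ ^ γ * h ≤ u (Ebar g) := by
  obtain ⟨γ, H1⟩ := exists_climb m (Lam := Lam) hlam hK
  obtain ⟨c, hc, H2⟩ := exists_walk m (Lam := Lam) hlam hK
  obtain ⟨q, hq⟩ := exists_chain_step (m + 1) (Lam := Lam) hlam
    (θ₁ := 1 / (1 + K) ^ 2) (by positivity) le_rfl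
  refine ⟨q + γ, c, hc, fun g u x t δ h hg hu hx hh hδ0 hδ hd1 ht0 ht1 hst => ?_⟩
  set ε := aperture K with hε
  have hε0 : 0 < ε := aperture_pos hK
  have e1 : ε * (1 + K) ^ 2 = 1 / 100 := aperture_mul hK
  have hεK : 0 ≤ ε * K := by positivity
  have hεK2 : 0 ≤ ε * K ^ 2 := by positivity
  have e2 : ε * (1 + K) ≤ 1 / 100 := by linarith
  have e3 : ε * (2 * (1 + K) + K * (2 * (1 + K) + 1)) ≤ 3 / 100 := by linarith
  have e4 : ε ≤ 1 / 100 := by linarith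
  set d := hGamma g (x, t) with hd
  have hd0 : 0 < d := pos_of_mul_pos_right (hδ0.trans_le hδ) hε0.le
  set x' := xprime x with hx'
  have hxe : x = mkPt x' (g x' t + d) := by
    rw [hd, hGamma]; simp only; rw [add_sub_cancel, hx', mkPt_xprime_xlast]
  set s := t + (ε * d) ^ 2 with hs
  set R := (1 + K) * (ε * d) with hR
  have hεd : 0 < ε * d := by positivity
  have hR1 : ε * d ≤ R := by rw [hR]; exact le_mul_of_one_le_left hεd.le (by linarith)
  have hεd' : ε * d ≤ 1 / 100 := by
    rw [← mul_one (1 / 100 : ℝ)]; exact mul_le_mul e4 (by linarith) hd0.le (by norm_num)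
  have hR2 : R ≤ 1 / 100 := by
    have : R = ε * (1 + K) * d := by rw [hR]; ring
    rw [this, ← mul_one (1 / 100 : ℝ)]
    exact mul_le_mul e2 (by linarith) hd0.le (by norm_num)
  have hts : t ≤ s := by rw [hs]; linarith [sq_nonneg (ε * d)]
  have hsq : (ε * d) ^ 2 ≤ 1 / 100 * (ε * d) := by
    rw [sq]; exact mul_le_mul_of_nonneg_right hεd' hεd.le
  have hs48 : s ≤ 48 / 100 := by rw [hs]; linarith
  have hsd : s - d ^ 2 ≤ 46 / 100 := by
    have : (ε * d) ^ 2 ≤ d ^ 2 := pow_le_pow_left₀ hεd.le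
      (mul_le_of_le_one_left hd0.le (by linarith)) 2
    rw [hs]; linarith
  have hlip : 2 * R + K * (2 * R + ε * d) ≤ 3 / 100 * d := by
    have := mul_le_mul_of_nonneg_right e3 hd0.le
    rw [hR]; linarith
  have hgap := hg.abs_sub_le hK (x' := x') (y' := x') (t := s) (s := t) (ρ := 0) (σ := ε * d)
    (by simp) hεd.le (by rw [hs, add_sub_cancel_left, abs_of_nonneg (by positivity)])
  have hsub : Metric.closedBall x (2 * R) ×ˢ Icc t s ⊆ Cyl g 1 := by
    refine hg.prod_subset_cyl hK (t := t) (σ := ε * d) ?_ (by linarith) (by linarith) hεd.le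
      (by linarith [sq_nonneg (ε * d)]) hs.le ?_ ?_
    · rw [← hx']; linarith
    · rw [← hd]; linarith
    · rw [← hd]; linarith
  have hθ : 1 / (1 + K) ^ 2 * R ^ 2 = s - t := by
    rw [hR, hs]; field_simp; ring
  have hdist : dist (mkPt x' (g x' s + d)) x ≤ K * (ε * d) := by
    rw [hxe]
    refine (dist_mkPt_le _ _ _ _).trans ?_
    rwa [sub_self, norm_zero, zero_add, add_sub_add_right_eq_sub, ← zero_add (ε * d)]
  have hball := hq u _ x (mkPt x' (g x' s + d)) t s δ (ε * d) R h hu hδ0 (hδ.trans hR1) hh hθ.le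
    hθ.ge hsub hst (by rw [hR]; linarith)
  have hδd : δ ≤ d := hδ.trans (mul_le_of_le_one_left hd0.le (by linarith))
  have hδ1 : δ ≤ 1 := by linarith
  have hR0 : 0 < R := hεd.trans_le hR1
  have hδR : δ ≤ δ / (2 * R) := by
    rw [le_div_iff₀ (by positivity)]
    exact mul_le_of_le_one_right hδ0.le (by linarith)
  have hlow : δ ^ q ≤ (δ / (2 * R)) ^ q := pow_le_pow_left₀ hδ0.le hδR q
  have hnn : 0 ≤ h * (δ / (2 * R)) ^ q := by positivity
  rcases le_or_gt d (11 / 100) with hds | hds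
  · obtain ⟨t', d', a1, a2, a3, a4, a5⟩ := H1 g u x' s d _ hg hu hx hnn hd0 hds
      (by linarith) hsd hball
    have hd' : 0 < d' := by linarith
    have hd'2 : d' ^ 2 ≤ (11 / 100) ^ 2 := pow_le_pow_left₀ hd'.le a2 2
    refine le_trans ?_ (H2 g u x' t' d' _ hg hu hx (by positivity) a1 (by linarith) a3
      (by linarith) fun y hy => a5 y (Metric.closedBall_subset_closedBall
        (mul_le_mul_of_nonneg_left a1 hε0.le) hy))
    have h2 : δ ≤ d / d' := by
      rw [le_div_iff₀ hd']
      exact (mul_le_of_le_one_right hδ0.le (by linarith)).trans hδd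
    have h3 : δ ^ γ ≤ (d / d') ^ γ := pow_le_pow_left₀ hδ0.le h2 γ
    rw [mul_assoc, pow_add, mul_comm (_ * _) h, ← mul_assoc h]
    gcongr
  · refine le_trans ?_ (H2 g u x' s d _ hg hu hx hnn (by linarith) hd1 (by linarith) hs48
      fun y hy => hball y (Metric.closedBall_subset_closedBall
        (mul_le_mul_of_nonneg_left (by linarith) hε0.le) hy))
    have h3 : δ ^ γ ≤ 1 := pow_le_one₀ hδ0.le hδ1
    have h4 : δ ^ (q + γ) ≤ (δ / (2 * R)) ^ q := by
      rw [pow_add]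
      exact (mul_le_of_le_one_right (by positivity) h3).trans hlow
    rw [mul_assoc, mul_comm _ h]
    gcongr

end Walk

/-! ### Measure of the part of a cylinder close to the graph -/

section Strip

variable {m : ℕ} {lam Lam K : ℝ} {g : Spc' m → ℝ → ℝ}

/-- The part of a cylinder in a thin layer above the graph has small measure, since it has many
disjoint vertical translates in a slightly larger cylinder. -/
lemma volume_layer_le (hg : Continuous fun q : Spc' m × ℝ => g q.1 q.2) (x : Spc m) (I : Set ℝ)
    (hI : IsOpen I) {r δ : ℝ} {L : ℕ} (hδ : 0 < δ) (hL : L * δ ≤ r) :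
    L * volume {p | p ∈ Metric.ball x r ×ˢ I ∧ 0 < hGamma g p ∧ hGamma g p < δ} ≤
      volume (Metric.ball x (2 * r) ×ˢ I) := by
  set S := {p | p ∈ Metric.ball x r ×ˢ I ∧ 0 < hGamma g p ∧ hGamma g p < δ} with hS
  have hcont := continuous_hGamma hg
  have hSm : MeasurableSet S := by
    have : S = Metric.ball x r ×ˢ I ∩ ({p | 0 < hGamma g p} ∩ {p | hGamma g p < δ}) := rfl
    rw [this]
    exact ((Metric.isOpen_ball.prod hI).inter ((isOpen_lt continuous_const hcont).inter
      (isOpen_lt hcont continuous_const))).measurableSet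
  set e : ℝ → Spc m × ℝ := fun a => (mkPt 0 a, 0) with he
  have hsub : ∀ (p : Spc m × ℝ) a, hGamma g (p + e a) = hGamma g p + a := by
    intro p a
    have h1 : xprime (p.1 + mkPt 0 a) = xprime p.1 := by
      have := xprime_sub (p.1 + mkPt 0 a) p.1
      rw [add_sub_cancel_left, xprime_mkPt] at this
      exact (sub_eq_zero.1 this.symm)
    have h2 : xlast (p.1 + mkPt 0 a) = xlast p.1 + a := by
      have := xlast_sub (p.1 + mkPt 0 a) p.1
      rw [add_sub_cancel_left, xlast_mkPt] at this
      linarith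
    simp only [hGamma, he, Prod.fst_add, Prod.snd_add, h1, h2, add_zero]
    ring
  have hinv : Measure.IsAddRightInvariant (volume : Measure (Spc m × ℝ)) := by
    rw [Measure.volume_eq_prod]; infer_instance
  set F : ℕ → Set (Spc m × ℝ) := fun k => (fun p => p + e (-(k * δ))) ⁻¹' S with hF
  have hFv : ∀ k, volume (F k) = volume S := fun k => measure_preimage_add_right _ _ _
  have hFm : ∀ k, MeasurableSet (F k) := fun k => measurable_add_const _ hSm
  have hFd : ∀ k, ∀ p ∈ F k, k * δ < hGamma g p ∧ hGamma g p < (k + 1) * δ := by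
    rintro k p ⟨-, h1, h2⟩
    rw [hsub] at h1 h2
    constructor <;> linarith
  have hdisj : Pairwise (Function.onFun Disjoint F) := by
    have key : ∀ i j, i < j → Disjoint (F i) (F j) := by
      intro i j hij
      refine Set.disjoint_left.2 fun p hi hj => ?_
      have h1 := (hFd i p hi).2
      have h2 := (hFd j p hj).1
      have : ((i : ℝ) + 1) ≤ j := by exact_mod_cast hij
      nlinarith
    intro i j hij
    rcases lt_or_gt_of_ne hij with h | h
    · exact key i j h
    · exact (key j i h).symm
  have hFsub : ∀ k ∈ Finset.range L, F k ⊆ Metric.ball x (2 * r) ×ˢ I := by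
    rintro k hk p ⟨⟨hp1, hp2⟩, -⟩
    rw [Finset.mem_range] at hk
    have hk' : (k : ℝ) * δ ≤ r :=
      le_trans (mul_le_mul_of_nonneg_right (by exact_mod_cast hk.le) hδ.le) hL
    refine ⟨?_, by simpa [he] using hp2⟩
    rw [Metric.mem_ball, dist_eq_norm] at hp1 ⊢
    have h1 : p.1 - x = ((p + e (-(k * δ))).1 - x) - mkPt 0 (-(k * δ)) := by
      simp only [he, Prod.fst_add]; abel
    have h2 := norm_mkPt_le (0 : Spc' m) (-(k * δ))
    rw [norm_zero, zero_add, abs_neg, abs_of_nonneg (by positivity)] at h2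
    rw [h1]
    refine (norm_sub_le _ _).trans_lt ?_
    linarith
  calc L * volume S = ∑ k ∈ Finset.range L, volume (F k) := by simp [hFv]
    _ = volume (⋃ k ∈ Finset.range L, F k) :=
        (measure_biUnion_finset (fun i _ j _ hij => hdisj hij) fun k _ => hFm k).symm
    _ ≤ _ := measure_mono (iUnion₂_subset hFsub)

/-- Pigeonhole principle for cylinders. -/
lemma exists_subcylinder (n : ℕ) {κ μ : ℝ} (hκ : 0 < κ) (hμ : 0 < μ) :
    ∃ ν : ℝ, 0 < ν ∧ ∀ (E : Set (Spc' n × ℝ)) (x : Spc' n) (t r : ℝ), 0 < r →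
      E ⊆ Metric.ball x r ×ˢ Ioo (t - r ^ 2) t → ENNReal.ofReal (μ * r ^ (n + 2)) ≤ volume E →
      ∃ x0 t0, ENNReal.ofReal (ν * (κ * r) ^ (n + 2)) ≤
        volume (E ∩ Metric.ball x0 (κ * r) ×ˢ Ioo (t0 - (κ * r) ^ 2) t0) := by
  have hcpt : IsCompact (Metric.closedBall (0 : Spc' n) 1 ×ˢ Icc (-1 : ℝ) 0) :=
    (isCompact_closedBall _ _).prod isCompact_Icc
  obtain ⟨F, hF⟩ := hcpt.elim_finite_subcover
    (fun z : Spc' n × ℝ => Metric.ball z.1 κ ×ˢ Ioo (z.2 - κ ^ 2) z.2)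
    (fun z => Metric.isOpen_ball.prod isOpen_Ioo)
    (fun p _ => mem_iUnion.2 ⟨(p.1, p.2 + κ ^ 2 / 2), Metric.mem_ball_self hκ,
      by constructor <;> simp only <;> linarith [pow_pos hκ 2]⟩)
  set ν := μ / ((F.card + 1) * κ ^ (n + 2)) with hν
  have hν0 : 0 < ν := by positivity
  refine ⟨ν, hν0, fun E x t r hr hE hvol => ?_⟩
  have hr2 : 0 < r ^ 2 := by positivity
  by_contra! hcon
  have hcov : E ⊆ ⋃ z ∈ F, E ∩ Metric.ball (x + r • z.1) (κ * r) ×ˢ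
      Ioo (t + r ^ 2 * z.2 - (κ * r) ^ 2) (t + r ^ 2 * z.2) := by
    intro p hp
    obtain ⟨⟨y, s⟩, rfl⟩ := exists_zoom_eq x t hr p
    obtain ⟨h1, h2⟩ := hE hp
    have h1' : y ∈ Metric.closedBall (0 : Spc' n) 1 := by
      refine Metric.ball_subset_closedBall ((zoom_mem_ball_iff (x0 := x) hr).1 ?_)
      rw [mul_one]; exact h1
    have h2' : s ∈ Icc (-1 : ℝ) 0 := by
      simp only [zoom, mem_Ioo] at h2
      obtain ⟨h2, h3⟩ := h2
      constructor
      · by_contra! h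
        have := mul_lt_mul_of_pos_left h hr2
        linarith
      · by_contra! h
        have := mul_pos hr2 h
        linarith
    have hmem := hF (mk_mem_prod h1' h2')
    obtain ⟨z, hzF, hz⟩ := mem_iUnion₂.1 hmem
    obtain ⟨hz1, hz2⟩ := mem_prod.1 hz
    simp only at hz1 hz2
    refine mem_iUnion₂.2 ⟨z, hzF, hp, ?_, ?_, ?_⟩
    · rw [Metric.mem_ball, dist_eq_norm] at hz1 ⊢
      have : (zoom x t r (y, s)).1 - (x + r • z.1) = r • (y - z.1) := by
        simp only [zoom]; rw [smul_sub]; abel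
      rw [this, norm_smul, Real.norm_of_nonneg hr.le, mul_comm κ]
      exact mul_lt_mul_of_pos_left hz1 hr
    · simp only [zoom]
      have := mul_lt_mul_of_pos_left hz2.1 hr2
      linarith
    · simp only [zoom]
      have := mul_lt_mul_of_pos_left hz2.2 hr2
      linarith
  have hlt : volume E < ENNReal.ofReal (μ * r ^ (n + 2)) := by
    refine (measure_mono hcov).trans_lt ((measure_biUnion_finset_le _ _).trans_lt ?_)
    refine (Finset.sum_le_sum fun z _ => (hcon (x + r • z.1) (t + r ^ 2 * z.2)).le).trans_lt ?_
    rw [Finset.sum_const, nsmul_eq_mul, ← ENNReal.ofReal_natCast,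
      ← ENNReal.ofReal_mul (Nat.cast_nonneg _)]
    refine (ENNReal.ofReal_lt_ofReal_iff (by positivity)).2 ?_
    have : F.card * (ν * (κ * r) ^ (n + 2)) = F.card / (F.card + 1) * (μ * r ^ (n + 2)) := by
      rw [hν, mul_pow]; field_simp
    rw [this]
    refine mul_lt_of_lt_one_left (by positivity) ?_
    rw [div_lt_one (by positivity)]
    linarith
  exact absurd hvol (not_le.2 hlt)

end Strip

/-! ### Extension by zero and lower bounds from interior near-maxima -/

section Extension

variable {m : ℕ} {lam Lam K : ℝ} {g : Spc' m → ℝ → ℝ} {u : Spc m × ℝ → ℝ}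

lemma SolAt.congr {n : ℕ} {w w' : Spc' n × ℝ → ℝ} {p : Spc' n × ℝ} (hw : SolAt lam Lam w p)
    (h : w' =ᶠ[𝓝 p] w) : SolAt lam Lam w' p := by
  obtain ⟨hc, a, S, ha, hS, heq⟩ := hw
  have hx : (fun y => w' (y, p.2)) =ᶠ[𝓝 p.1] fun y => w (y, p.2) :=
    (Continuous.continuousAt (by fun_prop : Continuous fun y : Spc' n => (y, p.2))).eventually h
  have ht : (fun s => w' (p.1, s)) =ᶠ[𝓝 p.2] fun s => w (p.1, s) :=
    (Continuous.continuousAt (by fun_prop : Continuous fun s : ℝ => (p.1, s))).eventually h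
  refine ⟨hc.congr_of_eventuallyEq hx, a, S, ha.congr_of_eventuallyEq ht, hS, ?_⟩
  have : hessForm (fun y => w' (y, p.2)) p.1 = hessForm (fun y => w (y, p.2)) p.1 :=
    (hx.fderiv (𝕜 := ℝ)).fderiv_eq
  rwa [this]

lemma indicator_eventuallyEq_self_of_isOpen {α : Type*} [TopologicalSpace α] {Ω : Set α}
    {f : α → ℝ} {p : α} (hΩ : IsOpen Ω) (hp : p ∈ Ω) : Ω.indicator f =ᶠ[𝓝 p] f := by
  filter_upwards [hΩ.mem_nhds hp] with q hq using indicator_of_mem hq f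

/-- A function vanishing on the graph extends continuously by zero across it. -/
lemma continuousOn_indicator_cyl (hg : Continuous fun q : Spc' m × ℝ => g q.1 q.2)
    (hu : ContinuousOn u (Cyl g 1)) (hv : VanishesOn u (Cyl g 1) (graphSet g)) :
    ContinuousOn ((Cyl g 1).indicator u)
      {p | ‖xprime p.1‖ < 1 ∧ -1 < p.2 ∧ p.2 < 1 ∧ hGamma g p < 1} := by
  have hopen := isOpen_cyl hg 1
  rintro p ⟨h1, h2, h3, h4⟩
  refine ContinuousAt.continuousWithinAt ?_
  rcases lt_trichotomy (hGamma g p) 0 with h | h | h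
  · have : (Cyl g 1).indicator u =ᶠ[𝓝 p] fun _ => 0 := by
      filter_upwards [(isOpen_lt (continuous_hGamma hg) continuous_const).mem_nhds h] with q hq
      refine indicator_of_notMem (fun hq' => ?_) u
      exact lt_asymm hq (mem_cyl_iff.1 hq').2.2.2.1
    exact continuousAt_const.congr this.symm
  · have hp : p ∉ Cyl g 1 := fun hp => (mem_cyl_iff.1 hp).2.2.2.1.ne' h
    have hlim : Tendsto u (𝓝[Cyl g 1] p) (𝓝 0) := by
      by_cases hcl : p ∈ closure (Cyl g 1)
      · refine hv p ⟨?_, hcl⟩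
        rw [hGamma, sub_eq_zero] at h
        exact h
      · rw [mem_closure_iff_nhdsWithin_neBot, not_neBot] at hcl
        rw [hcl]
        exact tendsto_bot
    rw [ContinuousAt, indicator_of_notMem hp, Metric.tendsto_nhds]
    intro ε hε
    have := (Metric.tendsto_nhds.1 hlim) ε hε
    rw [eventually_nhdsWithin_iff] at this
    filter_upwards [this] with q hq
    by_cases hqc : q ∈ Cyl g 1
    · rw [indicator_of_mem hqc]; exact hq hqc
    · rw [indicator_of_notMem hqc, dist_self]; exact hε
  · have hp : p ∈ Cyl g 1 := mem_cyl_iff.2 ⟨h1, by linarith, by linarith, h, h4⟩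
    exact ((hu p hp).continuousAt (hopen.mem_nhds hp)).congr
      (indicator_eventuallyEq_self_of_isOpen hopen hp).symm

set_option maxHeartbeats 800000 in
/-- A solution which is almost maximal at the top of a backward cylinder, possibly crossing the
graph, controls the reference value from below. -/
lemma exists_lower_bound_of_almost_max (m : ℕ) (hlam : 0 < lam) (hLam : 0 ≤ Lam) (hK : 0 ≤ K) :
    ∃ γ : ℕ, ∃ c : ℝ, 0 < c ∧ ∀ (g : Spc' m → ℝ → ℝ) (u : Spc m × ℝ → ℝ) (x1 : Spc m)
      (t1 r M : ℝ), Continuous (fun q : Spc' m × ℝ => g q.1 q.2) → HolderSemi 1 (1 / 2) K g →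
      NonnegSol (n := m + 1) lam Lam u (Cyl g 1) → VanishesOn u (Cyl g 1) (graphSet g) →
      0 < r → r * (1 + 2 * K) ≤ 1 / 100 → 0 < M → (x1, t1) ∈ Cyl g 1 → hGamma g (x1, t1) ≤ 3 / 4 →
      ‖xprime x1‖ + 2 * r ≤ 3 / 4 → -(1 / 2) + r ≤ t1 → t1 ≤ 4 / 9 →
      (∀ p ∈ Metric.closedBall x1 r ×ˢ Icc (t1 - r ^ 2) t1, p ∈ Cyl g 1 → u p ≤ 21 / 20 * M) →
      u (x1, t1) = M → c * (M * r ^ γ) ≤ u (Ebar g) := by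
  obtain ⟨μ, hμ, H1⟩ := exists_volume_ge_of_almost_max (m + 1) hlam hLam
  set v := (volume (pcyl (0 : Spc' (m + 1) × ℝ) 1)).toReal with hv
  obtain ⟨L, hL⟩ := exists_nat_ge (max 1 (2 ^ (m + 1 + 2) * v / (μ / 2)))
  have hL1 : (1 : ℝ) ≤ L := (le_max_left _ _).trans hL
  have hL2 : 2 ^ (m + 1 + 2) * v ≤ L * (μ / 2) := by
    rw [← div_le_iff₀ (by positivity)]; exact (le_max_right _ _).trans hL
  set η : ℝ := 1 / L with hη
  have hη0 : 0 < η := by positivity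
  have hη1 : η ≤ 1 := by rw [hη, div_le_one (by linarith)]; exact hL1
  set ε := aperture K with hε
  have hε0 : 0 < ε := aperture_pos hK
  have e1 : ε * (1 + K) ^ 2 = 1 / 100 := aperture_mul hK
  have hεK : 0 ≤ ε * K := by positivity
  have hεK2 : 0 ≤ ε * K ^ 2 := by positivity
  have e2 : ε * (1 + K) ≤ 1 / 100 := by linarith
  set κ := ε * η / 2 with hκ
  have hκ0 : 0 < κ := by positivity
  obtain ⟨ν, hν, H2⟩ := exists_subcylinder (m + 1) hκ0 (by positivity : 0 < μ / 2)
  obtain ⟨cG, hcG, H3⟩ := exists_growth (m + 1) hlam hLam hν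
  obtain ⟨γ, cC, hcC, H4⟩ := exists_chain m (Lam := Lam) hlam hK
  refine ⟨γ, cC * κ ^ γ * (cG / 2), by positivity, ?_⟩
  intro g u x1 t1 r M hgc hg hu hvan hr hrK hM hx1 hd1 hx1' ht1 ht1' hle hM'
  have hrK0 : 0 ≤ r * K := by positivity
  have hr1 : r ≤ 1 / 100 := by linarith
  have hr20 : 0 < r ^ 2 := by positivity
  have hr2 : r ^ 2 ≤ r / 100 := by rw [sq]; linarith [mul_le_mul_of_nonneg_left hr1 hr.le]
  obtain ⟨-, -, -, hd0, -⟩ := mem_cyl_iff.1 hx1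
  set w := (Cyl g 1).indicator u with hw
  have hopen := isOpen_cyl hgc 1
  have hnear : ∀ p ∈ Metric.closedBall x1 r ×ˢ Icc (t1 - r ^ 2) t1,
      ‖xprime p.1‖ < 1 ∧ -1 < p.2 ∧ p.2 < 1 ∧ hGamma g p ≤ 76 / 100 := by
    rintro ⟨y, s⟩ ⟨hy, hs1, hs2⟩
    simp only [Metric.mem_closedBall] at hy hs1 hs2
    have h3 := hg.abs_hGamma_sub_le hK (t := s) (s := t1) hy hr.le
      (abs_le.2 ⟨by linarith, by linarith⟩)
    have h4 := norm_xprime_le (y - x1)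
    rw [← dist_eq_norm, xprime_sub] at h4
    have h5 := norm_le_norm_add_norm_sub' (xprime y) (xprime x1)
    have h6 := (abs_le.1 h3).2
    refine ⟨?_, ?_, ?_, ?_⟩ <;> linarith
  have hwc : ContinuousOn w (Metric.closedBall x1 r ×ˢ Icc (t1 - r ^ 2) t1) :=
    (continuousOn_indicator_cyl hgc hu.continuousOn hvan).mono fun p hp => by
      obtain ⟨a1, a2, a3, a4⟩ := hnear p hp
      exact ⟨a1, a2, a3, by linarith⟩
  have hvol := H1 w x1 t1 r M hr hM hwc
    (fun p hp => by
      by_cases hpc : p ∈ Cyl g 1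
      · rw [hw, indicator_of_mem hpc]; exact hle p hp hpc
      · rw [hw, indicator_of_notMem hpc]; positivity)
    (fun p _ hp0 => by
      have hpc : p ∈ Cyl g 1 := mem_of_indicator_ne_zero hp0.ne'
      exact (hu.solAt p hpc).congr (indicator_eventuallyEq_self_of_isOpen hopen hpc))
    (by rw [hw, indicator_of_mem hx1]; exact hM')
  set E' := {p | p ∈ Metric.ball x1 r ×ˢ Ioo (t1 - r ^ 2) t1 ∧ M / 2 < w p} with hE'
  set S := {p | p ∈ Metric.ball x1 r ×ˢ Ioo (t1 - r ^ 2) t1 ∧ 0 < hGamma g p ∧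
    hGamma g p < η * r} with hS
  have hSvol : volume S ≤ ENNReal.ofReal (μ / 2 * r ^ (m + 1 + 2)) := by
    have h1 := volume_layer_le hgc x1 (Ioo (t1 - r ^ 2) t1) isOpen_Ioo (r := r) (δ := η * r)
      (L := L) (by positivity) (by rw [hη]; field_simp; exact le_rfl)
    have h2 : Metric.ball x1 (2 * r) ×ˢ Ioo (t1 - r ^ 2) t1 ⊆
        pcyl (n := m + 1) (x1, t1) (2 * r) := by
      refine Set.prod_mono le_rfl (Ioo_subset_Ioo ?_ ?_) <;> simp only <;> linarith
    have h3 := h1.trans (measure_mono h2)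
    rw [volume_pcyl _ (by positivity), ← ENNReal.ofReal_toReal (volume_pcyl_lt_top _ _).ne,
      ← hv, ← ENNReal.ofReal_mul (by positivity)] at h3
    have h4 : (2 * r) ^ (m + 1 + 2) * v ≤ L * (μ / 2 * r ^ (m + 1 + 2)) := by
      rw [mul_pow]
      have := mul_le_mul_of_nonneg_right hL2 (by positivity : 0 ≤ r ^ (m + 1 + 2))
      linarith
    have h5 := h3.trans (ENNReal.ofReal_le_ofReal h4)
    rw [ENNReal.ofReal_mul (by positivity), ENNReal.ofReal_natCast] at h5
    have hLne : (L : ℝ≥0∞) ≠ 0 := by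
      have : 0 < (L : ℝ) := by linarith
      exact_mod_cast this.ne'
    exact (ENNReal.mul_le_mul_iff_right hLne (ENNReal.natCast_ne_top L)).1 h5
  have hEvol : ENNReal.ofReal (μ / 2 * r ^ (m + 1 + 2)) ≤ volume (E' \ S) := by
    have h1 : volume E' ≤ volume (E' \ S) + volume S :=
      (measure_mono fun p hp => by
        by_cases h : p ∈ S
        · exact Or.inr h
        · exact Or.inl ⟨hp, h⟩).trans (measure_union_le _ _)
    have h2 : ENNReal.ofReal (μ * r ^ (m + 1 + 2)) =
        ENNReal.ofReal (μ / 2 * r ^ (m + 1 + 2)) + ENNReal.ofReal (μ / 2 * r ^ (m + 1 + 2)) := by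
      rw [← ENNReal.ofReal_add (by positivity) (by positivity)]
      congr 1; ring
    rw [h2] at hvol
    exact (ENNReal.add_le_add_iff_right ENNReal.ofReal_ne_top).1
      (hvol.trans (h1.trans (by gcongr)))
  obtain ⟨x0, t0, hx0⟩ := H2 (E' \ S) x1 t1 r hr (fun p hp => hp.1.1) hEvol
  set r' := κ * r with hr'
  have hr'0 : 0 < r' := by positivity
  have hr'r : r' * (1 + K) ≤ η * r / 200 := by
    have : r' * (1 + K) = ε * (1 + K) * (η * r / 2) := by rw [hr', hκ]; ring
    rw [this]
    have := mul_le_mul_of_nonneg_right e2 (by positivity : 0 ≤ η * r / 2)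
    linarith
  have hηr0 : 0 < η * r := by positivity
  have hηr : η * r ≤ r := mul_le_of_le_one_left hr.le hη1
  have hr'K0 : 0 ≤ r' * K := by positivity
  have hr'1 : r' ≤ 1 / 20000 := by linarith
  have hr'2 : r' ^ 2 ≤ r' / 20000 := by rw [sq]; linarith [mul_le_mul_of_nonneg_left hr'1 hr'0.le]
  have hr'20 : 0 < r' ^ 2 := by positivity
  obtain ⟨⟨y, s⟩, hyE, hyx, hst⟩ : (E' \ S ∩ Metric.ball x0 r' ×ˢ Ioo (t0 - r' ^ 2) t0).Nonempty := by
    refine nonempty_of_measure_ne_zero (μ := volume) (ne_of_gt (lt_of_lt_of_le ?_ hx0))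
    exact ENNReal.ofReal_pos.2 (by positivity)
  have hmemC : ∀ p ∈ E', p ∈ Cyl g 1 := fun p hp =>
    mem_of_indicator_ne_zero (f := u) (lt_trans (by positivity : 0 < M / 2) hp.2).ne'
  have hyd : η * r ≤ hGamma g (y, s) := by
    by_contra! hlt
    exact hyE.2 ⟨hyE.1.1, (mem_cyl_iff.1 (hmemC _ hyE.1)).2.2.2.1, hlt⟩
  have hyn := hnear (y, s)
    (Set.prod_mono Metric.ball_subset_closedBall Ioo_subset_Icc_self hyE.1.1)
  obtain ⟨⟨hyx1, hs1, hs2⟩, -⟩ := hyE.1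
  simp only [Metric.mem_ball] at hyx1 hs1 hs2 hyx hst
  obtain ⟨hst1, hst2⟩ := hst
  have hdepth : ∀ t, s ≤ t → t ≤ s + 3 * r' ^ 2 →
      |hGamma g (x0, t) - hGamma g (y, s)| ≤ η * r / 50 := by
    intro t h1 h2
    refine (hg.abs_hGamma_sub_le hK (t := t) (s := s) (ρ := r') (σ := 2 * r') ?_ (by positivity)
      (abs_le.2 ⟨by linarith, by linarith⟩)).trans ?_
    · rw [dist_comm]; exact hyx.le
    · linarith
  have hD0 := abs_le.1 (hdepth t0 hst2.le (by linarith))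
  have hD2 := abs_le.1 (hdepth (t0 + 2 * r' ^ 2) (by linarith) (by linarith))
  have hx0n : ‖xprime x0‖ ≤ 3 / 4 := by
    have h4 := norm_xprime_le (x0 - x1)
    rw [← dist_eq_norm, xprime_sub] at h4
    have h5 := norm_le_norm_add_norm_sub' (xprime x0) (xprime x1)
    have h6 := dist_triangle_left x0 x1 y
    linarith
  have hsub : Metric.closedBall x0 (r' * 8) ×ˢ Icc (t0 - 2 * r' ^ 2) (t0 + 3 * r' ^ 2) ⊆
      Cyl g 1 := by
    refine hg.prod_subset_cyl hK (t := t0) (σ := 2 * r') ?_ ?_ ?_ (by positivity) ?_ ?_ ?_ ?_ <;>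
      linarith
  have hgrow := H3 u x0 t0 r' (M / 2) hr'0 (by positivity) (hu.continuousOn.mono hsub)
    (fun p hp => hu.nonneg p (hsub hp)) (fun p hp => (hu.solAt p (hsub hp)).superAt)
    (hx0.trans (measure_mono fun p hp => ⟨hp.2, by
      have := hp.1.1.2
      rwa [hw, indicator_of_mem (hmemC p hp.1.1)] at this⟩))
  have hfin := H4 g u x0 (t0 + 2 * r' ^ 2) r' (cG * (M / 2)) hg hu hx0n (by positivity) hr'0
    (by
      have : ε * (η * r / 2) ≤ ε * hGamma g (x0, t0 + 2 * r' ^ 2) :=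
        mul_le_mul_of_nonneg_left (by linarith) hε0.le
      refine le_trans (le_of_eq ?_) this
      rw [hr', hκ]; ring)
    (by linarith) (by linarith) (by linarith)
    (fun z hz => hgrow (z, t0 + 2 * r' ^ 2) ⟨hz, by constructor <;> simp only <;> linarith⟩)
  refine le_trans (le_of_eq ?_) hfin
  rw [hr', mul_pow]; ring

end Extension

/-! ### The Carleson estimate -/

section Carleson

variable {m : ℕ} {lam Lam K : ℝ} {g : Spc' m → ℝ → ℝ} {u : Spc m × ℝ → ℝ}

lemma isCompact_closed_cylinder (hK : 0 ≤ K)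
    (hgc : Continuous fun q : Spc' m × ℝ => g q.1 q.2) (hg0 : g 0 0 = 0)
    (hg : HolderSemi 1 (1 / 2) K g) {a b : ℝ} (ha : -1 ≤ a) (hb : b ≤ 1) :
    IsCompact {p : Spc m × ℝ | ‖xprime p.1‖ ≤ 3 / 4 ∧ 0 ≤ hGamma g p ∧ hGamma g p ≤ 3 / 4 ∧
      a ≤ p.2 ∧ p.2 ≤ b} := by
  have hc := continuous_hGamma hgc
  have hx : Continuous fun p : Spc m × ℝ => ‖xprime p.1‖ :=
    (continuous_xprime.comp continuous_fst).norm
  refine IsCompact.of_isClosed_subset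
    ((isCompact_closedBall (0 : Spc m) (3 / 2 + 7 / 4 * K)).prod (isCompact_Icc (a := a) (b := b)))
    ?_ ?_
  · exact (isClosed_le hx continuous_const).inter ((isClosed_le continuous_const hc).inter
      ((isClosed_le hc continuous_const).inter ((isClosed_le continuous_const continuous_snd).inter
      (isClosed_le continuous_snd continuous_const))))
  · rintro ⟨x, t⟩ ⟨h1, h2, h3, h4, h5⟩
    refine ⟨mem_closedBall_zero_iff.2 ?_, h4, h5⟩
    simp only at h1 h4 h5 ⊢
    have h6 := hg (xprime x) 0 t 0
    rw [hg0, sub_zero, sub_zero, sub_zero, Real.rpow_one] at h6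
    have h7 : |t| ^ (1 / 2 : ℝ) ≤ 1 :=
      Real.rpow_le_one (abs_nonneg t) (abs_le.2 ⟨by linarith, by linarith⟩) (by norm_num)
    have h8 : K * (‖xprime x‖ + |t| ^ (1 / 2 : ℝ)) ≤ K * (7 / 4) :=
      mul_le_mul_of_nonneg_left (by linarith) hK
    have h9 : |xlast x| ≤ 3 / 4 + 7 / 4 * K := by
      simp only [hGamma] at h2 h3
      have := abs_le.1 (h6.trans h8)
      exact abs_le.2 ⟨by linarith, by linarith⟩
    have := norm_mkPt_le (xprime x) (xlast x)
    rw [mkPt_xprime_xlast] at this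
    linarith

set_option maxHeartbeats 800000 in
lemma exists_carleson (m : ℕ) (hlam : 0 < lam) (hLam : 0 ≤ Lam) (hK : 0 ≤ K) :
    ∃ C : ℝ, 0 < C ∧ ∀ (g : Spc' m → ℝ → ℝ) (u : Spc m × ℝ → ℝ),
      Continuous (fun q : Spc' m × ℝ => g q.1 q.2) → g 0 0 = 0 → HolderSemi 1 (1 / 2) K g →
      NonnegSol (n := m + 1) lam Lam u (Cyl g 1) → (∀ p ∈ Cyl g 1, 0 < u p) →
      VanishesOn u (Cyl g 1) (graphSet g) → ∀ p ∈ Cyl g (2 / 3), u p ≤ C * u (Ebar g) := by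
  obtain ⟨q, c, hc, H⟩ := exists_lower_bound_of_almost_max (K := K) m hlam hLam hK
  set γ := q + 1 with hγdef
  set δ : ℝ := min (1 / 100) (1 / (21 * γ)) with hδ
  have hγ : (1 : ℝ) ≤ γ := by simp [γ]
  have hδ0 : 0 < δ := by positivity
  have hδ1 : δ ≤ 1 / 100 := min_le_left _ _
  have hδ2 : δ * (21 * γ) ≤ 1 := by
    rw [← le_div_iff₀ (by positivity)]; exact min_le_right _ _
  have hpow : 20 / 21 ≤ (1 - δ) ^ γ := by
    have := one_add_mul_le_pow (show -2 ≤ -δ by linarith) γ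
    rw [← sub_eq_add_neg] at this
    linarith
  set ε : ℝ := δ / (1 + 2 * K) with hε
  have hε0 : 0 < ε := by positivity
  have hεδ : ε * (1 + 2 * K) = δ := div_mul_cancel₀ _ (by positivity)
  have hεle : ε ≤ δ := div_le_self hδ0.le (by linarith)
  refine ⟨18 ^ γ / (c * ε ^ q), by positivity, ?_⟩
  intro g u hgc hg0 hg hu hpos hvan p hp
  set 𝒦 := {p : Spc m × ℝ | ‖xprime p.1‖ ≤ 3 / 4 ∧ 0 ≤ hGamma g p ∧ hGamma g p ≤ 3 / 4 ∧
      -(1 / 2) ≤ p.2 ∧ p.2 ≤ 4 / 9} with h𝒦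
  have hcomp : IsCompact 𝒦 := isCompact_closed_cylinder hK hgc hg0 hg (by norm_num) (by norm_num)
  set w := (Cyl g 1).indicator u with hw
  have hwc : ContinuousOn w 𝒦 :=
    (continuousOn_indicator_cyl hgc hu.continuousOn hvan).mono fun p hp => by
      obtain ⟨h1, -, h3, h4, h5⟩ := hp
      exact ⟨by linarith, by linarith, by linarith, by linarith⟩
  have hw0 : ∀ p, 0 ≤ w p := fun p => indicator_nonneg hu.nonneg p
  set ρ : Spc m × ℝ → ℝ := fun p =>
    min (min (3 / 4 - ‖xprime p.1‖) (3 / 4 - hGamma g p)) (p.2 + 1 / 2) with hρ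
  have hρc : Continuous ρ :=
    ((continuous_const.sub (continuous_xprime.comp continuous_fst).norm).min
      (continuous_const.sub (continuous_hGamma hgc))).min (continuous_snd.add continuous_const)
  obtain ⟨p1, p2, p3, p4, p5⟩ := mem_cyl_iff.1 hp
  have hp𝒦 : p ∈ 𝒦 := ⟨by linarith, p4.le, by linarith, by linarith, by linarith⟩
  have hpC : p ∈ Cyl g 1 := mem_cyl_iff.2
    ⟨by linarith, by linarith, by linarith, p4, by linarith⟩
  have hρp : 1 / 18 ≤ ρ p := le_min (le_min (by linarith) (by linarith)) (by linarith)
  obtain ⟨⟨x1, t1⟩, hP, hmax⟩ := hcomp.exists_isMaxOn ⟨_, hp𝒦⟩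
    (hwc.mul ((hρc.pow γ).continuousOn))
  have hmax' : ∀ p ∈ 𝒦, w p * ρ p ^ γ ≤ w (x1, t1) * ρ (x1, t1) ^ γ := fun p hp => hmax hp
  set M := w (x1, t1) with hMdef
  set ρ₀ := ρ (x1, t1) with hρ₀
  have hup : w p = u p := indicator_of_mem hpC u
  have hM0 : 0 ≤ M := hw0 _
  have hprod : 0 < M * ρ₀ ^ γ := by
    refine lt_of_lt_of_le ?_ (hmax' p hp𝒦)
    rw [hup]
    have := hpos p hpC
    positivity
  obtain ⟨hP1, hP2, hP3, hP4, hP5⟩ := hP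
  simp only at hP1 hP4 hP5
  have hρ0 : 0 < ρ₀ := by
    refine lt_of_le_of_ne (le_min (le_min ?_ ?_) ?_) fun h => ?_
    · simp only; linarith
    · linarith
    · simp only; linarith
    · rw [← h, zero_pow (by simp [γ]), mul_zero] at hprod
      exact lt_irrefl _ hprod
  have hMpos : 0 < M := by
    refine lt_of_le_of_ne hM0 fun h => ?_
    rw [← h, zero_mul] at hprod
    exact lt_irrefl _ hprod
  have hPC : (x1, t1) ∈ Cyl g 1 := mem_of_indicator_ne_zero hMpos.ne'
  have hρx : ρ₀ ≤ 3 / 4 - ‖xprime x1‖ := (min_le_left _ _).trans (min_le_left _ _)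
  have hρh : ρ₀ ≤ 3 / 4 - hGamma g (x1, t1) := (min_le_left _ _).trans (min_le_right _ _)
  have hρt : ρ₀ ≤ t1 + 1 / 2 := min_le_right _ _
  have hρ1 : ρ₀ ≤ 1 := by linarith [norm_nonneg (xprime x1)]
  set r := ε * ρ₀ with hr
  have hr0 : 0 < r := by positivity
  have hrδ : r * (1 + 2 * K) = δ * ρ₀ := by rw [hr, mul_right_comm, hεδ]
  have hδρ : δ * ρ₀ ≤ 1 / 100 * ρ₀ := mul_le_mul_of_nonneg_right hδ1 hρ0.le
  have hrle : r ≤ δ * ρ₀ := mul_le_mul_of_nonneg_right hεle hρ0.le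
  have hr2 : r ^ 2 ≤ r := by
    rw [sq]; exact mul_le_of_le_one_left hr0.le (by linarith)
  have hle : ∀ p ∈ Metric.closedBall x1 r ×ˢ Icc (t1 - r ^ 2) t1, p ∈ Cyl g 1 →
      u p ≤ 21 / 20 * M := by
    rintro ⟨y, s⟩ ⟨hy, hs1, hs2⟩ hyC
    simp only [Metric.mem_closedBall] at hy hs1 hs2
    have h3 := (abs_le.1 (hg.abs_hGamma_sub_le hK (t := s) (s := t1) hy hr0.le
      (abs_le.2 ⟨by linarith, by linarith [sq_nonneg r]⟩))).2
    have h4 := norm_xprime_le (y - x1)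
    rw [← dist_eq_norm, xprime_sub] at h4
    have h5 := norm_le_norm_add_norm_sub' (xprime y) (xprime x1)
    have h6 : r + K * (r + r) = δ * ρ₀ := by rw [← hrδ]; ring
    obtain ⟨-, -, -, h7, -⟩ := mem_cyl_iff.1 hyC
    have hyρ : (1 - δ) * ρ₀ ≤ ρ (y, s) := by
      rw [sub_mul, one_mul]
      refine le_min (le_min ?_ ?_) ?_
      · simp only; linarith
      · linarith
      · simp only; linarith
    have hy𝒦 : (y, s) ∈ 𝒦 :=
      ⟨by simp only; linarith, h7.le, by linarith, by simp only; linarith, by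
        simp only; linarith⟩
    have h8 : u (y, s) * ((1 - δ) * ρ₀) ^ γ ≤ M * ρ₀ ^ γ := by
      refine le_trans ?_ (hmax' _ hy𝒦)
      rw [hw, indicator_of_mem hyC]
      refine mul_le_mul_of_nonneg_left ?_ (hu.nonneg _ hyC)
      exact pow_le_pow_left₀ (mul_nonneg (by linarith) hρ0.le) hyρ _
    rw [mul_pow, ← mul_assoc] at h8
    have h9 := le_of_mul_le_mul_right h8 (by positivity)
    have h10 := mul_le_mul_of_nonneg_left hpow (hu.nonneg _ hyC)
    linarith
  have hbound := H g u x1 t1 r M hgc hg hu hvan hr0 (by linarith) hMpos hPC hP3 (by linarith)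
    (by linarith) hP5 hle (by rw [hMdef, hw, indicator_of_mem hPC])
  have hM1 : M * ρ₀ ^ γ ≤ M * ρ₀ ^ q :=
    mul_le_mul_of_nonneg_left (pow_le_pow_of_le_one hρ0.le hρ1 (Nat.le_succ q)) hM0
  have hu1 : u p * (1 / 18) ^ γ ≤ M * ρ₀ ^ q := by
    refine le_trans ?_ ((hmax' p hp𝒦).trans hM1)
    rw [hup]
    exact mul_le_mul_of_nonneg_left (pow_le_pow_left₀ (by norm_num) hρp _) (hu.nonneg p hpC)
  have hu2 : u p ≤ 18 ^ γ * (M * ρ₀ ^ q) := by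
    rwa [one_div, inv_pow, ← div_eq_mul_inv, div_le_iff₀ (by positivity), mul_comm] at hu1
  refine hu2.trans ?_
  rw [div_mul_eq_mul_div, le_div_iff₀ (by positivity)]
  calc 18 ^ γ * (M * ρ₀ ^ q) * (c * ε ^ q) = 18 ^ γ * (c * (M * r ^ q)) := by
        rw [hr, mul_pow]; ring
    _ ≤ 18 ^ γ * u (Ebar g) := by gcongr

end Carleson

end

/-- **Carleson estimate in `C^{1,1/2}` domains** (Lemma 2.6). -/
theorem carleson_estimate (m : ℕ) (hm : 1 ≤ m) (lam Lam K : ℝ)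
    (hlam : 0 < lam) (hlamLam : lam ≤ Lam) (hK : 0 < K) :
    ∃ C : ℝ, 0 < C ∧
      ∀ (A : Spc m → Matrix (Fin (m + 1)) (Fin (m + 1)) ℝ), IsElliptic lam Lam A →
      ∀ g : Spc' m → ℝ → ℝ,
        Continuous (fun q : Spc' m × ℝ => g q.1 q.2) → g 0 0 = 0 →
        HolderSemi 1 (1 / 2) K g →
      ∀ u : Spc m × ℝ → ℝ,
        SolvesL A u (Cyl g 1) →
        (∀ p ∈ Cyl g 1, 0 < u p) →
        VanishesOn u (Cyl g 1) (graphSet g) →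
        ∀ p ∈ Cyl g (2 / 3), u p ≤ C * u (Ebar g) := by
  obtain ⟨C, hC, H⟩ := exists_carleson (K := K) m hlam (hlam.le.trans hlamLam) hK.le
  refine ⟨C, hC, fun A hA g hgc hg0 hg u hu hpos hvan => H g u hgc hg0 hg ?_ hpos hvan⟩
  have hS : ∀ p ∈ Cyl g 1, SolAt (n := m + 1) lam Lam u p := fun p hp => hu.solAt hA hp
  have h0 : ∀ p ∈ Cyl g 1, 0 ≤ u p := fun p hp => (hpos p hp).le
  exact ⟨continuousOn_of_solAt (n := m + 1) hlam (hlam.le.trans hlamLam) (isOpen_cyl hgc 1) hS h0,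
    h0, hS⟩
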